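/- arXiv:1007.1314 — 2 statements merged into one kernel-verified Lean document; each statement's English description precedes it below -/
import Mathlib

section
/- Let R be a valuation ring of rank 1 and let A be a smooth R-algebra. Then codimension is subadditive under intersection in Spec A: for any prime ideals p and p' of A and any prime ideal q of A that is minimal over p + p', one has ht(q) ≤ ht(p) + ht(p'). -/
/-- The height of an ideal of a commutative ring: for a prime ideal `p`, this is the
supremum of the lengths `r` of chains of primes `p₀ ⊊ p₁ ⊊ ⋯ ⊊ p_r = p`. -/
noncomputable def primeHt {A : Type*} [CommRing A] (p : Ideal A) : ℕ∞ :=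
  ⨆ (h : p.IsPrime), Order.height (⟨p, h⟩ : PrimeSpectrum A)

section
open MvPolynomial

namespace SubCodim

/-- A family in `A` algebraically independent modulo the prime `P`, over the image of `R`. -/
def Ind (R : Type*) [CommRing R] {A : Type*} [CommRing A] [Algebra R A] (P : Ideal A)
    {ι : Type*} (a : ι → A) : Prop :=
  ∀ F : MvPolynomial ι R, aeval a F ∈ P → ∀ m, algebraMap R A (F.coeff m) ∈ P

/-- transcendence degree of the residue field of `P` over its image in `R`. -/
noncomputable def td (R : Type*) [CommRing R] {A : Type*} [CommRing A] [Algebra R A]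
    (P : Ideal A) : ℕ := sSup {d | ∃ a : Fin d → A, Ind R P a}

theorem ind_transport {R A R' A' : Type*} [CommRing R] [CommRing A] [CommRing R'] [CommRing A']
    [Algebra R A] [Algebra R' A'] (φ : R →+* R') (hφ : Function.Surjective φ) (ψ : A →+* A')
    (hc : ∀ r, ψ (algebraMap R A r) = algebraMap R' A' (φ r)) (P' : Ideal A') {ι : Type*}
    (a : ι → A) : Ind R (P'.comap ψ) a ↔ Ind R' P' (ψ ∘ a) := by
  have key : ∀ F : MvPolynomial ι R, ψ (aeval a F) = aeval (ψ ∘ a) (F.map φ) := by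
    intro F
    have hc' : ψ.comp (algebraMap R A) = (algebraMap R' A').comp φ := RingHom.ext hc
    rw [aeval_def, aeval_def, eval₂_map, ← hc', MvPolynomial.hom_eval₂]
    rfl
  constructor
  · intro h F hF m
    obtain ⟨G, rfl⟩ := MvPolynomial.map_surjective φ hφ F
    have := h G (by rw [Ideal.mem_comap, key]; exact hF) m
    rw [Ideal.mem_comap, hc] at this
    simpa [coeff_map] using this
  · intro h F hF m
    rw [Ideal.mem_comap, key] at hF
    have := h _ hF m
    rw [Ideal.mem_comap, hc]
    simpa [coeff_map] using this

theorem setOf_transport {R A R' A' : Type*} [CommRing R] [CommRing A] [CommRing R'] [CommRing A']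
    [Algebra R A] [Algebra R' A'] (φ : R →+* R') (hφ : Function.Surjective φ) (ψ : A →+* A')
    (hψ : Function.Surjective ψ)
    (hc : ∀ r, ψ (algebraMap R A r) = algebraMap R' A' (φ r)) (P' : Ideal A') :
    {d | ∃ a : Fin d → A, Ind R (P'.comap ψ) a} = {d | ∃ a : Fin d → A', Ind R' P' a} := by
  ext d
  constructor
  · rintro ⟨a, ha⟩
    exact ⟨_, (ind_transport φ hφ ψ hc P' a).1 ha⟩
  · rintro ⟨a, ha⟩
    choose b hb using fun i => hψ (a i)
    refine ⟨b, (ind_transport φ hφ ψ hc P' b).2 ?_⟩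
    have : ψ ∘ b = a := funext hb
    rwa [this]

theorem td_transport {R A R' A' : Type*} [CommRing R] [CommRing A] [CommRing R'] [CommRing A']
    [Algebra R A] [Algebra R' A'] (φ : R →+* R') (hφ : Function.Surjective φ) (ψ : A →+* A')
    (hψ : Function.Surjective ψ)
    (hc : ∀ r, ψ (algebraMap R A r) = algebraMap R' A' (φ r)) (P' : Ideal A') :
    td R (P'.comap ψ) = td R' P' := by
  rw [td, td, setOf_transport φ hφ ψ hψ hc]

theorem ind_bot_iff {R B : Type*} [CommRing R] [CommRing B] [Algebra R B]
    (hinj : Function.Injective (algebraMap R B)) {ι : Type*} (a : ι → B) :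
    Ind R (⊥ : Ideal B) a ↔ AlgebraicIndependent R a := by
  rw [algebraicIndependent_iff]
  constructor
  · intro h F hF
    ext m
    have := h F (by simpa using hF) m
    rw [Ideal.mem_bot] at this
    simpa using (map_eq_zero_iff _ hinj).1 this
  · intro h F hF m
    rw [h F (by simpa using hF)]
    simp

theorem setOf_bot {R B : Type*} [CommRing R] [IsDomain R] [CommRing B] [IsDomain B] [Algebra R B]
    (hinj : Function.Injective (algebraMap R B)) :
    {d | ∃ a : Fin d → B, Ind R (⊥ : Ideal B) a} = {d : ℕ | (d : Cardinal) ≤ Algebra.trdeg R B} := by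
  ext d
  simp only [Set.mem_ofPred_eq, ind_bot_iff hinj]
  constructor
  · rintro ⟨a, ha⟩
    simpa using ha.lift_cardinalMk_le_trdeg
  · intro h
    have : FaithfulSMul R B := (faithfulSMul_iff_algebraMap_injective R B).2 hinj
    obtain ⟨s, hs⟩ := exists_isTranscendenceBasis R B
    rw [← hs.cardinalMk_eq_trdeg] at h
    have h' : Cardinal.lift (Cardinal.mk (Fin d)) ≤ Cardinal.lift.{0} (Cardinal.mk s) := by
      simpa using h
    obtain ⟨f⟩ := Cardinal.lift_mk_le'.1 h'
    exact ⟨_, hs.1.comp f f.injective⟩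

theorem td_bot {R B : Type*} [CommRing R] [IsDomain R] [CommRing B] [IsDomain B] [Algebra R B]
    [Algebra.FiniteType R B]
    (hinj : Function.Injective (algebraMap R B)) :
    (td R (⊥ : Ideal B) : Cardinal) = Algebra.trdeg R B := by
  rw [td, setOf_bot hinj]
  obtain ⟨n, hn⟩ := Cardinal.lt_aleph0.1 (trdeg_lt_aleph0_of_finiteType (R := R) (S := B))
  rw [hn]
  simp only [Nat.cast_le]
  have : {d : ℕ | d ≤ n} = Set.Iic n := rfl
  rw [this, csSup_Iic]

theorem setOf_quot {R A : Type*} [CommRing R] [CommRing A] [Algebra R A] (P : Ideal A) [P.IsPrime] :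
    {d | ∃ a : Fin d → A, Ind R P a} =
      {d | ∃ a : Fin d → A ⧸ P, Ind (R ⧸ P.under R) (⊥ : Ideal (A ⧸ P)) a} := by
  rw [← setOf_transport (Ideal.Quotient.mk (P.under R)) Ideal.Quotient.mk_surjective
    (Ideal.Quotient.mk P) Ideal.Quotient.mk_surjective (fun r => rfl) ⊥]
  have : Ideal.comap (Ideal.Quotient.mk P) ⊥ = P := by
    rw [← RingHom.ker_eq_comap_bot, Ideal.mk_ker]
  rw [this]

theorem td_quot {R A : Type*} [CommRing R] [CommRing A] [Algebra R A] (P : Ideal A) [P.IsPrime] :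
    td R P = td (R ⧸ P.under R) (⊥ : Ideal (A ⧸ P)) := by
  rw [td, td, setOf_quot]

instance finiteType_quot {R A : Type*} [CommRing R] [CommRing A] [Algebra R A]
    [Algebra.FiniteType R A] (P : Ideal A) [P.IsPrime] :
    Algebra.FiniteType (R ⧸ P.under R) (A ⧸ P) :=
  Algebra.FiniteType.of_restrictScalars_finiteType R _ _

theorem bddAbove_td {R A : Type*} [CommRing R] [CommRing A] [Algebra R A]
    [Algebra.FiniteType R A] (P : Ideal A) [P.IsPrime] :
    BddAbove {d | ∃ a : Fin d → A, Ind R P a} := by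
  have hinj : Function.Injective (algebraMap (R ⧸ P.under R) (A ⧸ P)) :=
    FaithfulSMul.algebraMap_injective _ _
  rw [setOf_quot, setOf_bot hinj]
  obtain ⟨n, hn⟩ := Cardinal.lt_aleph0.1
    (trdeg_lt_aleph0_of_finiteType (R := R ⧸ P.under R) (S := A ⧸ P))
  rw [hn]
  exact ⟨n, fun d hd => by simpa using hd⟩

theorem le_td {R A : Type*} [CommRing R] [CommRing A] [Algebra R A]
    [Algebra.FiniteType R A] (P : Ideal A) [P.IsPrime] {d : ℕ} (a : Fin d → A) (ha : Ind R P a) :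
    d ≤ td R P := le_csSup (bddAbove_td P) ⟨a, ha⟩

theorem exists_td {R A : Type*} [CommRing R] [CommRing A] [Algebra R A]
    [Algebra.FiniteType R A] (P : Ideal A) [P.IsPrime] :
    ∃ a : Fin (td R P) → A, Ind R P a := by
  refine Nat.sSup_mem (s := {d | ∃ a : Fin d → A, Ind R P a}) ?_ (bddAbove_td P)
  refine ⟨0, Fin.elim0, ?_⟩
  intro F hF m
  rw [MvPolynomial.eq_C_of_isEmpty F] at hF ⊢
  rw [coeff_C]
  split_ifs
  · simpa using hF
  · simp

end SubCodim

end

section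
open MvPolynomial

namespace SubCodim

theorem exists_dvd_all {R ι : Type*} [CommRing R] [IsDomain R] [ValuationRing R] (s : Finset ι)
    (hs : s.Nonempty) (c : ι → R) : ∃ i ∈ s, ∀ j ∈ s, c i ∣ c j := by
  classical
  induction hs using Finset.Nonempty.cons_induction with
  | singleton a => exact ⟨a, by simp, by simp⟩
  | cons a s ha hs ih =>
    obtain ⟨i, hi, h⟩ := ih
    rcases ValuationRing.dvd_total (c a) (c i) with h1 | h1
    · refine ⟨a, by simp, ?_⟩
      intro j hj
      rcases Finset.mem_cons.1 hj with rfl | hj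
      · exact dvd_rfl
      · exact h1.trans (h j hj)
    · refine ⟨i, by simp [hi], ?_⟩
      intro j hj
      rcases Finset.mem_cons.1 hj with rfl | hj
      · exact h1
      · exact h j hj

theorem ind_mono {R A : Type*} [CommRing R] [IsDomain R] [ValuationRing R] [CommRing A]
    [Algebra R A] {P' P : Ideal A} [P'.IsPrime] [P.IsPrime] (hle : P' ≤ P) {ι : Type*} {a : ι → A}
    (ha : Ind R P a) : Ind R P' a := by
  intro F hF m
  by_contra hm
  have hne : F.support.Nonempty := by
    refine ⟨m, ?_⟩
    rw [mem_support_iff]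
    intro h
    rw [h] at hm
    simp at hm
  obtain ⟨m0, hm0, hd⟩ := exists_dvd_all F.support hne F.coeff
  have hd' : ∀ j, F.coeff m0 ∣ F.coeff j := by
    intro j
    by_cases hj : j ∈ F.support
    · exact hd j hj
    · rw [notMem_support_iff.1 hj]; exact dvd_zero _
  obtain ⟨G, hG⟩ := (MvPolynomial.C_dvd_iff_dvd_coeff _ _).2 hd'
  have hc0 : F.coeff m0 ≠ 0 := mem_support_iff.1 hm0
  have hG1 : G.coeff m0 = 1 := by
    have h := congrArg (coeff m0) hG
    rw [coeff_C_mul] at h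
    exact mul_left_cancel₀ hc0 (by rw [← h, mul_one])
  have hcP : algebraMap R A (F.coeff m0) ∉ P' := by
    intro h
    obtain ⟨r, hr⟩ := hd' m
    apply hm
    rw [hr, map_mul]
    exact P'.mul_mem_right _ h
  rw [hG, map_mul, aeval_C] at hF
  have h1 := ha G (hle ((Ideal.IsPrime.mem_or_mem inferInstance hF).resolve_left hcP)) m0
  rw [hG1, map_one] at h1
  exact (Ideal.ne_top_iff_one P).1 (Ideal.IsPrime.ne_top inferInstance) h1

theorem aeval_mem {R A : Type*} [CommRing R] [CommRing A] [Algebra R A] (P : Ideal A)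
    {ι : Type*} (a : ι → A) (F : MvPolynomial ι R) (h : ∀ m, algebraMap R A (F.coeff m) ∈ P) :
    aeval a F ∈ P := by
  rw [aeval_def, eval₂_eq]
  exact P.sum_mem fun m _ => P.mul_mem_right _ (h m)

theorem ind_cons_aux {R A : Type*} [CommRing R] [CommRing A]
    [Algebra R A] {P' P : Ideal A} [P'.IsPrime] (hle : P' ≤ P)
    (hu : P.under R ≤ P'.under R) {ι : Type*} {a : ι → A}
    (ha : Ind R P a) (x : A) (hx : x ∈ P) (hx' : x ∉ P') :
    ∀ (n : ℕ) (f : Polynomial (MvPolynomial ι R)), f.natDegree < n →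
      f.eval₂ (aeval a : MvPolynomial ι R →ₐ[R] A).toRingHom x ∈ P' →
      ∀ i m, algebraMap R A ((f.coeff i).coeff m) ∈ P' := by
  intro n
  induction n with
  | zero => intro f hf; omega
  | succ n ih =>
    intro f hf h i m
    have hdec := f.divX_mul_X_add
    have h0 : ∀ m, algebraMap R A ((f.coeff 0).coeff m) ∈ P' := by
      intro m
      refine hu (ha (f.coeff 0) ?_ m)
      have h' := hle h
      rw [← hdec, Polynomial.eval₂_add, Polynomial.eval₂_mul_X, Polynomial.eval₂_C] at h'
      exact (Ideal.add_mem_iff_right _ (P.mul_mem_left _ hx)).1 h'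
    rcases i with _ | i
    · exact h0 m
    have h2 : f.divX.eval₂ (aeval a : MvPolynomial ι R →ₐ[R] A).toRingHom x ∈ P' := by
      rw [← hdec, Polynomial.eval₂_add, Polynomial.eval₂_mul_X, Polynomial.eval₂_C] at h
      have h3 := (Ideal.add_mem_iff_left _ (aeval_mem P' a _ h0)).1 h
      exact (Ideal.IsPrime.mem_or_mem inferInstance h3).resolve_right hx'
    rw [← Polynomial.coeff_divX]
    by_cases hdeg : f.natDegree = 0
    · rw [Polynomial.eq_C_of_natDegree_eq_zero hdeg]
      simp
    · exact ih f.divX (by rw [Polynomial.natDegree_divX_eq_natDegree_tsub_one]; omega) h2 i m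

theorem ind_cons {R A : Type*} [CommRing R] [CommRing A]
    [Algebra R A] {P' P : Ideal A} [P'.IsPrime] (hle : P' ≤ P)
    (hu : P.under R ≤ P'.under R) {d : ℕ} {a : Fin d → A}
    (ha : Ind R P a) (x : A) (hx : x ∈ P) (hx' : x ∉ P') :
    Ind R P' (Fin.cons x a : Fin (d + 1) → A) := by
  intro F hF m
  have key : ∀ F, (finSuccEquiv R d F).eval₂ (aeval a : MvPolynomial (Fin d) R →ₐ[R] A).toRingHom x
      = aeval (Fin.cons x a : Fin (d + 1) → A) F := by
    intro F
    induction F using MvPolynomial.induction_on with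
    | C r => simp [finSuccEquiv_apply]
    | add p q hp hq =>
      simp only [map_add, Polynomial.eval₂_add, hp, hq]
    | mul_X p i hp =>
      simp only [map_mul, Polynomial.eval₂_mul, hp, aeval_X]
      congr 1
      refine Fin.cases ?_ (fun j => ?_) i
      · simp [finSuccEquiv_X_zero]
      · simp [finSuccEquiv_X_succ]
  have := ind_cons_aux hle hu ha x hx hx' _ (finSuccEquiv R d F) (Nat.lt_succ_self _)
    (by rw [key]; exact hF) (m 0) (Finsupp.tail m)
  rw [finSuccEquiv_coeff_coeff, Finsupp.cons_tail] at this
  exact this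

theorem td_le {R A : Type*} [CommRing R] [IsDomain R] [ValuationRing R] [CommRing A]
    [Algebra R A] [Algebra.FiniteType R A] {P' P : Ideal A} [P'.IsPrime] [P.IsPrime] (hle : P' ≤ P) :
    td R P ≤ td R P' := by
  obtain ⟨a, ha⟩ := exists_td (R := R) P
  exact le_td P' a (ind_mono hle ha)

theorem td_lt {R A : Type*} [CommRing R] [CommRing A]
    [Algebra R A] [Algebra.FiniteType R A] {P' P : Ideal A} [P'.IsPrime] [P.IsPrime] (hlt : P' < P)
    (hu : P.under R ≤ P'.under R) : td R P + 1 ≤ td R P' := by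
  obtain ⟨a, ha⟩ := exists_td (R := R) P
  obtain ⟨x, hx, hx'⟩ := SetLike.exists_of_lt hlt
  exact le_td P' _ (ind_cons hlt.le hu ha x hx hx')

theorem valuationRing_of_surjective {R S : Type*} [CommRing R] [IsDomain R] [ValuationRing R]
    [CommRing S] [IsDomain S] (f : R →+* S) (hf : Function.Surjective f) : ValuationRing S := by
  refine (ValuationRing.iff_dvd_total (R := S)).2 ⟨fun a b => ?_⟩
  obtain ⟨a, rfl⟩ := hf a
  obtain ⟨b, rfl⟩ := hf b
  exact (ValuationRing.dvd_total a b).imp (map_dvd f) (map_dvd f)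

instance valuationRing_quot {R : Type*} [CommRing R] [IsDomain R] [ValuationRing R]
    (P : Ideal R) [P.IsPrime] : ValuationRing (R ⧸ P) :=
  valuationRing_of_surjective _ Ideal.Quotient.mk_surjective

theorem flat_of_injective {R B : Type*} [CommRing R] [IsDomain R] [ValuationRing R]
    [CommRing B] [IsDomain B] [Algebra R B] (hinj : Function.Injective (algebraMap R B)) :
    Module.Flat R B := by
  have : FaithfulSMul R B := (faithfulSMul_iff_algebraMap_injective R B).2 hinj
  rw [Module.Flat.flat_iff_torsion_eq_bot_of_isBezout, ← Submodule.isTorsionFree_iff_torsion_eq_bot]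
  infer_instance

theorem isIntegrallyClosed_fin (R : Type*) [CommRing R] [IsDomain R] [IsIntegrallyClosed R] (n : ℕ) :
    IsIntegrallyClosed (MvPolynomial (Fin n) R) := by
  induction n with
  | zero => exact IsIntegrallyClosed.of_equiv (isEmptyAlgEquiv R (Fin 0)).symm.toRingEquiv
  | succ n ih =>
    exact IsIntegrallyClosed.of_equiv (finSuccEquiv R n).symm.toRingEquiv

theorem isIntegrallyClosed_mv (R : Type*) [CommRing R] [IsDomain R] [IsIntegrallyClosed R]
    (ι : Type*) [Finite ι] :
    IsIntegrallyClosed (MvPolynomial ι R) := by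
  have := Fintype.ofFinite ι
  have := isIntegrallyClosed_fin R (Fintype.card ι)
  exact IsIntegrallyClosed.of_equiv (renameEquiv R (Fintype.equivFin ι).symm).toRingEquiv

end SubCodim

end

section
open MvPolynomial

namespace SubCodim

theorem quasiFiniteAt_of_isolated {R S : Type*} [CommRing R] [CommRing S] [Algebra R S]
    [Algebra.FiniteType R S] (q : Ideal S) [hq : q.IsPrime]
    (hmin : ∀ q' : Ideal S, q'.IsPrime → q' ≤ q → q'.under R = q.under R → q' = q)
    (hmax : ∀ q' : Ideal S, q'.IsPrime → q ≤ q' → q'.under R = q.under R → q' = q) :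
    Algebra.QuasiFiniteAt R q := by
  refine Algebra.QuasiFiniteAt.of_isOpen_singleton_fiber (⟨q, hq⟩ : PrimeSpectrum S) ?_
  set p := (⟨q, hq⟩ : PrimeSpectrum S).comap (algebraMap R S) with hp
  let e := PrimeSpectrum.preimageOrderIsoFiber R S p
  let h := PrimeSpectrum.preimageHomeomorphFiber R S p
  rw [← h.isOpen_image, Set.image_singleton]
  have : IsNoetherianRing (p.asIdeal.Fiber S) :=
    Algebra.FiniteType.isNoetherianRing p.asIdeal.ResidueField _
  have : IsJacobsonRing (p.asIdeal.Fiber S) :=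
    isJacobsonRing_of_finiteType (A := p.asIdeal.ResidueField)
  refine ((PrimeSpectrum.isOpen_singleton_tfae_of_isNoetherian_of_isJacobsonRing _).out 0 2).2 ?_
  have aux : ∀ y : PrimeSpectrum (p.asIdeal.Fiber S), (y ≤ e ⟨⟨q, hq⟩, rfl⟩ ∨ e ⟨⟨q, hq⟩, rfl⟩ ≤ y)
      → y = e ⟨⟨q, hq⟩, rfl⟩ := by
    intro y hy
    obtain ⟨⟨⟨q', hq'⟩, hu⟩, rfl⟩ := e.surjective y
    rw [e.le_iff_le, e.le_iff_le] at hy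
    have hu' : q'.under R = q.under R := congrArg PrimeSpectrum.asIdeal hu
    have : q' = q := hy.elim (fun h => hmin q' hq' h hu') (fun h => hmax q' hq' h hu')
    subst this
    rfl
  constructor
  · rw [PrimeSpectrum.isClosed_singleton_iff_isMaximal]
    obtain ⟨M, hM, hle⟩ := Ideal.exists_le_maximal (h ⟨⟨q, hq⟩, rfl⟩).asIdeal
      (h ⟨⟨q, hq⟩, rfl⟩).2.ne_top
    have := aux ⟨M, hM.isPrime⟩ (Or.inr hle)
    have h2 : M = (h ⟨⟨q, hq⟩, rfl⟩).asIdeal := congrArg PrimeSpectrum.asIdeal this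
    rw [← h2]
    exact hM
  · intro x y hxy hx
    rw [Set.mem_singleton_iff] at hx
    subst hx
    exact aux y (Or.inl ((PrimeSpectrum.le_iff_specializes _ _).2 hxy))

end SubCodim

end

section
open MvPolynomial

namespace SubCodim

theorem core_setup {R B : Type*} [CommRing R] [CommRing B]
    [Algebra R B] [Algebra.FiniteType R B] {r : ℕ} (f : Fin r → B) (q : Ideal B)
    [q.IsPrime] (hq : q ∈ (Ideal.span (Set.range f)).minimalPrimes)
    (z : Fin (td R q) → B) (hz : Ind R q z) :
    ∃ r₀ ∉ q, IsIntegral (Algebra.adjoin R (Set.range (Sum.elim f z))) r₀ ∧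
      ∀ x : B, ∃ m, IsIntegral (Algebra.adjoin R (Set.range (Sum.elim f z))) (r₀ ^ m * x) := by
  set S := Algebra.adjoin R (Set.range (Sum.elim f z)) with hS
  have hfS : ∀ i, f i ∈ S := fun i => Algebra.subset_adjoin ⟨Sum.inl i, rfl⟩
  have hzS : ∀ F : MvPolynomial (Fin (td R q)) R, aeval z F ∈ S := by
    intro F
    have h1 : Algebra.adjoin R (Set.range z) ≤ S := by
      apply Algebra.adjoin_mono
      rintro _ ⟨i, rfl⟩
      exact ⟨Sum.inr i, rfl⟩
    apply h1
    rw [Algebra.adjoin_range_eq_range_aeval]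
    exact ⟨F, rfl⟩
  have : Algebra.FiniteType S B := Algebra.FiniteType.of_restrictScalars_finiteType R S B
  have tr : ∀ q' : Ideal B, q'.under S = q.under S → ∀ x ∈ S, x ∈ q' ↔ x ∈ q := by
    intro q' h x hx
    have h3 : (⟨x, hx⟩ : S) ∈ q'.under S ↔ (⟨x, hx⟩ : S) ∈ q.under S := by rw [h]
    simpa [Ideal.under_def] using h3
  have hqf : Algebra.QuasiFiniteAt S q := by
    apply quasiFiniteAt_of_isolated
    · intro q' hq' hle hu
      refine le_antisymm hle (hq.2 ⟨hq', ?_⟩ hle)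
      rw [Ideal.span_le]
      rintro _ ⟨i, rfl⟩
      refine (tr q' hu _ (hfS i)).2 (hq.1.2 (Ideal.subset_span ⟨i, rfl⟩))
    · intro q' hq' hle hu
      by_contra hne
      have hlt : q < q' := lt_of_le_of_ne hle (Ne.symm hne)
      obtain ⟨x, hx, hx'⟩ := SetLike.exists_of_lt hlt
      have hRS : ∀ c : R, algebraMap R B c ∈ S := fun c => S.algebraMap_mem c
      have hz' : Ind R q' z := by
        intro F hF m
        exact hle (hz F ((tr q' hu _ (hzS F)).1 hF) m)
      have hu2 : q'.under R ≤ q.under R := by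
        intro c hc
        exact (tr q' hu _ (hRS c)).1 hc
      have := le_td q _ (ind_cons hle hu2 hz' x hx hx')
      omega
  exact Algebra.zariskisMainProperty_iff.1 (Algebra.ZariskisMainProperty.of_finiteType q)

theorem core_trdeg {R B : Type*} [CommRing R] [IsDomain R] [CommRing B] [IsDomain B]
    [Algebra R B] [Algebra.FiniteType R B] (hinj : Function.Injective (algebraMap R B))
    {ι : Type} [Fintype ι] (g : ι → B) (q : Ideal B) [q.IsPrime]
    (h : ∃ r₀ ∉ q, IsIntegral (Algebra.adjoin R (Set.range g)) r₀ ∧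
      ∀ x : B, ∃ m, IsIntegral (Algebra.adjoin R (Set.range g)) (r₀ ^ m * x)) :
    td R (⊥ : Ideal B) ≤ Fintype.card ι ∧
    (Fintype.card ι ≤ td R (⊥ : Ideal B) → AlgebraicIndependent R g) := by
  obtain ⟨r₀, hr₀, hint, hall⟩ := h
  have hne : r₀ ≠ 0 := fun h => hr₀ (h ▸ q.zero_mem)
  have halg : Algebra.IsAlgebraic (Algebra.adjoin R (Set.range g)) B := by
    refine ⟨fun x => ?_⟩
    obtain ⟨m, hm⟩ := hall x
    exact IsAlgebraic.of_mul (mem_nonZeroDivisors_of_ne_zero (pow_ne_zero m hne))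
      (hint.pow m).isAlgebraic hm.isAlgebraic
  have : FaithfulSMul R B := (faithfulSMul_iff_algebraMap_injective R B).2 hinj
  constructor
  · have h1 := Algebra.IsAlgebraic.trdeg_le_cardinalMk R (Set.range g)
    rw [← td_bot hinj] at h1
    have h2 : Cardinal.mk (Set.range g) ≤ (Fintype.card ι : Cardinal) := by
      have := Cardinal.mk_range_le_lift (f := g)
      simpa using this
    exact_mod_cast h1.trans h2
  · intro h
    refine (Algebra.IsAlgebraic.isTranscendenceBasis_of_lift_le_trdeg_of_finite R g ?_).1
    rw [← td_bot hinj]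
    simpa using h

theorem goingDown_integralClosure (S B : Type*) [CommRing S] [IsDomain S] [IsIntegrallyClosed S]
    [CommRing B] [IsDomain B] [Algebra S B] (hinj : Function.Injective (algebraMap S B)) :
    Algebra.HasGoingDown S (integralClosure S B) := by
  have : FaithfulSMul S B := (faithfulSMul_iff_algebraMap_injective S B).2 hinj
  have : FaithfulSMul S (integralClosure S B) := by
    rw [faithfulSMul_iff_algebraMap_injective]
    intro x y h
    exact hinj (congrArg Subtype.val h)
  have : Algebra.IsIntegral S (integralClosure S B) := inferInstance
  have : IsDomain (integralClosure S B) := inferInstance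
  infer_instance

theorem core_goingDown {S B : Type*} [CommRing S] [IsDomain S] [IsIntegrallyClosed S]
    [CommRing B] [IsDomain B] [Algebra S B] (hinj : Function.Injective (algebraMap S B))
    (I q : Ideal B) [q.IsPrime] (hq : q ∈ I.minimalPrimes) (r₀ : B) (hr₀ : r₀ ∉ q)
    (hint : IsIntegral S r₀) (hall : ∀ x : B, ∃ m, IsIntegral S (r₀ ^ m * x))
    (P0 : Ideal S) (hP0 : P0.IsPrime) (hle0 : P0 ≤ q.under S)
    (hI : I ≤ P0.map (algebraMap S B)) : q.under S ≤ P0 := by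
  have hgd := goingDown_integralClosure S B hinj
  let C := integralClosure S B
  obtain ⟨pC, hpC, hpCp, hpCo⟩ := Ideal.exists_ideal_le_liesOver_of_le (S := C) (p := P0)
    (q := q.under S) (q.under C) hle0
  have memC : ∀ (s : S), algebraMap S C s ∈ pC ↔ s ∈ P0 := by
    intro s
    rw [hpCo.over]
    rfl
  let ρ : C := ⟨r₀, hint⟩
  have hρ : ρ ∉ pC := fun h => hr₀ (hpC h)
  let q'' : Ideal B :=
    { carrier := {x | ∃ N, ∃ c ∈ pC, r₀ ^ N * x = algebraMap C B c}
      zero_mem' := ⟨0, 0, pC.zero_mem, by simp⟩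
      add_mem' := by
        rintro x y ⟨N, c, hc, hx⟩ ⟨M, d, hd, hy⟩
        refine ⟨N + M, ρ ^ M * c + ρ ^ N * d,
          pC.add_mem (pC.mul_mem_left _ hc) (pC.mul_mem_left _ hd), ?_⟩
        have hr : algebraMap C B ρ = r₀ := rfl
        rw [map_add, map_mul, map_mul, ← hx, ← hy, map_pow, map_pow, hr]
        ring
      smul_mem' := by
        rintro b x ⟨N, c, hc, hx⟩
        obtain ⟨m, hm⟩ := hall b
        refine ⟨m + N, ⟨_, hm⟩ * c, pC.mul_mem_left _ hc, ?_⟩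
        have hr : algebraMap C B ⟨_, hm⟩ = r₀ ^ m * b := rfl
        rw [map_mul, ← hx, hr, smul_eq_mul]
        ring }
  have memq : ∀ x, x ∈ q'' ↔ ∃ N, ∃ c ∈ pC, r₀ ^ N * x = algebraMap C B c := fun x => Iff.rfl
  have injC : Function.Injective (algebraMap C B) := Subtype.val_injective
  have memqC : ∀ c : C, algebraMap C B c ∈ q'' → c ∈ pC := by
    intro c hc
    obtain ⟨N, d, hd, h⟩ := (memq _).1 hc
    have : ρ ^ N * c = d := injC (by rw [map_mul, map_pow]; exact h)
    rw [← this] at hd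
    exact (hpCp.mem_or_mem hd).resolve_left (fun h => hρ (hpCp.mem_of_pow_mem _ h))
  have hq''le : q'' ≤ q := by
    intro x hx
    obtain ⟨N, c, hc, h⟩ := (memq _).1 hx
    have h1 : r₀ ^ N * x ∈ q := by rw [h]; exact hpC hc
    exact (Ideal.IsPrime.mem_or_mem inferInstance h1).resolve_left
      (fun h => hr₀ (Ideal.IsPrime.mem_of_pow_mem inferInstance _ h))
  have hq''p : q''.IsPrime := by
    refine ⟨fun h => ?_, ?_⟩
    · exact Ideal.IsPrime.ne_top (I := q) inferInstance (top_le_iff.1 (h ▸ hq''le))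
    · intro x y hxy
      obtain ⟨a, ha⟩ := hall x
      obtain ⟨b, hb⟩ := hall y
      have h1 : (⟨_, ha⟩ * ⟨_, hb⟩ : C) ∈ pC := by
        apply memqC
        have : algebraMap C B (⟨_, ha⟩ * ⟨_, hb⟩ : C) = r₀ ^ (a + b) * (x * y) := by
          rw [map_mul]
          change (r₀ ^ a * x) * (r₀ ^ b * y) = _
          ring
        rw [this]
        exact q''.mul_mem_left _ hxy
      rcases hpCp.mem_or_mem h1 with h | h
      · exact Or.inl ⟨a, _, h, rfl⟩
      · exact Or.inr ⟨b, _, h, rfl⟩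
  have hfq : I ≤ q'' := by
    refine hI.trans (Ideal.map_le_iff_le_comap.2 ?_)
    intro s hs
    refine ⟨0, algebraMap S C s, (memC _).2 hs, ?_⟩
    rw [pow_zero, one_mul, ← IsScalarTower.algebraMap_apply]
  have hqq : q ≤ q'' := hq.2 ⟨hq''p, hfq⟩ hq''le
  intro c hc
  have h1 : algebraMap S B c ∈ q'' := hqq hc
  rw [← memC]
  apply memqC
  rwa [← IsScalarTower.algebraMap_apply]

theorem core_domain2 {R B : Type*} [CommRing R] [IsDomain R] [IsIntegrallyClosed R]
    [CommRing B] [IsDomain B]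
    [Algebra R B] [Algebra.FiniteType R B] {r : ℕ} (f : Fin r → B) (q : Ideal B)
    [q.IsPrime] (hq : q ∈ (Ideal.span (Set.range f)).minimalPrimes)
    {δ : ℕ} (z : Fin δ → B) 
    (h : ∃ r₀ ∉ q, IsIntegral (Algebra.adjoin R (Set.range (Sum.elim f z))) r₀ ∧
      ∀ x : B, ∃ m, IsIntegral (Algebra.adjoin R (Set.range (Sum.elim f z))) (r₀ ^ m * x))
    (hind : AlgebraicIndependent R (Sum.elim f z)) : q.under R = ⊥ := by
  obtain ⟨r₀, hr₀, hint, hall⟩ := h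
  have : IsIntegrallyClosed (MvPolynomial (Fin r ⊕ Fin δ) R) := isIntegrallyClosed_mv R _
  have : IsIntegrallyClosed (Algebra.adjoin R (Set.range (Sum.elim f z))) := IsIntegrallyClosed.of_equiv hind.aevalEquiv.toRingEquiv
  let φ : MvPolynomial (Fin r ⊕ Fin δ) R →ₐ[R] MvPolynomial (Fin δ) R :=
    aeval (Sum.elim (fun _ => 0) X)
  let P0 : Ideal (Algebra.adjoin R (Set.range (Sum.elim f z))) := RingHom.ker (φ.toRingHom.comp hind.aevalEquiv.symm.toAlgHom.toRingHom)
  have hP0 : P0.IsPrime := RingHom.ker_isPrime _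
  have memP0 : ∀ F, hind.aevalEquiv F ∈ P0 ↔ φ F = 0 := by
    intro F
    simp [P0, RingHom.mem_ker]
  have hle0 : P0 ≤ q.under (Algebra.adjoin R (Set.range (Sum.elim f z))) := by
    intro s hs
    obtain ⟨F, rfl⟩ := hind.aevalEquiv.surjective s
    rw [memP0] at hs
    rw [Ideal.under_def, Ideal.mem_comap]
    rw [hind.algebraMap_aevalEquiv, ← Ideal.Quotient.eq_zero_iff_mem]
    have h2 : ∀ F, Ideal.Quotient.mkₐ R q (aeval (Sum.elim f z) F) =
        Ideal.Quotient.mkₐ R q (aeval z (φ F)) := by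
      intro F
      have : (Ideal.Quotient.mkₐ R q).comp (aeval (Sum.elim f z)) =
        ((Ideal.Quotient.mkₐ R q).comp (aeval z)).comp φ := by
        ext i
        rcases i with i | i
        · simp only [AlgHom.comp_apply, aeval_X, Sum.elim_inl, φ, map_zero]
          exact Ideal.Quotient.eq_zero_iff_mem.2 (hq.1.2 (Ideal.subset_span ⟨i, rfl⟩))
        · simp [φ]
      exact DFunLike.congr_fun this F
    have h3 := h2 F
    rw [hs, map_zero, map_zero] at h3
    exact h3
  have hres := core_goingDown (S := Algebra.adjoin R (Set.range (Sum.elim f z)))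
    Subtype.val_injective _ q hq r₀ hr₀ hint hall P0 hP0 hle0 (by
      rw [Ideal.span_le]
      rintro _ ⟨i, rfl⟩
      have h1 := Ideal.mem_map_of_mem (algebraMap (Algebra.adjoin R (Set.range (Sum.elim f z))) B)
        ((memP0 (X (Sum.inl i))).2 (by simp [φ]))
      rw [hind.algebraMap_aevalEquiv] at h1
      simpa using h1)
  rw [eq_bot_iff]
  intro c hc
  have h2 : hind.aevalEquiv (MvPolynomial.C c) ∈ P0 := by
    apply hres
    rw [Ideal.under_def, Ideal.mem_comap, hind.algebraMap_aevalEquiv]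
    simpa using hc
  rw [memP0] at h2
  simpa [φ] using h2

end SubCodim

end

section
open MvPolynomial

namespace SubCodim

theorem core_domain {R B : Type*} [CommRing R] [IsDomain R] [IsIntegrallyClosed R]
    [CommRing B] [IsDomain B]
    [Algebra R B] [Algebra.FiniteType R B] (hinj : Function.Injective (algebraMap R B))
    {r : ℕ} (f : Fin r → B) (q : Ideal B)
    [q.IsPrime] (hq : q ∈ (Ideal.span (Set.range f)).minimalPrimes) :
    td R (⊥ : Ideal B) ≤ r + td R q ∧ (q.under R ≠ ⊥ → td R (⊥ : Ideal B) + 1 ≤ r + td R q) := by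
  obtain ⟨z, hz⟩ := exists_td (R := R) q
  have h := core_setup f q hq z hz
  have h2 := core_trdeg hinj (Sum.elim f z) q h
  rw [Fintype.card_sum, Fintype.card_fin, Fintype.card_fin] at h2
  refine ⟨h2.1, fun hne => ?_⟩
  by_contra hlt
  exact hne (core_domain2 f q hq z h (h2.2 (by omega)))

theorem core {R B : Type*} [CommRing R] [IsDomain R] [ValuationRing R] [CommRing B]
    [Algebra R B] [Algebra.FiniteType R B] {r : ℕ} (f : Fin r → B) (P' q : Ideal B)
    [P'.IsPrime] [hqp : q.IsPrime] (hq : q ∈ (P' ⊔ Ideal.span (Set.range f)).minimalPrimes) :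
    td R P' ≤ r + td R q ∧ (¬ q.under R ≤ P'.under R → td R P' + 1 ≤ r + td R q) := by
  have hP'q : P' ≤ q := le_sup_left.trans hq.1.2
  have hfq : Ideal.span (Set.range f) ≤ q := le_sup_right.trans hq.1.2
  let mk := Ideal.Quotient.mk P'
  have hmk : Function.Surjective mk := Ideal.Quotient.mk_surjective
  have hker : RingHom.ker mk = P' := Ideal.mk_ker
  have hcomap : (q.map mk).comap mk = q := by
    rw [Ideal.comap_map_of_surjective' _ hmk, hker, sup_eq_left.2 hP'q]
  have hprime : (q.map mk).IsPrime := Ideal.map_isPrime_of_surjective hmk (by rw [hker]; exact hP'q)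
  have hmin : q.map mk ∈ (Ideal.span (Set.range (mk ∘ f))).minimalPrimes := by
    refine ⟨⟨hprime, ?_⟩, ?_⟩
    · rw [Ideal.span_le]
      rintro _ ⟨i, rfl⟩
      exact Ideal.mem_map_of_mem _ (hfq (Ideal.subset_span ⟨i, rfl⟩))
    · rintro q2 ⟨hq2, hfq2⟩ hle
      rw [Ideal.map_le_iff_le_comap]
      refine hq.2 ⟨hq2.comap _, ?_⟩ ?_
      · refine sup_le ?_ ?_
        · exact hker.ge.trans (Ideal.comap_mono bot_le)
        · rw [Ideal.span_le]
          rintro _ ⟨i, rfl⟩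
          exact hfq2 (Ideal.subset_span ⟨i, rfl⟩)
      · conv_rhs => rw [← hcomap]
        exact Ideal.comap_mono hle
  have hinj : Function.Injective (algebraMap (R ⧸ P'.under R) (B ⧸ P')) :=
    FaithfulSMul.algebraMap_injective _ _
  have h := core_domain hinj (mk ∘ f) (q.map mk) hmin
  rw [← td_quot, ← td_transport (Ideal.Quotient.mk (P'.under R)) Ideal.Quotient.mk_surjective
    mk hmk (fun r => rfl), hcomap] at h
  refine ⟨h.1, fun hne => h.2 fun hbot => hne ?_⟩
  intro c hc
  have : Ideal.Quotient.mk (P'.under R) c ∈ (q.map mk).under (R ⧸ P'.under R) :=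
    Ideal.mem_map_of_mem mk hc
  rw [hbot, Ideal.mem_bot] at this
  exact Ideal.Quotient.eq_zero_iff_mem.1 this

end SubCodim

end

section
open MvPolynomial TensorProduct

namespace SubCodim

theorem hom_eq_of_unramified {S A E F : Type*} [CommRing S] [CommRing A] [Algebra S A]
    [Algebra.FormallyUnramified S A] [Algebra.EssFiniteType S A] [CommRing E] [IsDomain E]
    [CommRing F] [Nontrivial F] (α β : A →+* E)
    (hS : α.comp (algebraMap S A) = β.comp (algebraMap S A)) (γ : E →+* F)
    (hγ : γ.comp α = γ.comp β) : α = β := by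
  algebraize [α.comp (algebraMap S A)]
  let α' : A →ₐ[S] E := { α with commutes' := fun s => rfl }
  let β' : A →ₐ[S] E := { β with commutes' := fun s => (RingHom.congr_fun hS s).symm }
  obtain ⟨t, ht, ht1⟩ := (Algebra.FormallyUnramified.iff_exists_tensorProduct
    (R := S) (S := A)).1 inferInstance
  let ε : A ⊗[S] A →ₐ[S] E := Algebra.TensorProduct.productMap α' β'
  have h1 : ∀ t : A ⊗[S] A, γ (ε t) = γ (α (Algebra.TensorProduct.lmul' S t)) := by
    intro t
    induction t with
    | zero => simp
    | add x y hx hy => simp only [map_add, hx, hy]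
    | tmul x y =>
      have hy : γ (α y) = γ (β y) := RingHom.congr_fun hγ y
      have h2 : ε (x ⊗ₜ y) = α x * β y := Algebra.TensorProduct.productMap_apply_tmul _ _ _ _
      rw [h2, map_mul, ← hy, ← map_mul, ← map_mul]
      rfl
  have hne : ε t ≠ 0 := by
    intro h0
    have := h1 t
    rw [h0, ht1, map_zero, map_one, map_one] at this
    exact zero_ne_one this
  ext a
  have h3 := congrArg ε (ht a)
  rw [map_mul, map_zero, map_sub] at h3
  have h4 := (mul_eq_zero.1 h3).resolve_right hne
  have h5 : ε (1 ⊗ₜ a) = β a := by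
    have : ε (1 ⊗ₜ a) = α 1 * β a := Algebra.TensorProduct.productMap_apply_tmul _ _ _ _
    rw [this, map_one, one_mul]
  have h6 : ε (a ⊗ₜ 1) = α a := by
    have : ε (a ⊗ₜ 1) = α a * β 1 := Algebra.TensorProduct.productMap_apply_tmul _ _ _ _
    rw [this, map_one, mul_one]
  rw [h5, h6, sub_eq_zero] at h4
  exact h4.symm

theorem flat_to_field {S L : Type*} [CommRing S] [IsDomain S] [Field L] (f : S →+* L)
    (hf : Function.Injective f) : f.Flat := by
  have h1 : f = (IsFractionRing.lift hf : FractionRing S →+* L).comp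
      (algebraMap S (FractionRing S)) := by
    ext x
    simp
  rw [h1]
  refine RingHom.Flat.comp ?_ (RingHom.Flat.of_isField (Field.toIsField _) _)
  rw [RingHom.flat_algebraMap_iff]
  infer_instance

theorem regular_of_flat {S T : Type*} [CommRing S] [IsDomain S] [CommRing T] (f : S →+* T)
    (hf : f.Flat) (x : S) (hx : x ≠ 0) : IsSMulRegular T (f x) := by
  algebraize [f]
  have h1 : IsSMulRegular S x := fun a b h => mul_left_cancel₀ hx h
  exact h1.of_flat (S := T)

theorem tensor_regular {R D D' : Type*} [CommRing R] [IsDomain R] [ValuationRing R]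
    [CommRing D] [IsDomain D] [CommRing D'] [IsDomain D'] [Algebra R D] [Algebra R D']
    (hD : Function.Injective (algebraMap R D)) (hD' : Function.Injective (algebraMap R D'))
    {ι κ : Type*} (u : ι → D) (v : κ → D') (hu : AlgebraicIndependent R u)
    (hv : AlgebraicIndependent R v) (F : MvPolynomial (ι ⊕ κ) R) (hF : F ≠ 0) :
    aeval (Sum.elim (fun i => u i ⊗ₜ[R] (1 : D')) (fun j => (1 : D) ⊗ₜ[R] v j)) F ∈
      nonZeroDivisors (D ⊗[R] D') := by
  let L := FractionRing D
  let L' := FractionRing D'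
  have hDL : Function.Injective (algebraMap D L) := IsFractionRing.injective D L
  have hDL' : Function.Injective (algebraMap D' L') := IsFractionRing.injective D' L'
  let iD : D →ₐ[R] L := IsScalarTower.toAlgHom R D L
  let iD' : D' →ₐ[R] L' := IsScalarTower.toAlgHom R D' L'
  have flatD' : Module.Flat R D' := flat_of_injective hD'
  have flatL : Module.Flat R L := flat_of_injective (by
    rw [IsScalarTower.algebraMap_eq R D L]; exact hDL.comp hD)
  let ψ : D ⊗[R] D' →ₐ[R] L ⊗[R] L' := Algebra.TensorProduct.map iD iD'
  have hψ : Function.Injective ψ :=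
    TensorProduct.map_injective_of_flat_flat iD.toLinearMap iD'.toLinearMap hDL hDL'
  let μ : MvPolynomial ι R ⊗[R] MvPolynomial κ R →ₐ[R] D ⊗[R] D' :=
    Algebra.TensorProduct.map (aeval u) (aeval v)
  let θ : MvPolynomial ι R ⊗[R] MvPolynomial κ R →ₐ[R] L ⊗[R] L' :=
    Algebra.TensorProduct.map (iD.comp (aeval u)) (iD'.comp (aeval v))
  have hθ : θ.toRingHom.Flat :=
    RingHom.Flat.tensorProductMap
      (flat_to_field (iD.comp (aeval u)).toRingHom (hDL.comp hu))
      (flat_to_field (iD'.comp (aeval v)).toRingHom (hDL'.comp hv))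
  have hθμ : ∀ x, θ x = ψ (μ x) := by
    intro x
    have : θ = ψ.comp μ := by
      ext <;> simp [θ, ψ, μ]
    rw [this]
    rfl
  let e := MvPolynomial.tensorEquivSum R ι κ R
  have he : ∀ F, μ (e.symm F) =
      aeval (Sum.elim (fun i => u i ⊗ₜ[R] (1 : D')) (fun j => (1 : D) ⊗ₜ[R] v j)) F := by
    intro F
    have : μ =
      (aeval (Sum.elim (fun i => u i ⊗ₜ[R] (1 : D')) (fun j => (1 : D) ⊗ₜ[R] v j))).comp
        e.toAlgHom := by
      ext i <;> simp [e, μ]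
    rw [this]
    simp
  have hne : e.symm F ≠ 0 := by simpa using hF
  have : IsDomain (MvPolynomial ι R ⊗[R] MvPolynomial κ R) := e.toMulEquiv.isDomain _
  have hreg : IsSMulRegular (L ⊗[R] L') (θ (e.symm F)) := by
    exact regular_of_flat θ.toRingHom hθ _ hne
  rw [← he, mem_nonZeroDivisors_iff_right]
  intro x hx
  apply hψ
  apply hreg
  simp only [smul_eq_mul, map_zero, mul_zero]
  rw [hθμ, ← map_mul, mul_comm, hx, map_zero]

theorem finiteType_tensor (R D D' : Type*) [CommRing R]
    [CommRing D] [CommRing D'] [Algebra R D] [Algebra R D']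
    [h : Algebra.FiniteType R D] [Algebra.FiniteType R D'] : Algebra.FiniteType R (D ⊗[R] D') :=
  Algebra.FiniteType.trans (S := D) h (Algebra.FiniteType.baseChange D)

theorem td_tensor {R D D' : Type*} [CommRing R] [IsDomain R] [ValuationRing R]
    [CommRing D] [IsDomain D] [CommRing D'] [IsDomain D'] [Algebra R D] [Algebra R D']
    [Algebra.FiniteType R D] [Algebra.FiniteType R D']
    (hD : Function.Injective (algebraMap R D)) (hD' : Function.Injective (algebraMap R D'))
    (Q : Ideal (D ⊗[R] D')) (hQ : Q ∈ minimalPrimes (D ⊗[R] D')) [Q.IsPrime] :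
    td R (⊥ : Ideal D) + td R (⊥ : Ideal D') ≤ td R Q ∧ Q.under R = ⊥ := by
  have := finiteType_tensor R D D'
  obtain ⟨u, hu⟩ := exists_td (R := R) (⊥ : Ideal D)
  obtain ⟨v, hv⟩ := exists_td (R := R) (⊥ : Ideal D')
  rw [ind_bot_iff hD] at hu
  rw [ind_bot_iff hD'] at hv
  have key : ∀ F : MvPolynomial (Fin (td R (⊥ : Ideal D)) ⊕ Fin (td R (⊥ : Ideal D'))) R,
      aeval (Sum.elim (fun i => u i ⊗ₜ[R] (1 : D')) (fun j => (1 : D) ⊗ₜ[R] v j)) F ∈ Q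
      → F = 0 := by
    intro F hFQ
    by_contra hF
    exact Set.disjoint_left.1 (Ideal.disjoint_nonZeroDivisors_of_mem_minimalPrimes hQ) hFQ
      (tensor_regular hD hD' u v hu hv F hF)
  constructor
  · refine le_td Q (Sum.elim (fun i => u i ⊗ₜ[R] (1 : D')) (fun j => (1 : D) ⊗ₜ[R] v j) ∘
      finSumFinEquiv.symm) ?_
    intro F hF m
    have h1 := key (rename finSumFinEquiv.symm F) (by rw [aeval_rename]; exact hF)
    have h2 : F = 0 := by
      apply rename_injective _ finSumFinEquiv.symm.injective
      rw [h1, map_zero]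
    rw [h2]
    simp
  · rw [eq_bot_iff]
    intro c hc
    have := key (C c) (by rw [aeval_C]; exact hc)
    simpa using this

end SubCodim

end

section
open MvPolynomial TensorProduct

namespace SubCodim

section LemmaD
variable {R R₁ A D D' F : Type*} [CommRing R] [CommRing R₁]
    [CommRing A] [CommRing D] [CommRing D']
    [CommRing F] [Algebra R A] [Algebra R₁ D] [Algebra R₁ D'] [Algebra R₁ F]

theorem lemmaD_min {n : ℕ} [IsDomain F]
    [Algebra (MvPolynomial (Fin n) R) A] [IsScalarTower R (MvPolynomial (Fin n) R) A]
    [Algebra.FormallyUnramified (MvPolynomial (Fin n) R) A]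
    [Algebra.FiniteType (MvPolynomial (Fin n) R) A]
    (φ : R →+* R₁) (ρ : A →+* D) (hρ : Function.Surjective ρ)
    (ρ' : A →+* D') (hρ' : Function.Surjective ρ') (χ : D →ₐ[R₁] F) (χ' : D' →ₐ[R₁] F)
    (hc : ∀ r, ρ (algebraMap R A r) = algebraMap R₁ D (φ r))
    (hc' : ∀ r, ρ' (algebraMap R A r) = algebraMap R₁ D' (φ r))
    (π : A →+* F) (hπ : ∀ a, χ (ρ a) = π a) (hπ' : ∀ a, χ' (ρ' a) = π a)
    (hmin : RingHom.ker π ∈ (RingHom.ker ρ ⊔ RingHom.ker ρ').minimalPrimes)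
    (Q2 : Ideal (D ⊗[R₁] D')) (hQ2 : Q2.IsPrime)
    (hf : ∀ i : Fin n, ρ (algebraMap (MvPolynomial (Fin n) R) A (X i)) ⊗ₜ[R₁] (1 : D')
      - (1 : D) ⊗ₜ[R₁] ρ' (algebraMap (MvPolynomial (Fin n) R) A (X i)) ∈ Q2)
    (hle : Q2 ≤ RingHom.ker (Algebra.TensorProduct.productMap χ χ')) :
    RingHom.ker (Algebra.TensorProduct.productMap χ χ') ≤ Q2 := by
  let mk := Ideal.Quotient.mk Q2
  let α : A →+* (D ⊗[R₁] D') ⧸ Q2 :=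
    (mk.comp (Algebra.TensorProduct.includeLeft (R := R₁) (S := R₁) (A := D) (B := D')).toRingHom).comp ρ
  let β : A →+* (D ⊗[R₁] D') ⧸ Q2 :=
    (mk.comp (Algebra.TensorProduct.includeRight (R := R₁) (A := D) (B := D')).toRingHom).comp ρ'
  have hα : ∀ a, α a = mk (ρ a ⊗ₜ 1) := fun a => rfl
  have hβ : ∀ a, β a = mk (1 ⊗ₜ ρ' a) := fun a => rfl
  let γ : (D ⊗[R₁] D') ⧸ Q2 →+* F :=
    Ideal.Quotient.lift Q2 (Algebra.TensorProduct.productMap χ χ').toRingHom hle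
  have hγ : ∀ t, γ (mk t) = Algebra.TensorProduct.productMap χ χ' t := fun t => rfl
  have hγα : ∀ a, γ (α a) = π a := by
    intro a
    rw [hα, hγ, Algebra.TensorProduct.productMap_apply_tmul, map_one, mul_one, hπ]
  have hγβ : ∀ a, γ (β a) = π a := by
    intro a
    rw [hβ, hγ, Algebra.TensorProduct.productMap_apply_tmul, map_one, one_mul, hπ']
  have hαβ : α = β := by
    refine hom_eq_of_unramified (S := MvPolynomial (Fin n) R) α β ?_ γ ?_
    · apply MvPolynomial.ringHom_ext
      · intro r
        have h1 : algebraMap (MvPolynomial (Fin n) R) A (C r) = algebraMap R A r := by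
          rw [IsScalarTower.algebraMap_apply R (MvPolynomial (Fin n) R) A]
          rfl
        change α (algebraMap (MvPolynomial (Fin n) R) A (C r)) =
          β (algebraMap (MvPolynomial (Fin n) R) A (C r))
        rw [h1, hα, hβ, hc, hc']
        congr 1
        rw [Algebra.algebraMap_eq_smul_one, Algebra.algebraMap_eq_smul_one, smul_tmul]
      · intro i
        change α (algebraMap (MvPolynomial (Fin n) R) A (X i)) =
          β (algebraMap (MvPolynomial (Fin n) R) A (X i))
        rw [hα, hβ]
        exact Ideal.Quotient.eq.2 (hf i)
    · ext a
      exact (hγα a).trans (hγβ a).symm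
  have hsurj : ∀ t, ∃ a, mk t = α a := by
    intro t
    induction t with
    | zero => exact ⟨0, by simp⟩
    | add x y hx hy =>
      obtain ⟨a, ha⟩ := hx
      obtain ⟨b, hb⟩ := hy
      exact ⟨a + b, by rw [map_add, map_add, ha, hb]⟩
    | tmul x y =>
      obtain ⟨a, rfl⟩ := hρ x
      obtain ⟨b, rfl⟩ := hρ' y
      refine ⟨a * b, ?_⟩
      have hb : α b = mk (1 ⊗ₜ ρ' b) := by rw [hαβ, hβ]
      rw [map_mul, hb, hα, ← map_mul, Algebra.TensorProduct.tmul_mul_tmul, mul_one, one_mul]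
  have hkerle : RingHom.ker π ≤ RingHom.ker α := by
    refine hmin.2 ⟨RingHom.ker_isPrime α, sup_le ?_ ?_⟩ ?_
    · intro a ha
      rw [RingHom.mem_ker] at ha ⊢
      rw [hα, ha, zero_tmul, map_zero]
    · intro a ha
      rw [RingHom.mem_ker] at ha ⊢
      rw [hαβ, hβ, ha, tmul_zero, map_zero]
    · intro a ha
      rw [RingHom.mem_ker] at ha ⊢
      rw [← hγα, ha, map_zero]
  intro t ht
  obtain ⟨a, ha⟩ := hsurj t
  rw [← Ideal.Quotient.eq_zero_iff_mem]
  change mk t = 0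
  rw [ha]
  apply hkerle
  rw [RingHom.mem_ker, ← hγα, ← ha, hγ]
  exact ht

theorem lemmaD0 {n : ℕ} [IsDomain R₁] [ValuationRing R₁] [IsDomain D] [IsDomain D'] [IsDomain F]
    [Algebra.FiniteType R₁ D] [Algebra.FiniteType R₁ D']
    [Algebra (MvPolynomial (Fin n) R) A] [IsScalarTower R (MvPolynomial (Fin n) R) A]
    [Algebra.FormallyUnramified (MvPolynomial (Fin n) R) A]
    [Algebra.FiniteType (MvPolynomial (Fin n) R) A]
    (hD : Function.Injective (algebraMap R₁ D)) (hD' : Function.Injective (algebraMap R₁ D'))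
    (φ : R →+* R₁) (hφ : Function.Surjective φ) (ρ : A →+* D) (hρ : Function.Surjective ρ)
    (ρ' : A →+* D') (hρ' : Function.Surjective ρ') (χ : D →ₐ[R₁] F) (χ' : D' →ₐ[R₁] F)
    (hc : ∀ r, ρ (algebraMap R A r) = algebraMap R₁ D (φ r))
    (hc' : ∀ r, ρ' (algebraMap R A r) = algebraMap R₁ D' (φ r))
    (π : A →+* F) (hπs : Function.Surjective π)
    (hπ : ∀ a, χ (ρ a) = π a) (hπ' : ∀ a, χ' (ρ' a) = π a)
    (hmin : RingHom.ker π ∈ (RingHom.ker ρ ⊔ RingHom.ker ρ').minimalPrimes) :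
    td R (RingHom.ker ρ) + td R (RingHom.ker ρ') ≤ n + td R (RingHom.ker π) ∧
    (¬ Function.Injective (algebraMap R₁ F) →
      td R (RingHom.ker ρ) + td R (RingHom.ker ρ') + 1 ≤ n + td R (RingHom.ker π)) := by
  have := finiteType_tensor R₁ D D'
  let lam := Algebra.TensorProduct.productMap χ χ'
  have hlam : Function.Surjective lam := by
    intro y
    obtain ⟨a, rfl⟩ := hπs y
    refine ⟨ρ a ⊗ₜ 1, ?_⟩
    rw [Algebra.TensorProduct.productMap_apply_tmul, map_one, mul_one, hπ]
  have hQp : (RingHom.ker lam).IsPrime := RingHom.ker_isPrime _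
  obtain ⟨Q', hQ', hQ'le⟩ := Ideal.exists_minimalPrimes_le (bot_le : ⊥ ≤ RingHom.ker lam)
  have hQ'p : Q'.IsPrime := hQ'.1.1
  let f : Fin n → D ⊗[R₁] D' := fun i =>
    ρ (algebraMap (MvPolynomial (Fin n) R) A (X i)) ⊗ₜ[R₁] (1 : D')
      - (1 : D) ⊗ₜ[R₁] ρ' (algebraMap (MvPolynomial (Fin n) R) A (X i))
  have hQmin : RingHom.ker lam ∈ (Q' ⊔ Ideal.span (Set.range f)).minimalPrimes := by
    refine ⟨⟨hQp, sup_le hQ'le ?_⟩, ?_⟩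
    · rw [Ideal.span_le]
      rintro _ ⟨i, rfl⟩
      change lam (f i) = 0
      simp only [f, lam, map_sub, Algebra.TensorProduct.productMap_apply_tmul, map_one, mul_one,
        one_mul, hπ, hπ', sub_self]
    · rintro Q2 ⟨hQ2, hle2⟩ hle
      exact lemmaD_min φ ρ hρ ρ' hρ' χ χ' hc hc' π hπ hπ' hmin Q2 hQ2
        (fun i => hle2 (le_sup_right (a := Q') (Ideal.subset_span ⟨i, rfl⟩))) hle
  have h1 := core (R := R₁) f Q' (RingHom.ker lam) hQmin
  have h2 := td_tensor hD hD' Q' hQ'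
  have e1 : td R (RingHom.ker ρ) = td R₁ (⊥ : Ideal D) := td_transport φ hφ ρ hρ hc ⊥
  have e2 : td R (RingHom.ker ρ') = td R₁ (⊥ : Ideal D') := td_transport φ hφ ρ' hρ' hc' ⊥
  have e3 : td R (RingHom.ker π) = td R₁ (⊥ : Ideal F) :=
    td_transport φ hφ π hπs (fun r => by rw [← hπ, hc, AlgHom.commutes]) ⊥
  have e4 : td R₁ (RingHom.ker lam) = td R₁ (⊥ : Ideal F) :=
    td_transport (RingHom.id R₁) Function.surjective_id lam.toRingHom hlam
      (fun r => lam.commutes r) ⊥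
  rw [e4] at h1
  rw [e1, e2, e3]
  refine ⟨by omega, fun hni => ?_⟩
  have := h1.2 (fun hle => hni ?_)
  · omega
  · rw [h2.2] at hle
    rw [injective_iff_map_eq_zero]
    intro c hc
    refine hle ?_
    change lam (algebraMap R₁ _ c) = 0
    rw [lam.commutes, hc]

end LemmaD

theorem lemmaD {R A : Type*} [CommRing R] [IsDomain R] [ValuationRing R] [CommRing A] [Algebra R A]
    {n : ℕ} [Algebra.FiniteType R A]
    [Algebra (MvPolynomial (Fin n) R) A] [IsScalarTower R (MvPolynomial (Fin n) R) A]
    [Algebra.FormallyUnramified (MvPolynomial (Fin n) R) A]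
    (p p' q : Ideal A) [p.IsPrime] [p'.IsPrime] [q.IsPrime] (hu : p.under R = p'.under R)
    (hmin : q ∈ (p ⊔ p').minimalPrimes) :
    td R p + td R p' ≤ n + td R q ∧
    (¬ q.under R ≤ p.under R → td R p + td R p' + 1 ≤ n + td R q) := by
  have : Algebra.FiniteType (MvPolynomial (Fin n) R) A :=
    Algebra.FiniteType.of_restrictScalars_finiteType R _ _
  have hpq : p ≤ q := le_sup_left.trans hmin.1.2
  have hpq' : p' ≤ q := le_sup_right.trans hmin.1.2
  obtain ⟨𝔯, h𝔯⟩ : ∃ 𝔯 : Ideal R, 𝔯 = p.under R := ⟨_, rfl⟩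
  have hrp : 𝔯.IsPrime := h𝔯 ▸ inferInstance
  let aD : Algebra (R ⧸ 𝔯) (A ⧸ p) := (Ideal.quotientMap p (algebraMap R A) h𝔯.le).toAlgebra
  let aD' : Algebra (R ⧸ 𝔯) (A ⧸ p') :=
    (Ideal.quotientMap p' (algebraMap R A) (h𝔯.trans hu).le).toAlgebra
  let aF : Algebra (R ⧸ 𝔯) (A ⧸ q) :=
    (Ideal.quotientMap q (algebraMap R A) (h𝔯.le.trans (Ideal.comap_mono hpq))).toAlgebra
  have tD : IsScalarTower R (R ⧸ 𝔯) (A ⧸ p) := IsScalarTower.of_algebraMap_eq fun r => rfl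
  have tD' : IsScalarTower R (R ⧸ 𝔯) (A ⧸ p') := IsScalarTower.of_algebraMap_eq fun r => rfl
  have ftD : Algebra.FiniteType (R ⧸ 𝔯) (A ⧸ p) :=
    Algebra.FiniteType.of_restrictScalars_finiteType R _ _
  have ftD' : Algebra.FiniteType (R ⧸ 𝔯) (A ⧸ p') :=
    Algebra.FiniteType.of_restrictScalars_finiteType R _ _
  have hD : Function.Injective (algebraMap (R ⧸ 𝔯) (A ⧸ p)) :=
    Ideal.quotientMap_injective' h𝔯.ge
  have hD' : Function.Injective (algebraMap (R ⧸ 𝔯) (A ⧸ p')) :=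
    Ideal.quotientMap_injective' (h𝔯.trans hu).ge
  let χ : A ⧸ p →ₐ[R ⧸ 𝔯] A ⧸ q :=
    { Ideal.Quotient.factor hpq with
      commutes' := by
        intro r
        obtain ⟨r, rfl⟩ := Ideal.Quotient.mk_surjective r
        rfl }
  let χ' : A ⧸ p' →ₐ[R ⧸ 𝔯] A ⧸ q :=
    { Ideal.Quotient.factor hpq' with
      commutes' := by
        intro r
        obtain ⟨r, rfl⟩ := Ideal.Quotient.mk_surjective r
        rfl }
  have h := lemmaD0 (n := n) hD hD' (Ideal.Quotient.mk 𝔯) Ideal.Quotient.mk_surjective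
    (Ideal.Quotient.mk p) Ideal.Quotient.mk_surjective (Ideal.Quotient.mk p')
    Ideal.Quotient.mk_surjective χ χ' (fun r => rfl) (fun r => rfl) (Ideal.Quotient.mk q)
    Ideal.Quotient.mk_surjective (fun a => rfl) (fun a => rfl)
    (by rw [Ideal.mk_ker, Ideal.mk_ker, Ideal.mk_ker]; exact hmin)
  rw [Ideal.mk_ker, Ideal.mk_ker, Ideal.mk_ker] at h
  refine ⟨h.1, fun hne => h.2 fun hinj => hne ?_⟩
  intro c hc
  rw [← h𝔯, ← Ideal.Quotient.eq_zero_iff_mem]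
  apply hinj
  rw [map_zero]
  exact Ideal.Quotient.eq_zero_iff_mem.2 hc

end SubCodim

end

section
open MvPolynomial TensorProduct

namespace SubCodim

open Classical in
/-- residual transcendence degree, plus one on the generic fibre. -/
noncomputable def tau (R : Type*) [CommRing R] {A : Type*} [CommRing A] [Algebra R A]
    (P : Ideal A) : ℕ := td R P + if P.under R = ⊥ then 1 else 0

section Heights
variable {R A : Type*} [CommRing R] [IsDomain R] [ValuationRing R] [CommRing A] [Algebra R A]
  [Algebra.FiniteType R A]

theorem tau_pos {P : Ideal A} (h : P.under R = ⊥) : tau R P = td R P + 1 := by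
  rw [tau, if_pos h]

theorem tau_neg {P : Ideal A} (h : P.under R ≠ ⊥) : tau R P = td R P := by
  rw [tau, if_neg h, add_zero]

theorem tau_lt (hR : ∀ I J : Ideal R, I.IsPrime → J.IsPrime → I ≠ ⊥ → J ≠ ⊥ → I = J)
    {P' P : Ideal A} [P'.IsPrime] [P.IsPrime] (hlt : P' < P) : tau R P + 1 ≤ tau R P' := by
  have hu : P'.under R ≤ P.under R := Ideal.comap_mono hlt.le
  by_cases h' : P'.under R = ⊥
  · by_cases h : P.under R = ⊥
    · rw [tau_pos h, tau_pos h']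
      have := td_lt (R := R) hlt (h.trans h'.symm).le
      omega
    · rw [tau_neg h, tau_pos h']
      have := td_le (R := R) hlt.le
      omega
  · have h : P.under R ≠ ⊥ := fun h => h' (le_bot_iff.1 (h ▸ hu))
    rw [tau_neg h, tau_neg h']
    exact td_lt (R := R) hlt (hR _ _ inferInstance inferInstance h h').le

theorem tau_le (hR : ∀ I J : Ideal R, I.IsPrime → J.IsPrime → I ≠ ⊥ → J ≠ ⊥ → I = J)
    {P' P : Ideal A} [P'.IsPrime] [P.IsPrime] (hle : P' ≤ P) : tau R P ≤ tau R P' := by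
  rcases hle.eq_or_lt with rfl | h
  · exact le_rfl
  · have := tau_lt hR h
    omega

theorem tau_core (hR : ∀ I J : Ideal R, I.IsPrime → J.IsPrime → I ≠ ⊥ → J ≠ ⊥ → I = J)
    {P' P : Ideal A} [P'.IsPrime] [P.IsPrime] (x : A)
    (hmin : P ∈ (P' ⊔ Ideal.span {x}).minimalPrimes) : tau R P' ≤ tau R P + 1 := by
  have hle : P' ≤ P := le_sup_left.trans hmin.1.2
  have hu : P'.under R ≤ P.under R := Ideal.comap_mono hle
  have hc := core (R := R) (fun _ : Fin 1 => x) P' P (by rwa [Set.range_const])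
  by_cases h' : P'.under R = ⊥
  · by_cases h : P.under R = ⊥
    · rw [tau_pos h, tau_pos h']
      omega
    · rw [tau_neg h, tau_pos h']
      have := hc.2 (fun hh => h (le_bot_iff.1 (h' ▸ hh)))
      omega
  · have h : P.under R ≠ ⊥ := fun h => h' (le_bot_iff.1 (h ▸ hu))
    rw [tau_neg h, tau_neg h']
    omega

variable {n : ℕ} [Algebra (MvPolynomial (Fin n) R) A] [IsScalarTower R (MvPolynomial (Fin n) R) A]
    [Algebra.FormallyUnramified (MvPolynomial (Fin n) R) A]

theorem tau_minimal [Module.Flat (MvPolynomial (Fin n) R) A]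
    {P : Ideal A} (hP : P ∈ minimalPrimes A) : tau R P = n + 1 := by
  have hPp : P.IsPrime := hP.1.1
  have h0 : P.under (MvPolynomial (Fin n) R) = ⊥ := by
    obtain ⟨P1, hle, hp1, hl⟩ := Ideal.exists_ideal_le_liesOver_of_le
      (p := (⊥ : Ideal (MvPolynomial (Fin n) R))) (q := P.under (MvPolynomial (Fin n) R)) P bot_le
    have : P = P1 := le_antisymm (hP.2 ⟨hp1, bot_le⟩ hle) hle
    rw [this, ← hl.over]
  have hR0 : P.under R = ⊥ := by
    rw [eq_bot_iff]
    intro r hr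
    have : (C r : MvPolynomial (Fin n) R) ∈ P.under (MvPolynomial (Fin n) R) := by
      rw [Ideal.mem_comap]
      rw [Ideal.mem_comap, IsScalarTower.algebraMap_apply R (MvPolynomial (Fin n) R) A] at hr
      exact hr
    rw [h0, Ideal.mem_bot, C_eq_zero] at this
    exact this
  rw [tau_pos hR0]
  have h1 := (lemmaD (R := R) (n := n) P P P rfl
    (by rw [sup_idem, Ideal.minimalPrimes_eq_subsingleton_self]; rfl)).1
  have h2 : n ≤ td R P := by
    refine le_td P (fun i => algebraMap (MvPolynomial (Fin n) R) A (X i)) ?_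
    intro F hF m
    have e : aeval (fun i => algebraMap (MvPolynomial (Fin n) R) A (X i)) F
        = algebraMap (MvPolynomial (Fin n) R) A F := by
      have : (aeval (fun i => algebraMap (MvPolynomial (Fin n) R) A (X i)) :
        MvPolynomial (Fin n) R →ₐ[R] A) = IsScalarTower.toAlgHom R (MvPolynomial (Fin n) R) A := by
        apply MvPolynomial.algHom_ext
        intro i
        simp
      rw [this]
      rfl
    rw [e] at hF
    have : F ∈ P.under (MvPolynomial (Fin n) R) := hF
    rw [h0, Ideal.mem_bot] at this
    rw [this, coeff_zero, map_zero]
    exact P.zero_mem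
  omega

theorem tau_le_top [Module.Flat (MvPolynomial (Fin n) R) A]
    (hR : ∀ I J : Ideal R, I.IsPrime → J.IsPrime → I ≠ ⊥ → J ≠ ⊥ → I = J)
    (P : Ideal A) [P.IsPrime] : tau R P ≤ n + 1 := by
  obtain ⟨P0, h0, hle⟩ := Ideal.exists_minimalPrimes_le (bot_le : ⊥ ≤ P)
  have : P0.IsPrime := h0.1.1
  rw [← tau_minimal (R := R) (n := n) h0]
  exact tau_le hR hle

theorem height_le [Module.Flat (MvPolynomial (Fin n) R) A]
    (hR : ∀ I J : Ideal R, I.IsPrime → J.IsPrime → I ≠ ⊥ → J ≠ ⊥ → I = J)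
    (x : PrimeSpectrum A) : Order.height x ≤ ((n + 1 - tau R x.asIdeal : ℕ) : ℕ∞) := by
  let f : PrimeSpectrum A → ℕ := fun y => n + 1 - tau R y.asIdeal
  have hf : StrictMono f := by
    intro y z hyz
    have h1 := tau_lt hR (P' := y.asIdeal) (P := z.asIdeal) hyz
    have h2 := tau_le_top (n := n) hR y.asIdeal
    simp only [f]
    omega
  have := Order.height_le_height_apply_of_strictMono f hf x
  rwa [Order.height_nat] at this

theorem le_height [Module.Flat (MvPolynomial (Fin n) R) A]
    (hR : ∀ I J : Ideal R, I.IsPrime → J.IsPrime → I ≠ ⊥ → J ≠ ⊥ → I = J) (k : ℕ) :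
    ∀ x : PrimeSpectrum A, k + tau R x.asIdeal = n + 1 → (k : ℕ∞) ≤ Order.height x := by
  induction k with
  | zero => intro x _; simp
  | succ k ih =>
    intro x hx
    have hne : ∃ d, ∃ y : PrimeSpectrum A, y < x ∧ tau R y.asIdeal = d := by
      obtain ⟨P0, h0, hle⟩ := Ideal.exists_minimalPrimes_le (bot_le : ⊥ ≤ x.asIdeal)
      have hp0 : P0.IsPrime := h0.1.1
      have h1 := tau_minimal (R := R) (n := n) h0
      refine ⟨_, ⟨P0, hp0⟩, lt_of_le_of_ne hle ?_, rfl⟩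
      rintro rfl
      change k + 1 + tau R P0 = n + 1 at hx
      omega
    classical
    obtain ⟨y, hyx, hy⟩ := Nat.find_spec hne
    have hmin : ∀ z : PrimeSpectrum A, z < x → tau R y.asIdeal ≤ tau R z.asIdeal := by
      intro z hz
      rw [hy]
      exact Nat.find_min' hne ⟨z, hz, rfl⟩
    obtain ⟨t, ht, ht'⟩ := SetLike.exists_of_lt (show y.asIdeal < x.asIdeal from hyx)
    have hle : y.asIdeal ≤ x.asIdeal := hyx.le
    have h1 : x.asIdeal ∈ (y.asIdeal ⊔ Ideal.span {t}).minimalPrimes := by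
      refine ⟨⟨x.isPrime, sup_le hle ((Ideal.span_singleton_le_iff_mem _).2 ht)⟩, ?_⟩
      rintro Q ⟨hQ, hQle⟩ hQx
      by_contra hcon
      have h2 : (⟨Q, hQ⟩ : PrimeSpectrum A) < x :=
        lt_of_le_not_ge (a := (⟨Q, hQ⟩ : PrimeSpectrum A)) hQx hcon
      have h3 : y.asIdeal < Q := by
        refine lt_of_le_of_ne (le_sup_left.trans hQle) ?_
        rintro h
        exact ht' (h ▸ hQle (le_sup_right (a := y.asIdeal) (Ideal.mem_span_singleton_self t)))
      have h4 := tau_lt hR h3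
      have h5 : tau R y.asIdeal ≤ tau R Q := hmin _ h2
      omega
    have h2 := tau_core hR t h1
    have h3 := tau_lt hR (P' := y.asIdeal) (P := x.asIdeal) hyx
    have h4 := ih y (by omega)
    push_cast
    exact (add_le_add_left h4 1).trans (Order.height_add_one_le hyx)

theorem tau_sub
    (hR : ∀ I J : Ideal R, I.IsPrime → J.IsPrime → I ≠ ⊥ → J ≠ ⊥ → I = J)
    {p p' q : Ideal A} [p.IsPrime] [p'.IsPrime] [q.IsPrime] (hmin : q ∈ (p ⊔ p').minimalPrimes) :
    tau R p + tau R p' ≤ n + 1 + tau R q := by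
  have hmixed : ∀ {p p' : Ideal A} [p.IsPrime] [p'.IsPrime], q ∈ (p ⊔ p').minimalPrimes →
      p.under R ≠ ⊥ → p'.under R = ⊥ → tau R p + tau R p' ≤ n + 1 + tau R q := by
    intro p p' _ _ hmin hp hp'
    obtain ⟨t, ht, ht0⟩ := Submodule.exists_mem_ne_zero_of_ne_bot hp
    have hpq : p ≤ q := le_sup_left.trans hmin.1.2
    have hpq' : p' ≤ q := le_sup_right.trans hmin.1.2
    have htq : p' ⊔ Ideal.span {algebraMap R A t} ≤ q :=
      sup_le hpq' ((Ideal.span_singleton_le_iff_mem _).2 (hpq ht))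
    obtain ⟨P, hP, hPq⟩ := Ideal.exists_minimalPrimes_le htq
    have hPp : P.IsPrime := hP.1.1
    have hPt : t ∈ P.under R :=
      hP.1.2 (le_sup_right (a := p') (Ideal.mem_span_singleton_self _))
    have hPu : P.under R ≠ ⊥ := fun h => ht0 (by rw [h] at hPt; exact hPt)
    have hqu : q.under R ≠ ⊥ := fun h =>
      hPu (le_bot_iff.1 (h ▸ (Ideal.comap_mono hPq : P.under R ≤ q.under R)))
    have h1 := tau_core hR _ hP
    have h2 : q ∈ (p ⊔ P).minimalPrimes := by
      refine ⟨⟨inferInstance, sup_le hpq hPq⟩, ?_⟩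
      rintro Q ⟨hQ, hQle⟩ hQq
      exact hmin.2 ⟨hQ, sup_le (le_sup_left.trans hQle)
        ((le_sup_left.trans hP.1.2).trans (le_sup_right.trans hQle))⟩ hQq
    have h3 := (lemmaD (R := R) (n := n) p P q
      (hR _ _ inferInstance inferInstance hp hPu) h2).1
    rw [tau_neg hp, tau_neg hqu]
    rw [tau_neg hPu] at h1
    omega
  by_cases hp : p.under R = ⊥
  · by_cases hp' : p'.under R = ⊥
    · have h3 := lemmaD (R := R) (n := n) p p' q (hp.trans hp'.symm) hmin
      rw [tau_pos hp, tau_pos hp']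
      by_cases hqu : q.under R = ⊥
      · rw [tau_pos hqu]; omega
      · rw [tau_neg hqu]
        have := h3.2 (fun h => hqu (le_bot_iff.1 (hp ▸ h)))
        omega
    · have := hmixed (p := p') (p' := p) (by rwa [sup_comm]) hp' hp
      omega
  · by_cases hp' : p'.under R = ⊥
    · exact hmixed hmin hp hp'
    · have h3 := (lemmaD (R := R) (n := n) p p' q
        (hR _ _ inferInstance inferInstance hp hp') hmin).1
      have hqu : q.under R ≠ ⊥ := fun h => hp (le_bot_iff.1
        (h ▸ (Ideal.comap_mono (le_sup_left.trans hmin.1.2) : p.under R ≤ q.under R)))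
      rw [tau_neg hp, tau_neg hp', tau_neg hqu]
      omega

theorem etale_case [Module.Flat (MvPolynomial (Fin n) R) A]
    (hR : ∀ I J : Ideal R, I.IsPrime → J.IsPrime → I ≠ ⊥ → J ≠ ⊥ → I = J)
    {p p' q : Ideal A} [hp : p.IsPrime] [hp' : p'.IsPrime] [hq : q.IsPrime]
    (hmin : q ∈ (p ⊔ p').minimalPrimes) :
    q.height ≤ p.height + p'.height := by
  have e := fun x : PrimeSpectrum A => x.height_eq_orderHeight
  have e1 : q.height = _ := e ⟨q, hq⟩
  have e2 : p.height = _ := e ⟨p, hp⟩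
  have e3 : p'.height = _ := e ⟨p', hp'⟩
  rw [e1, e2, e3]
  have h := tau_sub (n := n) hR hmin
  have t1 := tau_le_top (n := n) hR q
  have t2 := tau_le_top (n := n) hR p
  have t3 := tau_le_top (n := n) hR p'
  have h1 := height_le (n := n) hR ⟨q, hq⟩
  have h2 := le_height (n := n) hR (n + 1 - tau R p) ⟨p, hp⟩ (by simp only; omega)
  have h3 := le_height (n := n) hR (n + 1 - tau R p') ⟨p', hp'⟩ (by simp only; omega)
  refine (h1.trans ?_).trans (add_le_add h2 h3)
  rw [← Nat.cast_add, Nat.cast_le]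
  simp only
  omega

end Heights

theorem main {R A : Type*} [CommRing R] [IsDomain R] [ValuationRing R]
    (hrank : ringKrullDim R = 1) [CommRing A] [Algebra R A]
    [Algebra.FormallySmooth R A] [Algebra.FinitePresentation R A]
    (p p' q : Ideal A) (hp : p.IsPrime) (hp' : p'.IsPrime)
    (hq : q.IsPrime) (hmin : q ∈ (p ⊔ p').minimalPrimes) :
    q.height ≤ p.height + p'.height := by
  have hR : ∀ I J : Ideal R, I.IsPrime → J.IsPrime → I ≠ ⊥ → J ≠ ⊥ → I = J := by
    have : Ring.KrullDimLE 1 R := Ring.krullDimLE_iff.2 hrank.le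
    intro I J hI hJ hI0 hJ0
    have h1 : I.IsMaximal := Ideal.IsPrime.isMaximal_of_ne_bot hI hI0
    have h2 : J.IsMaximal := Ideal.IsPrime.isMaximal_of_ne_bot hJ hJ0
    rw [IsLocalRing.eq_maximalIdeal h1, IsLocalRing.eq_maximalIdeal h2]
  have hpq : p ≤ q := le_sup_left.trans hmin.1.2
  have hpq' : p' ≤ q := le_sup_right.trans hmin.1.2
  have : Algebra.IsSmoothAt R q := by
    have : Algebra.FormallySmooth A (Localization.AtPrime q) :=
      Algebra.FormallySmooth.of_isLocalization q.primeCompl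
    exact Algebra.FormallySmooth.comp R A (Localization.AtPrime q)
  obtain ⟨f, hf, n, _, _, _⟩ := Algebra.IsSmoothAt.exists_isStandardEtale_mvPolynomial
    (R := R) (S := A) (p := q)
  let M := Submonoid.powers f
  let L := Localization.Away f
  have hd : ∀ P : Ideal A, P.IsPrime → P ≤ q → Disjoint (M : Set A) (P : Set A) := by
    intro P hP hPq
    rw [Set.disjoint_left]
    rintro _ ⟨k, rfl⟩ h
    exact hf (hPq (hP.mem_of_pow_mem k h))
  have hpr : ∀ P : Ideal A, P.IsPrime → P ≤ q → (P.map (algebraMap A L)).IsPrime :=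
    fun P hP hPq => IsLocalization.isPrime_of_isPrime_disjoint M L P hP (hd P hP hPq)
  have hht : ∀ P : Ideal A, P.IsPrime → P ≤ q → (P.map (algebraMap A L)).height = P.height :=
    fun P hP hPq => IsLocalization.height_map_of_disjoint M P (hd P hP hPq)
  have i1 := hpr p hp hpq
  have i2 := hpr p' hp' hpq'
  have i3 := hpr q hq le_rfl
  rw [← hht p hp hpq, ← hht p' hp' hpq', ← hht q hq le_rfl]
  have : Algebra.FiniteType R L := .trans (S := A) inferInstance inferInstance
  refine etale_case (R := R) (n := n) hR ?_
  rw [← Ideal.map_sup, IsLocalization.minimalPrimes_map M L, Set.mem_preimage]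
  have := IsLocalization.under_map_of_isPrime_disjoint M L hq (hd q hq le_rfl)
  rwa [this]

end SubCodim

end

/-- **Subadditivity of codimension over rank-1 valuation rings.**
Let `R` be a valuation ring of rank 1 (a valuation domain of Krull dimension 1) and let `A`
be a smooth `R`-algebra (formally smooth and of finite presentation).  Then codimension is
subadditive under intersection in `Spec A`: for prime ideals `p`, `p'` of `A` and any prime
`q` minimal over `p + p'`, one has `ht q ≤ ht p + ht p'`. -/
theorem subadditive_codimension_over_rank_one_valuation_ring
    {R A : Type u} [CommRing R] [IsDomain R] [ValuationRing R]
    (hrank : ringKrullDim R = 1)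
    [CommRing A] [Algebra R A]
    [Algebra.FormallySmooth R A] [Algebra.FinitePresentation R A]
    (p p' q : Ideal A) (hp : p.IsPrime) (hp' : p'.IsPrime)
    (hq : q.IsPrime) (hmin : q ∈ (p + p').minimalPrimes) :
    primeHt q ≤ primeHt p + primeHt p' := by
  have key := SubCodim.main hrank p p' q hp hp' hq hmin
  have e : ∀ P : Ideal A, P.IsPrime → primeHt P = P.height := by
    intro P hP
    rw [primeHt, iSup_pos hP]
    exact (PrimeSpectrum.height_eq_orderHeight ⟨P, hP⟩).symm
  rw [e p hp, e p' hp', e q hq]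
  exact key
end

section
/- Let R be a valuation ring of rank 1 with maximal ideal m and fraction field K, and let A be a smooth R-algebra. Let I and I' be ideals of A of pure height j and j' respectively (every prime minimal over I has height j, and every prime minimal over I' has height j'). Let x be a prime ideal of A containing I + I' + mA such that for every prime P minimal over I + I' + mA with P ⊆ x, the image of P in A/mA has height j + j' in A/mA. Then: (1) there exists a prime ideal p of A with I + I' ⊆ p ⊆ x such that p does not contain mA (so p lies over (0) ⊆ R, i.e., p corresponds to a point of the generic fiber specializing to x); (2) if moreover x is a maximal ideal of A, then p may be chosen so that its extension p·(A ⊗_R K) is a maximal ideal of A ⊗_R K. -/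
section
universe u

namespace LPI
open MvPolynomial

/-- algebraic independence over the image of `R`. -/
def AI (R : Type u) {D : Type u} [CommRing R] [CommRing D] [Algebra R D] {ι : Type} (v : ι → D) :
    Prop :=
  ∀ F : MvPolynomial ι R, aeval v F = 0 → MvPolynomial.map (algebraMap R D) F = 0

/-- transcendence degree over the image of `R`. -/
noncomputable def td (R D : Type u) [CommRing R] [CommRing D] [Algebra R D] : ℕ :=
  Cardinal.toNat (Algebra.trdeg (⊥ : Subalgebra R D) D)

section
variable {R D : Type u} [CommRing R] [CommRing D] [Algebra R D]

lemma ai_iff {ι : Type} (v : ι → D) : AI R v ↔ AlgebraicIndependent (⊥ : Subalgebra R D) v := by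
  rw [algebraicIndependent_iff]
  have hs : Function.Surjective (algebraMap R (⊥ : Subalgebra R D)) := by
    rintro ⟨y, hy⟩
    obtain ⟨r, rfl⟩ := Algebra.mem_bot.mp hy
    exact ⟨r, rfl⟩
  have key : ∀ F : MvPolynomial ι R, aeval v (MvPolynomial.map (algebraMap R (⊥ : Subalgebra R D)) F)
      = aeval v F := fun F => by rw [MvPolynomial.aeval_map_algebraMap]
  have key2 : ∀ F : MvPolynomial ι R, MvPolynomial.map (algebraMap (⊥ : Subalgebra R D) D)
      (MvPolynomial.map (algebraMap R (⊥ : Subalgebra R D)) F) = MvPolynomial.map (algebraMap R D) F :=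
    fun F => by rw [MvPolynomial.map_map, ← IsScalarTower.algebraMap_eq]
  have inj : Function.Injective (MvPolynomial.map (σ := ι) (algebraMap (⊥ : Subalgebra R D) D)) :=
    MvPolynomial.map_injective _ Subtype.val_injective
  constructor
  · intro h p hp
    obtain ⟨F, rfl⟩ := MvPolynomial.map_surjective _ hs p
    rw [key] at hp
    apply inj
    rw [key2, h F hp, map_zero]
  · intro h F hF
    have h0 : MvPolynomial.map (algebraMap R (⊥ : Subalgebra R D)) F = 0 := h _ (by rw [key, hF])
    rw [← key2, h0, map_zero]

lemma isAlgebraic_adjoin_bot {s : Set D} :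
    Algebra.IsAlgebraic (Algebra.adjoin (⊥ : Subalgebra R D) s) D ↔
    Algebra.IsAlgebraic (Algebra.adjoin R s) D := by
  have h : ∀ y : D, y ∈ Algebra.adjoin (⊥ : Subalgebra R D) s ↔ y ∈ Algebra.adjoin R s := by
    intro y
    constructor
    · intro hy
      induction hy using Algebra.adjoin_induction with
      | mem x hx => exact Algebra.subset_adjoin hx
      | algebraMap r =>
        obtain ⟨r, hr⟩ := r
        obtain ⟨r, rfl⟩ := Algebra.mem_bot.mp hr
        exact Subalgebra.algebraMap_mem _ _
      | add x y _ _ hx hy => exact add_mem hx hy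
      | mul x y _ _ hx hy => exact mul_mem hx hy
    · intro hy
      induction hy using Algebra.adjoin_induction with
      | mem x hx => exact Algebra.subset_adjoin hx
      | algebraMap r =>
        exact Subalgebra.algebraMap_mem (Algebra.adjoin (⊥ : Subalgebra R D) s)
          (⟨algebraMap R D r, Algebra.mem_bot.mpr ⟨r, rfl⟩⟩ : (⊥ : Subalgebra R D))
      | add x y _ _ hx hy => exact add_mem hx hy
      | mul x y _ _ hx hy => exact mul_mem hx hy
  let f₁ : Algebra.adjoin (⊥ : Subalgebra R D) s →+* Algebra.adjoin R s :=
    (algebraMap (Algebra.adjoin (⊥ : Subalgebra R D) s) D).codRestrict (Algebra.adjoin R s)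
      (fun y => (h _).1 y.2)
  let f₂ : Algebra.adjoin R s →+* Algebra.adjoin (⊥ : Subalgebra R D) s :=
    (algebraMap (Algebra.adjoin R s) D).codRestrict (Algebra.adjoin (⊥ : Subalgebra R D) s)
      (fun y => (h _).2 y.2)
  have s₁ : Function.Surjective f₁ := fun y => ⟨⟨y.1, (h y.1).2 y.2⟩, Subtype.ext rfl⟩
  have s₂ : Function.Surjective f₂ := fun y => ⟨⟨y.1, (h y.1).1 y.2⟩, Subtype.ext rfl⟩
  have c₁ : (algebraMap (Algebra.adjoin R s) D).comp f₁ =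
      (RingHom.id D).comp (algebraMap (Algebra.adjoin (⊥ : Subalgebra R D) s) D) :=
    RingHom.ext fun y => rfl
  have c₂ : (algebraMap (Algebra.adjoin (⊥ : Subalgebra R D) s) D).comp f₂ =
      (RingHom.id D).comp (algebraMap (Algebra.adjoin R s) D) :=
    RingHom.ext fun y => rfl
  constructor
  · intro H
    refine ⟨fun y => ?_⟩
    exact IsAlgebraic.of_ringHom_of_comp_eq f₂ (RingHom.id D) (H.isAlgebraic y) s₂
      Function.injective_id c₂
  · intro H
    refine ⟨fun y => ?_⟩
    exact IsAlgebraic.of_ringHom_of_comp_eq f₁ (RingHom.id D) (H.isAlgebraic y) s₁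
      Function.injective_id c₁

variable [IsDomain D]

lemma td_le {ι : Type} [Fintype ι] (v : ι → D)
    (h : Algebra.IsAlgebraic (Algebra.adjoin R (Set.range v)) D) : td R D ≤ Fintype.card ι := by
  have := isAlgebraic_adjoin_bot.mpr h
  have h1 := Algebra.IsAlgebraic.trdeg_le_cardinalMk (⊥ : Subalgebra R D) (Set.range v)
  have h2 : Cardinal.mk (Set.range v) ≤ Fintype.card ι := by
    have := Cardinal.mk_range_le_lift (f := v)
    simpa using this
  have := Cardinal.toNat_le_toNat (h1.trans h2) (Cardinal.natCast_lt_aleph0)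
  simpa [td] using this

lemma trdeg_fin [Algebra.FiniteType R D] :
    Algebra.trdeg (⊥ : Subalgebra R D) D < Cardinal.aleph0 := by
  have : Algebra.FiniteType (⊥ : Subalgebra R D) D := .of_restrictScalars_finiteType R _ _
  exact trdeg_lt_aleph0_of_finiteType

lemma td_cast [Algebra.FiniteType R D] :
    ((td R D : ℕ) : Cardinal) = Algebra.trdeg (⊥ : Subalgebra R D) D :=
  Cardinal.cast_toNat_of_lt_aleph0 trdeg_fin

lemma le_td [Algebra.FiniteType R D] {ι : Type} [Fintype ι] (v : ι → D) (h : AI R v) :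
    Fintype.card ι ≤ td R D := by
  have := ((ai_iff v).1 h).lift_cardinalMk_le_trdeg
  rw [← td_cast] at this
  simpa using this

lemma exists_basis [Algebra.FiniteType R D] : ∃ v : Fin (td R D) → D, AI R v ∧
    Algebra.IsAlgebraic (Algebra.adjoin R (Set.range v)) D := by
  obtain ⟨s, hs⟩ := exists_isTranscendenceBasis (⊥ : Subalgebra R D) D
  have h1 := hs.cardinalMk_eq_trdeg
  rw [← td_cast] at h1
  have : Nonempty (s ≃ Fin (td R D)) := by
    have : Cardinal.lift.{0} (Cardinal.mk s) = Cardinal.lift.{u} (Cardinal.mk (Fin (td R D))) := by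
      simpa using h1
    exact Cardinal.lift_mk_eq'.mp this
  obtain ⟨e⟩ := this
  refine ⟨fun i => (e.symm i).1, (ai_iff _).2 (hs.1.comp _ e.symm.injective), ?_⟩
  have h3 := hs.isAlgebraic
  rw [isAlgebraic_adjoin_bot] at h3
  convert h3 using 3
  all_goals
    have : Set.range (fun i => (e.symm i).1) = Set.range (Subtype.val : s → D) :=
      e.symm.surjective.range_comp _
    simp only [this]

lemma ai_of_le [Algebra.FiniteType R D] {ι : Type} [Fintype ι] (v : ι → D)
    (h : Algebra.IsAlgebraic (Algebra.adjoin R (Set.range v)) D) (hle : Fintype.card ι ≤ td R D) :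
    AI R v := by
  have := isAlgebraic_adjoin_bot.mpr h
  rw [ai_iff]
  refine (Algebra.IsAlgebraic.isTranscendenceBasis_of_lift_le_trdeg_of_finite (⊥ : Subalgebra R D) v ?_).1
  rw [← td_cast]
  simpa using hle
end
end LPI

namespace LPI
open MvPolynomial

lemma zmp {S B : Type u} [CommRing S] [CommRing B] [Algebra S B] [Algebra.FiniteType S B]
    (x : Ideal B) [hx : x.IsPrime]
    (h1 : ∀ z : Ideal B, z.IsPrime → z ≤ x → z.comap (algebraMap S B) = x.comap (algebraMap S B) → z = x)
    (h2 : ∀ z : Ideal B, z.IsPrime → x ≤ z → z.comap (algebraMap S B) = x.comap (algebraMap S B) → z = x) :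
    ∃ r ∉ x, IsIntegral S r ∧ ∀ b, ∃ m, IsIntegral S (r ^ m * b) := by
  rw [← Algebra.zariskisMainProperty_iff]
  let q : PrimeSpectrum B := ⟨x, hx⟩
  let p : PrimeSpectrum S := q.comap (algebraMap S B)
  have : Algebra.QuasiFiniteAt S x := by
    refine Algebra.QuasiFiniteAt.of_isOpen_singleton_fiber q ?_
    let e := PrimeSpectrum.preimageHomeomorphFiber S B p
    let o := PrimeSpectrum.preimageOrderIsoFiber S B p
    have : IsNoetherianRing (p.asIdeal.Fiber B) := Algebra.FiniteType.isNoetherianRing p.asIdeal.ResidueField _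
    have : IsJacobsonRing (p.asIdeal.Fiber B) := isJacobsonRing_of_finiteType (A := p.asIdeal.ResidueField)
    let qf : (PrimeSpectrum.comap (algebraMap S B) ⁻¹' {p}) := ⟨q, rfl⟩
    have ho : IsOpen {o qf} := by
      refine ((PrimeSpectrum.isOpen_singleton_tfae_of_isNoetherian_of_isJacobsonRing (o qf)).out 0 2).mpr ?_
      constructor
      · rw [PrimeSpectrum.isClosed_singleton_iff_isMaximal]
        obtain ⟨M, hM, hle⟩ := Ideal.exists_le_maximal (o qf).asIdeal (o qf).2.ne_top
        let w : PrimeSpectrum (p.asIdeal.Fiber B) := ⟨M, hM.isPrime⟩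
        have hw : o qf ≤ w := hle
        have h3 : qf ≤ o.symm w := by rwa [OrderIso.le_symm_apply]
        have h4 : (o.symm w).1.asIdeal = x := h2 _ (o.symm w).1.2 h3
          (congrArg PrimeSpectrum.asIdeal (o.symm w).2)
        have h5 : o.symm w = qf := Subtype.ext (PrimeSpectrum.ext h4)
        have h6 : w = o qf := by rw [← h5, OrderIso.apply_symm_apply]
        rw [← h6]; exact hM
      · intro a b hab ha
        rw [Set.mem_singleton_iff] at ha ⊢
        subst ha
        have hw : b ≤ o qf := (PrimeSpectrum.le_iff_specializes _ _).2 hab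
        have h3 : o.symm b ≤ qf := by rwa [OrderIso.symm_apply_le]
        have h4 : (o.symm b).1.asIdeal = x := h1 _ (o.symm b).1.2 h3
          (congrArg PrimeSpectrum.asIdeal (o.symm b).2)
        have h5 : o.symm b = qf := Subtype.ext (PrimeSpectrum.ext h4)
        rw [← h5, OrderIso.apply_symm_apply]
    have := e.isOpen_preimage.mpr ho
    convert! this using 1
    ext w
    simp only [Set.mem_singleton_iff, Set.mem_preimage]
    exact (o.injective.eq_iff (a := w) (b := qf)).symm
  exact .of_finiteType x


lemma alg_of_zmp {R S B : Type u} [CommRing R] [CommRing S] [CommRing B] [Algebra R B] [Algebra S B]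
    [IsDomain B] (T : Subalgebra R B) (hT : ∀ s : S, algebraMap S B s ∈ T)
    (h : ∃ r : B, r ≠ 0 ∧ IsIntegral S r ∧ ∀ b, ∃ m, IsIntegral S (r ^ m * b)) :
    Algebra.IsAlgebraic T B := by
  obtain ⟨r, hr, hri, h⟩ := h
  let g : S →+* T := (algebraMap S B).codRestrict T hT
  have hg : (algebraMap T B).comp g = algebraMap S B := RingHom.ext fun _ => rfl
  have hT : ∀ b : B, IsIntegral S b → IsAlgebraic T b := fun b hb => by
    have : (algebraMap T B).IsIntegralElem b := by
      have hb' : (algebraMap S B).IsIntegralElem b := hb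
      rw [← hg] at hb'
      exact RingHom.IsIntegralElem.of_comp hb'
    exact IsIntegral.isAlgebraic this
  refine ⟨fun b => ?_⟩
  obtain ⟨m, hm⟩ := h b
  exact IsAlgebraic.of_mul (pow_mem (mem_nonZeroDivisors_of_ne_zero hr) m) ((hT _ hri).pow m) (hT _ hm)

lemma exists_dvd_aeval {R D : Type u} [CommRing R] [CommRing D] [Algebra R D] [IsDomain D]
    {ι : Type} (t : ι → D) (h : Algebra.IsAlgebraic (Algebra.adjoin R (Set.range t)) D) (y : D) (hy : y ≠ 0) :
    ∃ F : MvPolynomial ι R, aeval t F ≠ 0 ∧ y ∣ aeval t F := by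
  obtain ⟨r, hr, h⟩ := (h.isAlgebraic y).exists_nonzero_dvd (mem_nonZeroDivisors_of_ne_zero hy)
  have h2 : ∀ y ∈ Algebra.adjoin R (Set.range t), ∃ F : MvPolynomial ι R, aeval t F = y := by
    intro y hy
    rw [Algebra.adjoin_range_eq_range_aeval] at hy
    exact hy
  obtain ⟨F, hF⟩ := h2 r r.2
  have hF' : aeval t F = (r : D) := hF
  refine ⟨F, ?_, ?_⟩
  · rw [hF']; simpa using hr
  · rw [hF']; exact h

/-- monotonicity -/
lemma td_le_of_injective {R D D' : Type u} [CommRing R] [CommRing D] [Algebra R D] [IsDomain D]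
    [CommRing D'] [Algebra R D'] [IsDomain D'] [Algebra.FiniteType R D] [Algebra.FiniteType R D']
    (f : D →ₐ[R] D') (hf : Function.Injective f) : td R D ≤ td R D' := by
  obtain ⟨v, hv, -⟩ := exists_basis (R := R) (D := D)
  have := le_td (R := R) (f ∘ v) (fun F hF => by
    have h1 : f (aeval v F) = aeval (f ∘ v) F := by
      rw [← AlgHom.comp_apply, MvPolynomial.comp_aeval]; rfl
    have h2 := hv F (hf (by rw [h1, hF, map_zero]))
    have h3 : algebraMap R D' = (f : D →+* D').comp (algebraMap R D) := f.comp_algebraMap.symm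
    rw [h3, ← MvPolynomial.map_map, h2, map_zero])
  simpa using this

lemma td_drop {R D D' : Type u} [CommRing R] [CommRing D] [Algebra R D] [IsDomain D]
    [CommRing D'] [Algebra R D'] [IsDomain D'] [Algebra.FiniteType R D] [Algebra.FiniteType R D']
    (f : D →ₐ[R] D') (hf : Function.Surjective f) (hni : ¬ Function.Injective f)
    (hR : ∀ a : R, algebraMap R D' a = 0 → algebraMap R D a = 0) : td R D' + 1 ≤ td R D := by
  obtain ⟨v, hv, -⟩ := exists_basis (R := R) (D := D')
  choose w hw using fun i => hf (v i)
  have hev : ∀ F : MvPolynomial _ R, f (aeval w F) = aeval v F := by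
    intro F
    rw [← AlgHom.comp_apply, MvPolynomial.comp_aeval]
    congr 2
    ext i; exact hw i
  have key : ∀ F : MvPolynomial _ R, aeval v F = 0 → aeval w F = 0 ∧ MvPolynomial.map (algebraMap R D) F = 0 := by
    intro F hF
    have h1 := hv F hF
    have h2 : MvPolynomial.map (algebraMap R D) F = 0 := by
      ext d
      rw [coeff_map, coeff_zero]
      apply hR
      rw [← coeff_map, h1, coeff_zero]
    refine ⟨?_, h2⟩
    rw [MvPolynomial.aeval_def, MvPolynomial.eval₂_eq_eval_map, h2, map_zero]
  have hw' : AI R w := fun F hF => (key F (by rw [← hev, hF, map_zero])).2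
  have hle : td R D' ≤ td R D := by simpa using le_td w hw'
  by_contra hcon
  have heq : td R D ≤ td R D' := by omega
  have halg : Algebra.IsAlgebraic (Algebra.adjoin R (Set.range w)) D := by
    rw [← isAlgebraic_adjoin_bot]
    have h1 := AlgebraicIndependent.isTranscendenceBasis_of_lift_trdeg_le ((ai_iff w).1 hw') trdeg_fin
      (by rw [← td_cast]; simpa using heq)
    exact h1.isAlgebraic
  rw [injective_iff_map_eq_zero] at hni
  push Not at hni
  obtain ⟨y, hy, hy0⟩ := hni
  obtain ⟨F, hF0, hF⟩ := exists_dvd_aeval w halg y hy0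
  apply hF0
  refine (key F ?_).1
  rw [← hev]
  obtain ⟨c, hc⟩ := hF
  rw [hc, map_mul, hy, zero_mul]

lemma td_base {R k D : Type u} [CommRing R] [CommRing k] [Algebra R k] [CommRing D] [IsDomain D]
    [Algebra R D] [Algebra k D] [IsScalarTower R k D] [Algebra.FiniteType R D]
    (hs : Function.Surjective (algebraMap R k)) : td R D = td k D := by
  have : Algebra.FiniteType k D := .of_restrictScalars_finiteType R k D
  have key : ∀ (n : ℕ) (v : Fin n → D), AI R v ↔ AI k v := by
    intro n v
    have e1 : ∀ F : MvPolynomial (Fin n) R, aeval v (MvPolynomial.map (algebraMap R k) F) = aeval v F :=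
      fun F => MvPolynomial.aeval_map_algebraMap ..
    have e2 : ∀ F : MvPolynomial (Fin n) R, MvPolynomial.map (algebraMap k D) (MvPolynomial.map (algebraMap R k) F)
      = MvPolynomial.map (algebraMap R D) F := fun F => by
        rw [MvPolynomial.map_map, ← IsScalarTower.algebraMap_eq]
    constructor
    · intro h F hF
      obtain ⟨F, rfl⟩ := MvPolynomial.map_surjective _ hs F
      rw [e2]; exact h F (by rw [← e1, hF])
    · intro h F hF
      rw [← e2]; exact h _ (by rw [e1, hF])
  apply le_antisymm
  · obtain ⟨v, hv, -⟩ := exists_basis (R := R) (D := D)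
    simpa using le_td v ((key _ v).1 hv)
  · obtain ⟨v, hv, -⟩ := exists_basis (R := k) (D := D)
    simpa using le_td v ((key _ v).2 hv)

end LPI

namespace LPI
open MvPolynomial

lemma intClosed_of_equiv {A B : Type u} [CommRing A] [CommRing B] [IsDomain A] [IsDomain B]
    (e : A ≃+* B) [IsIntegrallyClosed A] : IsIntegrallyClosed B := by
  let := (e : A →+* B).toAlgebra
  exact IsIntegrallyClosed.of_equiv e

lemma intClosed_mv {R : Type u} [CommRing R] [IsDomain R] [IsIntegrallyClosed R] (n : ℕ) :
    IsIntegrallyClosed (MvPolynomial (Fin n) R) := by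
  induction n with
  | zero => exact intClosed_of_equiv (isEmptyRingEquiv R (Fin 0)).symm
  | succ n ih => exact intClosed_of_equiv (finSuccEquiv R n).symm.toRingEquiv

lemma intClosed_mv' {R : Type u} [CommRing R] [IsDomain R] [IsIntegrallyClosed R] (ι : Type) [Fintype ι] :
    IsIntegrallyClosed (MvPolynomial ι R) := 
  have := intClosed_mv (R := R) (Fintype.card ι)
  intClosed_of_equiv (renameEquiv R (Fintype.equivFin ι).symm).toRingEquiv

/-- going down step -/
lemma gd_step {S D : Type u} [CommRing S] [IsDomain S] [IsIntegrallyClosed S] [CommRing D] [IsDomain D]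
    [Algebra S D] (hinj : Function.Injective (algebraMap S D)) (x : Ideal D) [x.IsPrime]
    (r : D) (hr : r ∉ x) (hri : IsIntegral S r) (hall : ∀ b, ∃ m, IsIntegral S (r ^ m * b))
    (p0 : Ideal S) [p0.IsPrime] (hp0 : p0 ≤ x.comap (algebraMap S D)) :
    ∃ p : Ideal D, p.IsPrime ∧ p ≤ x ∧ p.comap (algebraMap S D) = p0 := by
  let C := integralClosure S D
  have : FaithfulSMul S C := by
    rw [faithfulSMul_iff_algebraMap_injective]
    intro a b hab
    exact hinj (congrArg (algebraMap C D) hab)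
  let xC : Ideal C := x.comap (algebraMap C D)
  have : xC.LiesOver (x.comap (algebraMap S D)) := ⟨by
    ext a; rfl⟩
  obtain ⟨P, hPx, hP, hPl⟩ := Ideal.exists_ideal_le_liesOver_of_le (p := p0) (q := x.comap (algebraMap S D)) xC hp0
  let rC : C := ⟨r, hri⟩
  have hrP : rC ∉ P := fun h => hr (hPx h)
  let p : Ideal D :=
    { carrier := {b | ∃ m, ∃ c : C, c ∈ P ∧ (c : D) = r ^ m * b}
      zero_mem' := ⟨0, 0, P.zero_mem, by simp⟩
      add_mem' := by
        rintro a b ⟨m, c, hc, hca⟩ ⟨m', c', hc', hcb⟩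
        refine ⟨m + m', rC ^ m' * c + rC ^ m * c', P.add_mem (P.mul_mem_left _ hc) (P.mul_mem_left _ hc'), ?_⟩
        push_cast
        rw [hca, hcb]
        change r ^ m' * (r ^ m * a) + r ^ m * (r ^ m' * b) = _
        ring
      smul_mem' := by
        rintro s b ⟨m, c, hc, hcb⟩
        obtain ⟨m', hm'⟩ := hall s
        refine ⟨m' + m, ⟨_, hm'⟩ * c, P.mul_mem_left _ hc, ?_⟩
        push_cast
        rw [hcb, smul_eq_mul]; ring }
  have hpC : ∀ c : C, (c : D) ∈ p → c ∈ P := by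
    rintro c ⟨m, c', hc', h⟩
    have : c' = rC ^ m * c := Subtype.ext h
    rw [this] at hc'
    exact (hP.mem_or_mem hc').resolve_left fun h => hrP (hP.mem_of_pow_mem _ h)
  have hCp : ∀ c : C, c ∈ P → (c : D) ∈ p := fun c hc => ⟨0, c, hc, by simp⟩
  have hpx : p ≤ x := by
    rintro b ⟨m, c, hc, h⟩
    have h1 : (c : D) ∈ x := hPx hc
    rw [h] at h1
    exact ((inferInstance : x.IsPrime).mem_or_mem h1).resolve_left fun h => hr ((inferInstance : x.IsPrime).mem_of_pow_mem _ h)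
  have hrp : r ∉ p := fun h => hr (hpx h)
  refine ⟨p, ⟨fun h => hrp (by rw [h]; trivial), ?_⟩, hpx, ?_⟩
  · rintro a b ⟨m, c, hc, h⟩
    obtain ⟨m1, h1⟩ := hall a
    obtain ⟨m2, h2⟩ := hall b
    let c1 : C := ⟨_, h1⟩
    let c2 : C := ⟨_, h2⟩
    have h3 : rC ^ (m1 + m2) * c = rC ^ m * (c1 * c2) := by
      apply Subtype.ext
      push_cast
      rw [h]
      change r ^ (m1 + m2) * (r ^ m * (a * b)) = r ^ m * ((r ^ m1 * a) * (r ^ m2 * b))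
      ring
    have h4 : rC ^ m * (c1 * c2) ∈ P := h3 ▸ P.mul_mem_left _ hc
    have h5 := (hP.mem_or_mem h4).resolve_left fun h => hrP (hP.mem_of_pow_mem _ h)
    rcases hP.mem_or_mem h5 with h6 | h6
    · exact Or.inl ⟨m1, c1, h6, rfl⟩
    · exact Or.inr ⟨m2, c2, h6, rfl⟩
  · ext a
    have : p0 = P.comap (algebraMap S C) := hPl.over
    rw [this, Ideal.mem_comap, Ideal.mem_comap]
    exact ⟨fun h => hpC (algebraMap S C a) h, fun h => hCp (algebraMap S C a) h⟩

/-- dimension inequality with n equations, and the lifting statement in the equality case. -/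
lemma T3 {R D : Type u} [CommRing R] [CommRing D] [IsDomain D] [Algebra R D] [Algebra.FiniteType R D]
    (x : Ideal D) [hx : x.IsPrime] (n : ℕ) (f : Fin n → D) (hf : ∀ i, f i ∈ x)
    (hmin : ∀ z : Ideal D, z.IsPrime → z ≤ x → (∀ i, f i ∈ z) →
      z.comap (algebraMap R D) = x.comap (algebraMap R D) → z = x) :
    td R D ≤ td R (D ⧸ x) + n ∧
    (∀ [IsDomain R] [IsIntegrallyClosed R], Function.Injective (algebraMap R D) →
      td R (D ⧸ x) + n ≤ td R D →
      ∃ p : Ideal D, p.IsPrime ∧ p ≤ x ∧ (∀ i, f i ∈ p) ∧ p.comap (algebraMap R D) = ⊥ ∧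
        (td R (D ⧸ x) = 0 → Algebra.IsAlgebraic R (D ⧸ p))) := by
  obtain ⟨t', ht', halg⟩ := exists_basis (R := R) (D := D ⧸ x)
  choose t ht using fun i => Ideal.Quotient.mk_surjective (t' i)
  let e := td R (D ⧸ x)
  let S := MvPolynomial (Fin e ⊕ Fin n) R
  let v : Fin e ⊕ Fin n → D := Sum.elim t f
  let : Algebra S D := (aeval v).toRingHom.toAlgebra
  have hSD : ∀ F : S, algebraMap S D F = aeval v F := fun _ => rfl
  have : IsScalarTower R S D := IsScalarTower.of_algebraMap_eq fun a => by
    rw [hSD]; exact ((aeval v).commutes a).symm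
  have : Algebra.FiniteType S D := .of_restrictScalars_finiteType R S D
  have hmk : ∀ F : S, Ideal.Quotient.mk x (aeval v F) = aeval (Sum.elim t' 0 : Fin e ⊕ Fin n → D ⧸ x) F := by
    intro F
    rw [← Ideal.Quotient.mkₐ_eq_mk R, ← AlgHom.comp_apply, MvPolynomial.comp_aeval]
    congr 2
    ext i
    rcases i with i | i
    · simp [v, ht]
    · simpa [v] using Ideal.Quotient.eq_zero_iff_mem.mpr (hf i)
  have hcR : ∀ z : Ideal D, z.comap (algebraMap S D) = x.comap (algebraMap S D) →
      z.comap (algebraMap R D) = x.comap (algebraMap R D) := by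
    intro z hz
    rw [IsScalarTower.algebraMap_eq R S D, ← Ideal.comap_comap, hz, Ideal.comap_comap]
  obtain ⟨r, hrx, hri, hall⟩ := zmp (S := S) x (by
    intro z hz hzx hc
    refine hmin z hz hzx (fun i => ?_) (hcR z hc)
    have h1 : (X (Sum.inr i) : S) ∈ x.comap (algebraMap S D) := by
      rw [Ideal.mem_comap, hSD, aeval_X]; exact hf i
    rw [← hc, Ideal.mem_comap, hSD, aeval_X] at h1
    exact h1) (by
    intro z hz hxz hc
    refine le_antisymm (fun y hy => ?_) hxz
    by_contra hyx
    obtain ⟨F, hF0, c, hF⟩ := exists_dvd_aeval t' halg (Ideal.Quotient.mk x y)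
      (fun h => hyx (Ideal.Quotient.eq_zero_iff_mem.mp h))
    obtain ⟨c, rfl⟩ := Ideal.Quotient.mk_surjective c
    let G : S := rename Sum.inl F
    have hG : Ideal.Quotient.mk x (aeval v G) = aeval t' F := by
      rw [hmk, aeval_rename]; rfl
    have h1 : aeval v G - y * c ∈ x := by
      rw [← Ideal.Quotient.eq_zero_iff_mem, map_sub, hG, hF, map_mul, sub_self]
    have h2 : aeval v G ∈ z := by
      have := z.add_mem (hxz h1) (z.mul_mem_right c hy)
      simpa using this
    have h3 : G ∈ z.comap (algebraMap S D) := h2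
    rw [hc] at h3
    apply hF0
    rw [← hG, Ideal.Quotient.eq_zero_iff_mem]
    exact h3)
  have hr0 : r ≠ 0 := fun h => hrx (h ▸ x.zero_mem)
  have halgD : Algebra.IsAlgebraic (Algebra.adjoin R (Set.range v)) D := by
    refine alg_of_zmp (S := S) _ (fun F => ?_) ⟨r, hr0, hri, hall⟩
    rw [Algebra.adjoin_range_eq_range_aeval]
    exact ⟨F, rfl⟩
  have hcard : Fintype.card (Fin e ⊕ Fin n) = td R (D ⧸ x) + n := by simp [e]
  refine ⟨hcard ▸ td_le v halgD, ?_⟩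
  intro _ _ hinj hle
  have hai := ai_of_le v halgD (hcard ▸ hle)
  have hSinj : Function.Injective (algebraMap S D) := by
    rw [injective_iff_map_eq_zero]
    intro F hF
    exact MvPolynomial.map_injective _ hinj (by rw [hai F hF, map_zero])
  have : IsIntegrallyClosed S := intClosed_mv' _
  let φ : S →ₐ[R] MvPolynomial (Fin e) R := aeval (Sum.elim X 0)
  let p0 : Ideal S := RingHom.ker φ
  have : p0.IsPrime := RingHom.ker_isPrime _
  have hp0 : p0 ≤ x.comap (algebraMap S D) := by
    intro F hF
    have hF' : φ F = 0 := hF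
    rw [Ideal.mem_comap, hSD, ← Ideal.Quotient.eq_zero_iff_mem, hmk]
    have : aeval (Sum.elim t' 0 : Fin e ⊕ Fin n → D ⧸ x) F = aeval t' (φ F) := by
      rw [← AlgHom.comp_apply, MvPolynomial.comp_aeval]
      congr 2
      ext i
      rcases i with i | i <;> simp
    rw [this, hF', map_zero]
  obtain ⟨p, hp, hpx, hpc⟩ := gd_step hSinj x r hrx hri hall p0 hp0
  refine ⟨p, hp, hpx, ?_, ?_, ?_⟩
  · intro i
    have : (X (Sum.inr i) : S) ∈ p0 := by
      change φ _ = 0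
      exact (aeval_X _ _).trans rfl
    rw [← hpc, Ideal.mem_comap, hSD, aeval_X] at this
    exact this
  · rw [eq_bot_iff]
    intro a ha
    have h1 : algebraMap R S a ∈ p.comap (algebraMap S D) := by
      rw [Ideal.mem_comap, ← IsScalarTower.algebraMap_apply]; exact ha
    rw [hpc] at h1
    have h2 : φ (algebraMap R S a) = 0 := h1
    rw [AlgHom.commutes] at h2
    exact (C_injective _ _) (by rw [map_zero]; exact h2)
  · intro he
    have he' : e = 0 := he
    have hIE : IsEmpty (Fin e) := by rw [he']; infer_instance
    have hIntg : ∀ b : D, IsIntegral S b → IsAlgebraic R (Ideal.Quotient.mk p b) := by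
      intro b hb
      have h1 : IsIntegral R (Ideal.Quotient.mk p b) := by
        have h2 : ((Ideal.Quotient.mk p).comp (algebraMap S D)).IsIntegralElem (Ideal.Quotient.mk p b) := by
          obtain ⟨P, hP, h⟩ := hb
          refine ⟨P, hP, ?_⟩
          rw [← Polynomial.hom_eval₂, h, map_zero]
        have h3 : ((Ideal.Quotient.mk p).comp (algebraMap S D)) =
            (algebraMap R (D ⧸ p)).comp (constantCoeff : S →+* R) := by
          apply MvPolynomial.ringHom_ext
          · intro a
            simp only [RingHom.comp_apply, constantCoeff_C]
            rw [hSD, aeval_C]; rfl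
          · rintro (i | i)
            · exact hIE.elim i
            · simp only [RingHom.comp_apply, constantCoeff_X, map_zero, hSD, aeval_X]
              rw [Ideal.Quotient.eq_zero_iff_mem]
              have : (X (Sum.inr i) : S) ∈ p0 := by
                change φ _ = 0
                exact (aeval_X _ _).trans rfl
              rw [← hpc, Ideal.mem_comap, hSD, aeval_X] at this
              exact this
        rw [h3] at h2
        exact RingHom.IsIntegralElem.of_comp h2
      exact h1.isAlgebraic
    refine ⟨fun b => ?_⟩
    obtain ⟨b, rfl⟩ := Ideal.Quotient.mk_surjective b
    obtain ⟨m, hm⟩ := hall b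
    have h5 := hIntg _ hm
    rw [map_mul, map_pow] at h5
    refine IsAlgebraic.of_mul (pow_mem (mem_nonZeroDivisors_of_ne_zero ?_) m) ((hIntg _ hri).pow m) h5
    exact fun h => hrx (hpx (Ideal.Quotient.eq_zero_iff_mem.mp h))
end LPI

namespace LPI
open MvPolynomial TensorProduct

lemma flat_field {S L : Type u} [CommRing S] [IsDomain S] [Field L] [Algebra S L]
    (h : Function.Injective (algebraMap S L)) : Module.Flat S L := by
  have : FaithfulSMul S L := (faithfulSMul_iff_algebraMap_injective S L).mpr h
  let := FractionRing.liftAlgebra S L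
  exact Module.Flat.trans S (FractionRing S) L

lemma aeval_injective {R D : Type u} [CommRing R] [CommRing D] [Algebra R D]
    (h : Function.Injective (algebraMap R D)) {ι : Type} (t : ι → D) (ht : AI R t) :
    Function.Injective (aeval t : MvPolynomial ι R →ₐ[R] D) := by
  rw [injective_iff_map_eq_zero]
  intro F hF
  exact MvPolynomial.map_injective _ h (by rw [ht F hF, map_zero])

section
variable {R D D' : Type u} [CommRing R] [IsDomain R] [CommRing D] [IsDomain D] [Algebra R D]
  [CommRing D'] [IsDomain D'] [Algebra R D'] [Module.Flat R D]

lemma nzd_base {S L : Type u} [CommRing S] [CommRing L] [Algebra R S] [Algebra R L] [Algebra S L]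
    [IsScalarTower R S L] [Module.Flat S L] [IsDomain (S ⊗[R] D)] (w : S ⊗[R] D) (hw : w ≠ 0) :
    ∃ g : S ⊗[R] D →ₐ[R] L ⊗[R] D, (∀ s d, g (s ⊗ₜ d) = algebraMap S L s ⊗ₜ d) ∧
      ∀ y, g w * y = 0 → y = 0 := by
  let e := Algebra.TensorProduct.cancelBaseChange R S S L D
  have hmul : Function.Injective (LinearMap.lTensor L (LinearMap.mulLeft S w)) :=
    Module.Flat.lTensor_preserves_injective_linearMap _ (by
      intro p q h
      exact mul_left_cancel₀ hw h)
  have hmul' : ∀ y : L ⊗[S] (S ⊗[R] D), ((1 : L) ⊗ₜ[S] w) * y = 0 → y = 0 := by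
    intro y hy
    apply hmul
    rw [map_zero, ← hy]
    clear hy
    induction y with
    | zero => simp
    | add y z hy hz => rw [map_add, hy, hz, mul_add]
    | tmul l z => simp
  refine ⟨(e.toAlgHom.restrictScalars R).comp
      ((Algebra.TensorProduct.includeRight : S ⊗[R] D →ₐ[S] L ⊗[S] (S ⊗[R] D)).restrictScalars R), ?_, ?_⟩
  · intro s d
    simp [e, Algebra.smul_def]
  · intro y hy
    apply e.symm.injective
    rw [map_zero]
    apply hmul'
    apply e.injective
    rw [map_mul, AlgEquiv.apply_symm_apply, map_zero]
    exact hy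

lemma poly_ne (hD : Function.Injective (algebraMap R D)) {a b : ℕ} (t : Fin a → D) (ht : AI R t)
    (F : MvPolynomial (Fin b ⊕ Fin a) R) (hF : F ≠ 0) :
    aeval (Sum.elim (fun j => (X j : MvPolynomial (Fin b) R) ⊗ₜ[R] (1 : D))
      (fun i => (1 : MvPolynomial (Fin b) R) ⊗ₜ[R] t i)) F ≠ 0 := by
  let eW : MvPolynomial (Fin b) R ⊗[R] D ≃ₐ[R] MvPolynomial (Fin b) D :=
    (Algebra.TensorProduct.comm R _ D).trans ((algebraTensorAlgEquiv R D).restrictScalars R)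
  intro h
  apply hF
  let g : MvPolynomial (Fin b) (MvPolynomial (Fin a) R) →ₐ[R] MvPolynomial (Fin b) D :=
    MvPolynomial.mapAlgHom (aeval t : MvPolynomial (Fin a) R →ₐ[R] D)
  have h2 : eW.toAlgHom.comp (aeval (Sum.elim (fun j => (X j : MvPolynomial (Fin b) R) ⊗ₜ[R] (1 : D))
      (fun i => (1 : MvPolynomial (Fin b) R) ⊗ₜ[R] t i)))
      = g.comp (sumAlgEquiv R (Fin b) (Fin a)).toAlgHom := by
    apply MvPolynomial.algHom_ext
    rintro (j | i)
    · simp [eW, g]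
    · simp [eW, g, MvPolynomial.smul_eq_C_mul]
  have h1 := DFunLike.congr_fun h2 F
  have h4 : g (sumAlgEquiv R (Fin b) (Fin a) F) = 0 := by
    refine h1.symm.trans ?_
    exact (congrArg eW h).trans (map_zero eW)
  have h3 := MvPolynomial.map_injective _ (aeval_injective hD t ht) (a₁ := sumAlgEquiv R (Fin b) (Fin a) F) (a₂ := 0)
    (by rw [map_zero]; exact h4)
  simpa using h3

lemma tensor_nzd (hD : Function.Injective (algebraMap R D)) (hD' : Function.Injective (algebraMap R D'))
    {a b : ℕ} (t : Fin a → D) (s : Fin b → D') (ht : AI R t) (hs : AI R s)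
    (F : MvPolynomial (Fin b ⊕ Fin a) R) (hF : F ≠ 0) :
    aeval (Sum.elim (fun j => (1 : D) ⊗ₜ[R] s j) (fun i => t i ⊗ₜ[R] (1 : D'))) F ∈
      nonZeroDivisors (D ⊗[R] D') := by
  let s' : Fin b → FractionRing D' := fun j => algebraMap D' _ (s j)
  let _ : Algebra (MvPolynomial (Fin b) R) (FractionRing D') := (aeval s').toRingHom.toAlgebra
  have hSL : ∀ F : MvPolynomial (Fin b) R, algebraMap _ (FractionRing D') F = aeval s' F := fun _ => rfl
  have : IsScalarTower R (MvPolynomial (Fin b) R) (FractionRing D') := IsScalarTower.of_algebraMap_eq fun a => by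
    rw [hSL]; exact ((aeval s').commutes a).symm
  have hLinj : Function.Injective (algebraMap D' (FractionRing D')) := IsFractionRing.injective D' _
  have hSinj : Function.Injective (algebraMap (MvPolynomial (Fin b) R) (FractionRing D')) := by
    have h1 : ∀ F : MvPolynomial (Fin b) R, algebraMap _ (FractionRing D') F = algebraMap D' _ (aeval s F) := by
      intro F
      rw [hSL]
      exact MvPolynomial.aeval_algebraMap_apply _ _ _
    intro F G h
    rw [h1, h1] at h
    exact aeval_injective hD' s hs (hLinj h)
  have : Module.Flat (MvPolynomial (Fin b) R) (FractionRing D') := flat_field hSinj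
  have : IsDomain (MvPolynomial (Fin b) R ⊗[R] D) :=
    ((Algebra.TensorProduct.comm R _ D).trans ((algebraTensorAlgEquiv (σ := Fin b) R D).restrictScalars R)).toMulEquiv.isDomain
  obtain ⟨g, hg, hmul⟩ := nzd_base (L := FractionRing D') _ (poly_ne hD t ht F hF)
  let j : D ⊗[R] D' →ₐ[R] (FractionRing D') ⊗[R] D :=
    (Algebra.TensorProduct.map (IsScalarTower.toAlgHom R D' (FractionRing D')) (AlgHom.id R D)).comp
      (Algebra.TensorProduct.comm R D D').toAlgHom
  have hj : Function.Injective j := by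
    have h1 : Function.Injective (LinearMap.rTensor D (IsScalarTower.toAlgHom R D' (FractionRing D')).toLinearMap) :=
      Module.Flat.rTensor_preserves_injective_linearMap _ hLinj
    exact h1.comp (Algebra.TensorProduct.comm R D D').injective
  have hjF : j (aeval (Sum.elim (fun j => (1 : D) ⊗ₜ[R] s j) (fun i => t i ⊗ₜ[R] (1 : D'))) F)
      = g (aeval (Sum.elim (fun j => (X j : MvPolynomial (Fin b) R) ⊗ₜ[R] (1 : D))
      (fun i => (1 : MvPolynomial (Fin b) R) ⊗ₜ[R] t i)) F) := by
    have h2 : j.comp (aeval (Sum.elim (fun j => (1 : D) ⊗ₜ[R] s j) (fun i => t i ⊗ₜ[R] (1 : D'))))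
        = g.comp (aeval (Sum.elim (fun j => (X j : MvPolynomial (Fin b) R) ⊗ₜ[R] (1 : D))
      (fun i => (1 : MvPolynomial (Fin b) R) ⊗ₜ[R] t i))) := by
      apply MvPolynomial.algHom_ext
      rintro (i | i)
      · simp [j, hg, hSL, s']
      · simp [j, hg]
    exact DFunLike.congr_fun h2 F
  rw [mem_nonZeroDivisors_iff_right]
  intro y hy
  apply hj
  rw [map_zero]
  apply hmul
  rw [← hjF, ← map_mul, mul_comm, hy, map_zero]

lemma ft_tensor [Algebra.FiniteType R D] [Algebra.FiniteType R D'] : Algebra.FiniteType R (D ⊗[R] D') :=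
  Algebra.FiniteType.trans (S := D) inferInstance inferInstance

lemma T4 (hD : Function.Injective (algebraMap R D)) (hD' : Function.Injective (algebraMap R D'))
    [Algebra.FiniteType R D] [Algebra.FiniteType R D'] (β : Ideal (D ⊗[R] D')) [β.IsPrime]
    (hβ : β ∈ minimalPrimes (D ⊗[R] D')) :
    td R D + td R D' ≤ td R ((D ⊗[R] D') ⧸ β) ∧ Function.Injective (algebraMap R ((D ⊗[R] D') ⧸ β)) := by
  have := ft_tensor (R := R) (D := D) (D' := D')
  have : Algebra.FiniteType R ((D ⊗[R] D') ⧸ β) :=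
    .of_surjective (Ideal.Quotient.mkₐ R β) Ideal.Quotient.mk_surjective
  obtain ⟨t, ht, -⟩ := exists_basis (R := R) (D := D)
  obtain ⟨s, hs, -⟩ := exists_basis (R := R) (D := D')
  let v := (Sum.elim (fun j => (1 : D) ⊗ₜ[R] s j) (fun i => t i ⊗ₜ[R] (1 : D')))
  have key : ∀ F : MvPolynomial _ R, aeval v F ∈ β → F = 0 := by
    intro F hF
    by_contra hF0
    exact Set.disjoint_left.mp (Ideal.disjoint_nonZeroDivisors_of_mem_minimalPrimes hβ) hF
      (tensor_nzd hD hD' t s ht hs F hF0)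
  have hmk : ∀ F : MvPolynomial _ R, aeval (fun i => Ideal.Quotient.mk β (v i)) F = Ideal.Quotient.mk β (aeval v F) := by
    intro F
    rw [← Ideal.Quotient.mkₐ_eq_mk R, ← AlgHom.comp_apply, MvPolynomial.comp_aeval]
  constructor
  · have := le_td (R := R) (fun i => Ideal.Quotient.mk β (v i)) (by
      intro F hF
      rw [hmk, Ideal.Quotient.eq_zero_iff_mem] at hF
      rw [key F hF, map_zero])
    simp at this
    omega
  · rw [injective_iff_map_eq_zero]
    intro a ha
    have : (C a : MvPolynomial (Fin (td R D') ⊕ Fin (td R D)) R) = 0 := by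
      apply key
      rw [aeval_C]
      exact Ideal.Quotient.eq_zero_iff_mem.mp ha
    exact C_injective _ _ (by rw [this, map_zero])
end
end LPI

namespace LPI
open MvPolynomial TensorProduct

lemma lemD {P A Ω L : Type u} [CommRing P] [CommRing A] [Algebra P A] [CommRing Ω] [IsDomain Ω]
    [CommRing L] [Nontrivial L] [Algebra.EssFiniteType P A] [Algebra.FormallyUnramified P A]
    (u v : A →+* Ω) (huv : u.comp (algebraMap P A) = v.comp (algebraMap P A)) (w : Ω →+* L)
    (hw : w.comp u = w.comp v) : u = v := by
  obtain ⟨t, ht, ht1⟩ := Algebra.FormallyUnramified.iff_exists_tensorProduct.mp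
    (inferInstance : Algebra.FormallyUnramified P A)
  let _ : Algebra P Ω := (u.comp (algebraMap P A)).toAlgebra
  let u' : A →ₐ[P] Ω := { u with commutes' := fun r => rfl }
  let v' : A →ₐ[P] Ω := { v with commutes' := fun r => (DFunLike.congr_fun huv r).symm }
  let μ : A ⊗[P] A →ₐ[P] Ω := Algebra.TensorProduct.lift u' v' fun _ _ => .all _ _
  have h1 : ∀ y, w (μ y) = w (u (Algebra.TensorProduct.lmul' P y)) := by
    intro y
    induction y with
    | zero => simp
    | add y z hy hz => simp only [map_add, hy, hz]
    | tmul a b =>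
      have h2 : w (v b) = w (u b) := (DFunLike.congr_fun hw b).symm
      have h3 : μ (a ⊗ₜ b) = u a * v b := by
        simp only [μ, Algebra.TensorProduct.lift_tmul]; rfl
      rw [h3, Algebra.TensorProduct.lmul'_apply_tmul, map_mul, map_mul, map_mul, h2]
  have hne : μ t ≠ 0 := by
    intro h
    have := h1 t
    rw [h, ht1, map_zero, map_one, map_one] at this
    exact zero_ne_one this
  ext a
  have h4 : μ (1 ⊗ₜ[P] a - a ⊗ₜ[P] 1) = v a - u a := by
    rw [map_sub]
    simp only [μ, Algebra.TensorProduct.lift_tmul, map_one, one_mul, mul_one]; rfl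
  have h5 := congrArg μ (ht a)
  rw [map_mul, map_zero, h4] at h5
  exact (sub_eq_zero.mp ((mul_eq_zero.mp h5).resolve_right hne)).symm

section
variable {R D D' E : Type u} [CommRing R] [IsDomain R] [CommRing D] [IsDomain D] [Algebra R D]
  [CommRing D'] [IsDomain D'] [Algebra R D'] [Module.Flat R D] [CommRing E] [IsDomain E] [Algebra R E]
  [Algebra.FiniteType R D] [Algebra.FiniteType R D']

lemma lemM (hD : Function.Injective (algebraMap R D)) (hD' : Function.Injective (algebraMap R D'))
    (κ : D ⊗[R] D' →ₐ[R] E) (hκ : Function.Surjective κ) (n : ℕ) (f : Fin n → D ⊗[R] D')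
    (hf : ∀ i, κ (f i) = 0)
    (hmin : ∀ z : Ideal (D ⊗[R] D'), z.IsPrime → z ≤ RingHom.ker κ → (∀ i, f i ∈ z) →
      z.comap (algebraMap R _) = (RingHom.ker κ).comap (algebraMap R _) → z = RingHom.ker κ) :
    td R D + td R D' ≤ td R E + n ∧ (∀ [IsIntegrallyClosed R], td R E + n ≤ td R D + td R D' →
      ∃ p : Ideal (D ⊗[R] D'), p.IsPrime ∧ p ≤ RingHom.ker κ ∧ (∀ i, f i ∈ p) ∧
        p.comap (algebraMap R _) = ⊥ ∧ (td R E = 0 → Algebra.IsAlgebraic R ((D ⊗[R] D') ⧸ p))) := by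
  have := ft_tensor (R := R) (D := D) (D' := D')
  have hXp : (RingHom.ker κ).IsPrime := RingHom.ker_isPrime _
  obtain ⟨β, hβ, hβX⟩ := Ideal.exists_minimalPrimes_le (I := (⊥ : Ideal (D ⊗[R] D'))) (J := RingHom.ker κ) bot_le
  have hβp : β.IsPrime := hβ.1.1
  have : Algebra.FiniteType R ((D ⊗[R] D') ⧸ β) :=
    .of_surjective (Ideal.Quotient.mkₐ R β) Ideal.Quotient.mk_surjective
  obtain ⟨htd, hinj⟩ := T4 hD hD' β hβ
  let κ' : (D ⊗[R] D') ⧸ β →ₐ[R] E := Ideal.Quotient.liftₐ β κ hβX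
  have hκ' : ∀ b, κ' (Ideal.Quotient.mk β b) = κ b := fun b => rfl
  have hκs : Function.Surjective κ' := fun e => by
    obtain ⟨b, rfl⟩ := hκ e
    exact ⟨Ideal.Quotient.mk β b, rfl⟩
  let x : Ideal ((D ⊗[R] D') ⧸ β) := RingHom.ker κ'
  have hxp : x.IsPrime := RingHom.ker_isPrime _
  have hcx : x.comap (Ideal.Quotient.mk β) = RingHom.ker κ := rfl
  have e : (((D ⊗[R] D') ⧸ β) ⧸ x) ≃ₐ[R] E := Ideal.quotientKerAlgEquivOfSurjective hκs
  have hE : Algebra.FiniteType R E := .of_surjective κ hκ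
  have : Algebra.FiniteType R (((D ⊗[R] D') ⧸ β) ⧸ x) :=
    .of_surjective (Ideal.Quotient.mkₐ R x) Ideal.Quotient.mk_surjective
  have htE : td R (((D ⊗[R] D') ⧸ β) ⧸ x) = td R E :=
    le_antisymm (td_le_of_injective e.toAlgHom e.injective) (td_le_of_injective e.symm.toAlgHom e.symm.injective)
  have halgm : (Ideal.Quotient.mk β).comp (algebraMap R (D ⊗[R] D')) = algebraMap R _ := rfl
  obtain ⟨h1, h2⟩ := T3 (R := R) x n (fun i => Ideal.Quotient.mk β (f i)) (fun i => hf i) (by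
    intro z hz hzx hfz hc
    have hz' : (z.comap (Ideal.Quotient.mk β)).IsPrime := Ideal.IsPrime.comap _
    have := hmin (z.comap (Ideal.Quotient.mk β)) hz' (by
      rw [← hcx]; exact Ideal.comap_mono hzx) hfz (by
      rw [← hcx, Ideal.comap_comap, Ideal.comap_comap]; exact hc)
    rw [← hcx] at this
    exact Ideal.comap_injective_of_surjective _ Ideal.Quotient.mk_surjective this)
  rw [htE] at h1 h2
  refine ⟨htd.trans h1, ?_⟩
  intro _ hle
  obtain ⟨p, hp, hpx, hfp, hpb, halg⟩ := h2 hinj (hle.trans htd)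
  refine ⟨p.comap (Ideal.Quotient.mk β), Ideal.IsPrime.comap _, ?_, hfp, ?_, ?_⟩
  · rw [← hcx]; exact Ideal.comap_mono hpx
  · rw [Ideal.comap_comap]; exact hpb
  · intro h0
    have := halg h0
    exact Algebra.IsAlgebraic.of_injective
      (Ideal.quotientMapₐ (I := p.comap (Ideal.Quotient.mk β)) p (Ideal.Quotient.mkₐ R β) le_rfl)
      Ideal.quotientMap_injective

variable {R₁ A : Type u} [CommRing R₁] [CommRing A] [Algebra R₁ A] {d : ℕ}
  [Algebra (MvPolynomial (Fin d) R₁) A] [IsScalarTower R₁ (MvPolynomial (Fin d) R₁) A]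
  [Algebra.EssFiniteType (MvPolynomial (Fin d) R₁) A]
  [Algebra.FormallyUnramified (MvPolynomial (Fin d) R₁) A]

/-- the elements cutting out the diagonal -/
noncomputable def dia (α : A →+* D) (α' : A →+* D') (a : A) : D ⊗[R] D' :=
  α a ⊗ₜ 1 - 1 ⊗ₜ α' a

lemma pull (κ : D ⊗[R] D' →ₐ[R] E) (g : R₁ →+* R)
    (α : A →+* D) (α' : A →+* D') (hα : ∀ a, α (algebraMap R₁ A a) = algebraMap R D (g a))
    (hα' : ∀ a, α' (algebraMap R₁ A a) = algebraMap R D' (g a)) (hs : Function.Surjective α)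
    (hs' : Function.Surjective α') (hκ : ∀ a, κ (dia α α' a) = 0)
    (z : Ideal (D ⊗[R] D')) (hz : z.IsPrime) (hzk : z ≤ RingHom.ker κ)
    (hX : ∀ i, dia α α' (algebraMap (MvPolynomial (Fin d) R₁) A (X i)) ∈ z) :
    (∀ a, dia α α' a ∈ z) ∧ (∀ b, ∃ a, b - α a ⊗ₜ 1 ∈ z) := by
  let iL : D →+* D ⊗[R] D' := Algebra.TensorProduct.includeLeftRingHom
  let iR : D' →+* D ⊗[R] D' := (Algebra.TensorProduct.includeRight : D' →ₐ[R] D ⊗[R] D').toRingHom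
  let u : A →+* (D ⊗[R] D') ⧸ z := (Ideal.Quotient.mk z).comp (iL.comp α)
  let v : A →+* (D ⊗[R] D') ⧸ z := (Ideal.Quotient.mk z).comp (iR.comp α')
  have hdia : ∀ a, u a - v a = Ideal.Quotient.mk z (dia α α' a) := fun a => by
    simp only [u, v, dia, map_sub]; rfl
  have huv : u = v := by
    let w : (D ⊗[R] D') ⧸ z →+* E := Ideal.Quotient.lift z κ.toRingHom (fun a ha => hzk ha)
    refine lemD (P := MvPolynomial (Fin d) R₁) u v ?_ w ?_
    · apply MvPolynomial.ringHom_ext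
      · intro a
        have e1 : algebraMap (MvPolynomial (Fin d) R₁) A (C a) = algebraMap R₁ A a :=
          (IsScalarTower.algebraMap_apply R₁ (MvPolynomial (Fin d) R₁) A a).symm
        have e2 : dia α α' (algebraMap R₁ A a) = (0 : D ⊗[R] D') := by
          rw [dia, hα, hα', sub_eq_zero, ← Algebra.TensorProduct.algebraMap_apply,
            ← Algebra.TensorProduct.algebraMap_apply']
        have e3 : u (algebraMap R₁ A a) = v (algebraMap R₁ A a) :=
          sub_eq_zero.mp (by rw [hdia, e2, map_zero])
        exact (congrArg u e1).trans (e3.trans (congrArg v e1.symm))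
      · intro i
        exact sub_eq_zero.mp ((hdia _).trans (Ideal.Quotient.eq_zero_iff_mem.mpr (hX i)))
    · ext a
      have e4 : w (u a) - w (v a) = 0 := by
        rw [← map_sub, hdia]
        exact hκ a
      exact sub_eq_zero.mp e4
  have h1 : ∀ a, dia α α' a ∈ z := fun a => by
    rw [← Ideal.Quotient.eq_zero_iff_mem, ← hdia, huv, sub_self]
  refine ⟨h1, fun b => ?_⟩
  induction b with
  | zero => exact ⟨0, by simp⟩
  | add b c hb hc =>
    obtain ⟨a, ha⟩ := hb
    obtain ⟨a', ha'⟩ := hc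
    refine ⟨a + a', ?_⟩
    have := z.add_mem ha ha'
    rwa [map_add, TensorProduct.add_tmul, add_sub_add_comm]
  | tmul b c =>
    obtain ⟨b, rfl⟩ := hs b
    obtain ⟨c, rfl⟩ := hs' c
    refine ⟨b * c, ?_⟩
    have := z.mul_mem_left (α b ⊗ₜ 1) (h1 c)
    rw [dia, mul_sub, Algebra.TensorProduct.tmul_mul_tmul, Algebra.TensorProduct.tmul_mul_tmul] at this
    rw [← neg_mem_iff, neg_sub, map_mul]
    simpa using this

lemma lemN (g : R₁ →+* R) (hg : Function.Surjective g)
    (hD : Function.Injective (algebraMap R D)) (hD' : Function.Injective (algebraMap R D'))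
    (π : D →ₐ[R] E) (π' : D' →ₐ[R] E)
    (α : A →+* D) (α' : A →+* D') (hα : ∀ a, α (algebraMap R₁ A a) = algebraMap R D (g a))
    (hα' : ∀ a, α' (algebraMap R₁ A a) = algebraMap R D' (g a)) (hs : Function.Surjective α)
    (hs' : Function.Surjective α') (hπ : ∀ a, π (α a) = π' (α' a)) (hπs : Function.Surjective π)
    (r : ℕ) (h : Fin r → A) (hh : ∀ i, π (α (h i)) = 0)
    (hmin : ∀ z : Ideal A, z.IsPrime → RingHom.ker α ≤ z → RingHom.ker α' ≤ z → (∀ i, h i ∈ z) →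
      (∀ a ∈ z, π (α a) = 0) → (∀ a : R₁, π (α (algebraMap R₁ A a)) = 0 → algebraMap R₁ A a ∈ z) →
      (∀ a, π (α a) = 0 → a ∈ z)) :
    td R D + td R D' ≤ td R E + (d + r) ∧ (∀ [IsIntegrallyClosed R], td R E + (d + r) ≤ td R D + td R D' →
      ∃ p : Ideal A, p.IsPrime ∧ RingHom.ker α ≤ p ∧ RingHom.ker α' ≤ p ∧ (∀ a ∈ p, π (α a) = 0) ∧
        (∀ a : R₁, algebraMap R₁ A a ∈ p → g a = 0) ∧
        (td R E = 0 → ∀ a, ∃ f : Polynomial R₁, f.map g ≠ 0 ∧ Polynomial.aeval a f ∈ p)) := by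
  let κ : D ⊗[R] D' →ₐ[R] E := Algebra.TensorProduct.lift π π' fun _ _ => .all _ _
  have hκ : ∀ b c, κ (b ⊗ₜ c) = π b * π' c := fun b c => Algebra.TensorProduct.lift_tmul ..
  have hκs : Function.Surjective κ := fun e => by
    obtain ⟨b, rfl⟩ := hπs e
    exact ⟨b ⊗ₜ 1, by simp [hκ]⟩
  have hdia : ∀ a, κ (dia α α' a) = 0 := fun a => by
    rw [dia, map_sub, hκ, hκ, map_one, map_one, hπ, mul_one, one_mul, sub_self]
  let f : Fin (d + r) → D ⊗[R] D' := Fin.append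
    (fun i => dia α α' (algebraMap (MvPolynomial (Fin d) R₁) A (X i))) (fun i => α (h i) ⊗ₜ 1)
  have hfz : ∀ z : Ideal (D ⊗[R] D'), (∀ i, f i ∈ z) ↔
      (∀ i, dia α α' (algebraMap (MvPolynomial (Fin d) R₁) A (X i)) ∈ z) ∧ ∀ i, α (h i) ⊗ₜ 1 ∈ z := by
    intro z
    constructor
    · intro hf
      exact ⟨fun i => by simpa [f] using hf (Fin.castAdd r i), fun i => by simpa [f] using hf (Fin.natAdd d i)⟩
    · rintro ⟨h1, h2⟩ i
      refine Fin.addCases (fun i => ?_) (fun i => ?_) i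
      · simpa [f] using h1 i
      · simpa [f] using h2 i
  let ρ : A →+* D ⊗[R] D' := Algebra.TensorProduct.includeLeftRingHom.comp α
  have hρ : ∀ a, ρ a = α a ⊗ₜ 1 := fun _ => rfl
  have hρR : ∀ a, ρ (algebraMap R₁ A a) = algebraMap R _ (g a) := fun a => by
    rw [hρ, hα, ← Algebra.TensorProduct.algebraMap_apply]
  have hκρ : ∀ a, κ (ρ a) = π (α a) := fun a => by rw [hρ, hκ, map_one, mul_one]
  have pk : ∀ z : Ideal (D ⊗[R] D'), z.IsPrime → z ≤ RingHom.ker κ → (∀ i, f i ∈ z) →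
      (z.comap ρ).IsPrime ∧ RingHom.ker α ≤ z.comap ρ ∧ RingHom.ker α' ≤ z.comap ρ ∧
      (∀ i, h i ∈ z.comap ρ) ∧ (∀ a ∈ z.comap ρ, π (α a) = 0) ∧ (∀ b, ∃ a, b - ρ a ∈ z) := by
    intro z hz hzk hf
    obtain ⟨h1, h2⟩ := (hfz z).1 hf
    obtain ⟨h3, h4⟩ := pull κ g α α' hα hα' hs hs' hdia z hz hzk h1
    refine ⟨Ideal.IsPrime.comap _, ?_, ?_, h2, ?_, h4⟩
    · intro a ha
      rw [Ideal.mem_comap, hρ, show α a = 0 from ha, TensorProduct.zero_tmul]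
      exact z.zero_mem
    · intro a ha
      have := h3 a
      rw [dia, show α' a = 0 from ha, TensorProduct.tmul_zero, sub_zero] at this
      exact this
    · intro a ha
      rw [← hκρ]
      exact hzk ha
  obtain ⟨h1, h2⟩ := lemM hD hD' κ hκs (d + r) f ((hfz (RingHom.ker κ)).2 ⟨fun i => hdia _, fun i => by
      rw [← hρ, RingHom.mem_ker, hκρ, hh]⟩) (by
    intro z hz hzk hf hc
    obtain ⟨a1, a2, a3, a4, a5, a6⟩ := pk z hz hzk hf
    refine le_antisymm hzk ?_
    have h5 := hmin (z.comap ρ) a1 a2 a3 a4 a5 (by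
      intro a ha
      rw [Ideal.mem_comap, hρR, ← Ideal.mem_comap, hc, Ideal.mem_comap, ← hρR, RingHom.mem_ker, hκρ, ha])
    intro b hb
    obtain ⟨a, ha⟩ := a6 b
    have h6 : κ (b - ρ a) = 0 := hzk ha
    rw [map_sub, show κ b = 0 from hb, zero_sub, neg_eq_zero, hκρ] at h6
    have h7 := z.add_mem ha (h5 a h6)
    simpa using h7)
  refine ⟨h1, ?_⟩
  intro _ hle
  obtain ⟨p, hp, hpk, hfp, hpb, halg⟩ := h2 hle
  obtain ⟨a1, a2, a3, a4, a5, a6⟩ := pk p hp hpk hfp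
  refine ⟨p.comap ρ, a1, a2, a3, a5, ?_, ?_⟩
  · intro a ha
    rw [Ideal.mem_comap, hρR, ← Ideal.mem_comap, hpb] at ha
    exact ha
  · intro h0 a
    have := halg h0
    obtain ⟨f, hf, hy⟩ := this.isAlgebraic (Ideal.Quotient.mk p (ρ a))
    obtain ⟨f, rfl⟩ := Polynomial.map_surjective g hg f
    refine ⟨f, hf, ?_⟩
    rw [Ideal.mem_comap, ← Ideal.Quotient.eq_zero_iff_mem, ← hy, Polynomial.aeval_def,
      Polynomial.aeval_def, Polynomial.eval₂_map, Polynomial.hom_eval₂, Polynomial.hom_eval₂]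
    congr 1
    ext c
    exact congrArg (Ideal.Quotient.mk p) (hρR c)
end
end LPI

namespace LPI
open MvPolynomial

/-- parameters at a prime of a Noetherian ring -/
lemma params {B : Type u} [CommRing B] [IsNoetherianRing B] (Q : Ideal B) [Q.IsPrime] :
    ∃ (n : ℕ) (f : Fin n → B), (n : ℕ∞) = Q.height ∧ (∀ i, f i ∈ Q) ∧
      ∀ z : Ideal B, z.IsPrime → z ≤ Q → (∀ i, f i ∈ z) → z = Q := by
  obtain ⟨s, hs, hc⟩ := Ideal.exists_finset_card_eq_height_of_isNoetherianRing Q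
  refine ⟨s.card, fun i => (s.equivFin.symm i).1, hc, fun i => ?_, fun z hz hzQ hf => ?_⟩
  · exact hs.1.2 (Ideal.subset_span (s.equivFin.symm i).2)
  · refine le_antisymm hzQ (hs.2 ⟨hz, Ideal.span_le.mpr fun a ha => ?_⟩ hzQ)
    have := hf (s.equivFin ⟨a, ha⟩)
    simpa using this

lemma map_mk_prime {A : Type u} [CommRing A] {J Q : Ideal A} (hJ : J ≤ Q) [hQ : Q.IsPrime] :
    (Q.map (Ideal.Quotient.mk J)).IsPrime :=
  Ideal.map_isPrime_of_surjective Ideal.Quotient.mk_surjective (by rwa [Ideal.mk_ker])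

lemma comap_map_mk {A : Type u} [CommRing A] {J Q : Ideal A} (hJ : J ≤ Q) :
    (Q.map (Ideal.Quotient.mk J)).comap (Ideal.Quotient.mk J) = Q :=
  Ideal.comap_map_mk hJ

lemma params_quot {A : Type u} [CommRing A] (J Q : Ideal A) [IsNoetherianRing (A ⧸ J)] [hQ : Q.IsPrime]
    (hJ : J ≤ Q) :
    ∃ (n : ℕ) (f : Fin n → A), (n : ℕ∞) = (Q.map (Ideal.Quotient.mk J)).height ∧ (∀ i, f i ∈ Q) ∧
      ∀ z : Ideal A, z.IsPrime → J ≤ z → z ≤ Q → (∀ i, f i ∈ z) → z = Q := by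
  have := map_mk_prime hJ
  obtain ⟨n, f, hn, hf, hz⟩ := params (Q.map (Ideal.Quotient.mk J))
  choose F hF using fun i => Ideal.Quotient.mk_surjective (f i)
  refine ⟨n, F, hn, fun i => ?_, fun z hzp hJz hzQ hFz => ?_⟩
  · have := hf i
    rw [← hF, ← Ideal.mem_comap, comap_map_mk hJ] at this
    exact this
  · have := map_mk_prime hJz
    have h := hz (z.map (Ideal.Quotient.mk J)) this (Ideal.map_mono hzQ) (fun i => by
      rw [← hF]; exact Ideal.mem_map_of_mem _ (hFz i))
    rw [← comap_map_mk hJz, h, comap_map_mk hJ]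

lemma params_gen {R A : Type u} [CommRing R] [IsDomain R] [CommRing A] [Algebra R A]
    [Algebra.FiniteType R A] (q : Ideal A) [hq : q.IsPrime] (hq0 : q.comap (algebraMap R A) = ⊥) :
    ∃ (n : ℕ) (f : Fin n → A), (n : ℕ∞) = q.height ∧ (∀ i, f i ∈ q) ∧
      ∀ z : Ideal A, z.IsPrime → z ≤ q → (∀ i, f i ∈ z) → z = q := by
  let M := Algebra.algebraMapSubmonoid A (nonZeroDivisors R)
  let B := Localization M
  let K := FractionRing R
  let _ : Algebra K B := localizationAlgebra (nonZeroDivisors R) A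
  have : IsNoetherianRing B := by
    have h1 : (algebraMap R A).FiniteType := by rw [RingHom.finiteType_algebraMap]; infer_instance
    have hloc : IsLocalization ((nonZeroDivisors R).map (algebraMap R A)) B :=
      inferInstanceAs (IsLocalization M (Localization M))
    have h3 := RingHom.finiteType_localizationPreserves (algebraMap R A) (nonZeroDivisors R) K B h1
    have h4 : Algebra.FiniteType K B := h3
    exact Algebra.FiniteType.isNoetherianRing K B
  have hdisj : ∀ z : Ideal A, z ≤ q → Disjoint (M : Set A) z := by
    intro z hz
    rw [Set.disjoint_left]
    rintro _ ⟨r, hr, rfl⟩ hrz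
    have : r ∈ q.comap (algebraMap R A) := hz hrz
    rw [hq0] at this
    exact nonZeroDivisors.ne_zero hr this
  have hpr : ∀ z : Ideal A, z.IsPrime → z ≤ q → (z.map (algebraMap A B)).IsPrime := fun z hz hzq =>
    IsLocalization.isPrime_of_isPrime_disjoint M B z hz (hdisj z hzq)
  have hcm : ∀ z : Ideal A, z.IsPrime → z ≤ q → (z.map (algebraMap A B)).comap (algebraMap A B) = z := 
    fun z hz hzq => IsLocalization.under_map_of_isPrime_disjoint M B hz (hdisj z hzq)
  have := hpr q hq le_rfl
  obtain ⟨n, f, hn, hf, hz⟩ := params (q.map (algebraMap A B))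
  choose F hF using fun i => IsLocalization.surj M (f i)
  refine ⟨n, fun i => (F i).1, ?_, fun i => ?_, fun z hzp hzq hFz => ?_⟩
  · rw [hn, IsLocalization.height_map_of_disjoint M q (hdisj q le_rfl)]
  · rw [← hcm q hq le_rfl, Ideal.mem_comap, ← hF]
    exact Ideal.mul_mem_right _ _ (hf i)
  · have h := hz (z.map (algebraMap A B)) (hpr z hzp hzq) (Ideal.map_mono hzq) (fun i => by
      have h1 : f i * algebraMap A B (F i).2 ∈ z.map (algebraMap A B) := by
        rw [hF]; exact Ideal.mem_map_of_mem _ (hFz i)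
      exact (Ideal.mul_unit_mem_iff_mem _ (IsLocalization.map_units B (F i).2)).mp h1)
    rw [← hcm z hzp hzq, h, hcm q hq le_rfl]

end LPI

namespace LPI
open MvPolynomial

instance ft_quot {R A : Type u} [CommRing R] [CommRing A] [Algebra R A] [Algebra.FiniteType R A]
    (Q : Ideal A) : Algebra.FiniteType R (A ⧸ Q) :=
  .of_surjective (Ideal.Quotient.mkₐ R Q) Ideal.Quotient.mk_surjective

lemma td_equiv {R D D' : Type u} [CommRing R] [CommRing D] [Algebra R D] [IsDomain D]
    [CommRing D'] [Algebra R D'] [IsDomain D'] [Algebra.FiniteType R D] [Algebra.FiniteType R D']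
    (e : D ≃ₐ[R] D') : td R D = td R D' :=
  le_antisymm (td_le_of_injective e.toAlgHom e.injective)
    (td_le_of_injective e.symm.toAlgHom e.symm.injective)

section
variable {R A : Type u} [CommRing R] [CommRing A] [Algebra R A] [Algebra.FiniteType R A]

lemma T3' (β Q : Ideal A) [hβ : β.IsPrime] [hQ : Q.IsPrime] (hβQ : β ≤ Q) (n : ℕ) (f : Fin n → A)
    (hf : ∀ i, f i ∈ Q)
    (hmin : ∀ z : Ideal A, z.IsPrime → β ≤ z → z ≤ Q → (∀ i, f i ∈ z) →
      z.comap (algebraMap R A) = Q.comap (algebraMap R A) → z = Q) :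
    td R (A ⧸ β) ≤ td R (A ⧸ Q) + n := by
  let X : Ideal (A ⧸ β) := Q.map (Ideal.Quotient.mk β)
  have hX : X.IsPrime := map_mk_prime hβQ
  have hcX : X.comap (Ideal.Quotient.mk β) = Q := comap_map_mk hβQ
  have e : ((A ⧸ β) ⧸ X) ≃ₐ[R] A ⧸ Q := DoubleQuot.quotQuotEquivQuotOfLEₐ R hβQ
  rw [← td_equiv e]
  refine (T3 (R := R) X n (fun i => Ideal.Quotient.mk β (f i))
    (fun i => Ideal.mem_map_of_mem _ (hf i)) ?_).1
  intro z hz hzx hfz hc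
  have hz' : (z.comap (Ideal.Quotient.mk β)).IsPrime := Ideal.IsPrime.comap _
  have := hmin (z.comap (Ideal.Quotient.mk β)) hz' (by
      intro a ha
      rw [Ideal.mem_comap, Ideal.Quotient.eq_zero_iff_mem.mpr ha]
      exact z.zero_mem) (by
      rw [← hcX]; exact Ideal.comap_mono hzx) hfz (by
      rw [← hcX, Ideal.comap_comap, Ideal.comap_comap]; exact hc)
  rw [← hcX] at this
  exact Ideal.comap_injective_of_surjective _ Ideal.Quotient.mk_surjective this

variable {d : ℕ} [Algebra (MvPolynomial (Fin d) R) A] [IsScalarTower R (MvPolynomial (Fin d) R) A]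

lemma aeval_quot (β : Ideal A) (F : MvPolynomial (Fin d) R) :
    aeval (fun i => Ideal.Quotient.mk β (algebraMap (MvPolynomial (Fin d) R) A (X i))) F =
      Ideal.Quotient.mk β (algebraMap (MvPolynomial (Fin d) R) A F) := by
  have : aeval (fun i => Ideal.Quotient.mk β (algebraMap (MvPolynomial (Fin d) R) A (X i))) =
    (Ideal.Quotient.mkₐ R β).comp (IsScalarTower.toAlgHom R (MvPolynomial (Fin d) R) A) := by
    ext i
    simp
  rw [this]
  rfl

lemma E_ge [Module.Flat (MvPolynomial (Fin d) R) A] (Q : Ideal A) [hQ : Q.IsPrime] (n : ℕ) (f : Fin n → A)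
    (hf : ∀ i, f i ∈ Q)
    (hmin : ∀ z : Ideal A, z.IsPrime → z ≤ Q → (∀ i, f i ∈ z) →
      z.comap (algebraMap R A) = Q.comap (algebraMap R A) → z = Q) :
    d ≤ td R (A ⧸ Q) + n := by
  let S := MvPolynomial (Fin d) R
  let p : Ideal R := Q.comap (algebraMap R A)
  have hp : p.IsPrime := Ideal.IsPrime.comap _
  let pS : Ideal S := p.map C
  have hpS : pS.IsPrime := by
    have h1 : pS = RingHom.ker (MvPolynomial.map (σ := Fin d) (Ideal.Quotient.mk p)) := by
      rw [MvPolynomial.ker_map, Ideal.mk_ker]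
    rw [h1]; exact RingHom.ker_isPrime _
  have hCA : ∀ a : R, algebraMap S A (C a) = algebraMap R A a := fun a =>
    (IsScalarTower.algebraMap_apply R S A a).symm
  have hle : pS ≤ Q.under S := by
    refine Ideal.map_le_iff_le_comap.mpr fun a ha => ?_
    change algebraMap S A (C a) ∈ Q
    rw [hCA]; exact ha
  have : Q.LiesOver (Q.under S) := ⟨rfl⟩
  obtain ⟨β, hβQ, hβ, hβo⟩ := Ideal.exists_ideal_le_liesOver_of_le Q hle
  have hβc : β.comap (algebraMap S A) = pS := hβo.over.symm
  refine le_trans ?_ (T3' (R := R) β Q hβQ n f hf fun z hz _ h2 h3 h4 => hmin z hz h2 h3 h4)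
  have := le_td (R := R) (D := A ⧸ β) (fun i : Fin d => Ideal.Quotient.mk β (algebraMap S A (X i))) ?_
  · simpa using this
  intro F hF
  rw [aeval_quot, Ideal.Quotient.eq_zero_iff_mem, ← Ideal.mem_comap, hβc] at hF
  have hF' := MvPolynomial.mem_map_C_iff.mp hF
  ext m
  rw [coeff_map, coeff_zero]
  refine (Ideal.Quotient.eq_zero_iff_mem (I := β)).mpr ?_
  rw [← hCA]
  change C (coeff m F) ∈ β.comap (algebraMap S A)
  rw [hβc]
  exact Ideal.mem_map_of_mem _ (hF' m)

lemma td_le_d [Algebra.FiniteType (MvPolynomial (Fin d) R) A] [Algebra.QuasiFinite (MvPolynomial (Fin d) R) A]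
    (Q : Ideal A) [hQ : Q.IsPrime] : td R (A ⧸ Q) ≤ d := by
  let S := MvPolynomial (Fin d) R
  let v : Fin d → A ⧸ Q := fun i => Ideal.Quotient.mk Q (algebraMap S A (X i))
  have h := zmp (S := S) (B := A ⧸ Q) ⊥
    (fun z hz h1 h2 => Algebra.QuasiFinite.eq_of_le_of_under_eq (R := S) z ⊥ h1 h2)
    (fun z hz h1 h2 => (Algebra.QuasiFinite.eq_of_le_of_under_eq (R := S) ⊥ z h1 h2.symm).symm)
  have := td_le (R := R) v (alg_of_zmp (R := R) (S := S) _ (fun s => by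
    have : algebraMap S (A ⧸ Q) s = aeval v s := (aeval_quot Q s).symm
    rw [this, Algebra.adjoin_range_eq_range_aeval]
    exact ⟨s, rfl⟩) h)
  simpa using this

lemma chain_aux (J : Ideal A) : ∀ (n : ℕ) (a : PrimeSpectrum (A ⧸ J)), (n : ℕ∞) ≤ Order.height a →
    ∃ l : LTSeries (PrimeSpectrum (A ⧸ J)), l.last = a ∧ l.length = n :=
  fun _ a h => Order.exists_series_of_le_height a h

lemma chain (J : Ideal A) (m : Ideal R) (hm : m.IsMaximal) (hmJ : m ≤ J.comap (algebraMap R A)) :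
    ∀ (n : ℕ) (Q : Ideal A) [Q.IsPrime], J ≤ Q → (n : ℕ∞) ≤ (Q.map (Ideal.Quotient.mk J)).height →
    ∃ P : Ideal A, P.IsPrime ∧ J ≤ P ∧ P ≤ Q ∧ n + td R (A ⧸ Q) ≤ td R (A ⧸ P) := by
  intro n
  induction n with
  | zero => exact fun Q hQ hJQ _ => ⟨Q, hQ, hJQ, le_rfl, by simp⟩
  | succ n ih =>
    intro Q hQ hJQ hn
    have hp := map_mk_prime hJQ
    rw [PrimeSpectrum.height_eq_orderHeight ⟨Q.map (Ideal.Quotient.mk J), hp⟩] at hn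
    obtain ⟨l, hl, hln⟩ := Order.exists_series_of_le_height _ hn
    have hne : l.length ≠ 0 := by omega
    let b := l.eraseLast.last
    have hb : b < ⟨Q.map (Ideal.Quotient.mk J), hp⟩ := by
      rw [← hl]; exact l.eraseLast_last_rel_last hne
    have hbn : (n : ℕ∞) ≤ Order.height b := by
      have := Order.length_le_height_last (p := l.eraseLast)
      have e : l.eraseLast.length = n := by rw [RelSeries.eraseLast_length]; omega
      rwa [e] at this
    let Q' := b.asIdeal.comap (Ideal.Quotient.mk J)
    have hQ' : Q'.IsPrime := Ideal.IsPrime.comap _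
    have hJQ' : J ≤ Q' := fun a ha => by
      rw [Ideal.mem_comap, Ideal.Quotient.eq_zero_iff_mem.mpr ha]
      exact b.asIdeal.zero_mem
    have hmap : Q'.map (Ideal.Quotient.mk J) = b.asIdeal :=
      Ideal.map_comap_of_surjective _ Ideal.Quotient.mk_surjective _
    have hlt : Q' < Q := by
      refine lt_of_le_of_ne ?_ ?_
      · have := Ideal.comap_mono (f := Ideal.Quotient.mk J) (show b.asIdeal ≤ _ from hb.le)
        rwa [comap_map_mk hJQ] at this
      · intro h
        refine hb.ne (PrimeSpectrum.ext ?_)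
        rw [← hmap, h]
    obtain ⟨P, hP, hJP, hPQ, hle⟩ := ih Q' hJQ' (by
      rw [hmap, PrimeSpectrum.height_eq_orderHeight b]; exact hbn)
    refine ⟨P, hP, hJP, hPQ.trans hlt.le, ?_⟩
    have hcm : ∀ Z : Ideal A, Z.IsPrime → J ≤ Z → Z.comap (algebraMap R A) = m := fun Z hZ hJZ => by
      have : (Z.comap (algebraMap R A)).IsPrime := Ideal.IsPrime.comap _
      exact (hm.eq_of_le this.ne_top (hmJ.trans (Ideal.comap_mono hJZ))).symm
    have := td_drop (R := R) (D := A ⧸ Q') (D' := A ⧸ Q) (Ideal.Quotient.factorₐ R hlt.le)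
      (Ideal.Quotient.factor_surjective hlt.le) (by
        intro hinj
        obtain ⟨a, haQ, haQ'⟩ := SetLike.exists_of_lt hlt
        refine haQ' (Ideal.Quotient.eq_zero_iff_mem.mp (hinj ?_))
        rw [map_zero]
        exact Ideal.Quotient.eq_zero_iff_mem.mpr haQ) (by
        intro a ha
        have ha' : a ∈ Q.comap (algebraMap R A) := (Ideal.Quotient.eq_zero_iff_mem (I := Q)).mp ha
        rw [hcm Q hQ hJQ, ← hcm Q' hQ' hJQ'] at ha'
        exact (Ideal.Quotient.eq_zero_iff_mem (I := Q')).mpr ha')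
    omega
end
end LPI

namespace LPI
open MvPolynomial

section
variable {R A : Type u} [CommRing R] [CommRing A] [Algebra R A]

lemma noeth_special [Algebra.FiniteType R A] (m : Ideal R) (hm : m.IsMaximal) (J : Ideal A)
    (hJ : m ≤ J.comap (algebraMap R A)) :
    IsNoetherianRing (A ⧸ J) := by
  let _ : Field (R ⧸ m) := Ideal.Quotient.field m
  let _ : Algebra (R ⧸ m) (A ⧸ J) := Ideal.Quotient.algebraQuotientOfLEComap hJ
  have : IsScalarTower R (R ⧸ m) (A ⧸ J) := .of_algebraMap_eq' rfl
  have : Algebra.FiniteType (R ⧸ m) (A ⧸ J) := .of_restrictScalars_finiteType R _ _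
  exact Algebra.FiniteType.isNoetherianRing (R ⧸ m) (A ⧸ J)

lemma comap_eq_max (m : Ideal R) (hm : m.IsMaximal) (Q : Ideal A) [hQ : Q.IsPrime]
    (h : m.map (algebraMap R A) ≤ Q) : Q.comap (algebraMap R A) = m := by
  have : (Q.comap (algebraMap R A)).IsPrime := Ideal.IsPrime.comap _
  exact (hm.eq_of_le this.ne_top (Ideal.map_le_iff_le_comap.mp h)).symm

/-- height in the special fibre versus height -/
lemma ht_special [Module.Flat R A] [IsDomain R] (m : Ideal R) (hm : m.IsMaximal) (hm0 : m ≠ ⊥)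
    (Q : Ideal A) [hQ : Q.IsPrime] (h : m.map (algebraMap R A) ≤ Q) (n : ℕ)
    (hn : (n : ℕ∞) ≤ (Q.map (Ideal.Quotient.mk (m.map (algebraMap R A)))).height) :
    ((n + 1 : ℕ) : ℕ∞) ≤ Q.height := by
  have hp := map_mk_prime h
  rw [PrimeSpectrum.height_eq_orderHeight ⟨_, hp⟩] at hn
  obtain ⟨l, hl, hln⟩ := Order.exists_series_of_le_height _ hn
  let φ : PrimeSpectrum (A ⧸ m.map (algebraMap R A)) → PrimeSpectrum A :=
    PrimeSpectrum.comap (Ideal.Quotient.mk _)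
  have hφ : StrictMono φ := by
    apply Monotone.strictMono_of_injective
    · exact fun a b hab => Ideal.comap_mono hab
    · exact PrimeSpectrum.comap_injective_of_surjective _ Ideal.Quotient.mk_surjective
  let l' := l.map φ hφ
  have hlast : l'.last = ⟨Q, hQ⟩ := by
    rw [LTSeries.last_map, hl]
    exact PrimeSpectrum.ext (comap_map_mk h)
  have hhead : m.map (algebraMap R A) ≤ l'.head.asIdeal := by
    rw [LTSeries.head_map]
    intro a ha
    change Ideal.Quotient.mk _ a ∈ l.head.asIdeal
    rw [Ideal.Quotient.eq_zero_iff_mem.mpr ha]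
    exact Ideal.zero_mem _
  have hc := comap_eq_max m hm l'.head.asIdeal hhead
  have : l'.head.asIdeal.LiesOver m := ⟨hc.symm⟩
  have hmp := hm.isPrime
  obtain ⟨P, hPle, hP, hPo⟩ := Ideal.exists_ideal_le_liesOver_of_le (p := (⊥ : Ideal R)) (q := m)
    l'.head.asIdeal bot_le
  have hlt : (⟨P, hP⟩ : PrimeSpectrum A) < l'.head := by
    refine lt_of_le_of_ne hPle ?_
    intro he
    apply hm0
    rw [← hc, ← he]
    exact hPo.over.symm
  let l'' := l'.cons ⟨P, hP⟩ hlt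
  have := Order.length_le_height_last (p := l'')
  rw [RelSeries.last_cons, hlast, ← PrimeSpectrum.height_eq_orderHeight] at this
  have e : l''.length = n + 1 := by
    simp [l'', l', hln]
  rwa [e] at this

variable {d : ℕ} [Algebra (MvPolynomial (Fin d) R) A] [IsScalarTower R (MvPolynomial (Fin d) R) A]
  [Algebra.Etale (MvPolynomial (Fin d) R) A] 

lemma special_formula [Algebra.FiniteType R A] (m : Ideal R) (hm : m.IsMaximal) 
    (Q : Ideal A) [hQ : Q.IsPrime] (h : m.map (algebraMap R A) ≤ Q) :
    ∃ n : ℕ, (n : ℕ∞) = (Q.map (Ideal.Quotient.mk (m.map (algebraMap R A)))).height ∧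
      n + td R (A ⧸ Q) = d := by
  have := noeth_special (A := A) m hm _ Ideal.le_comap_map
  obtain ⟨n, f, hn, hf, hz⟩ := params_quot (m.map (algebraMap R A)) Q h
  refine ⟨n, hn, le_antisymm ?_ ?_⟩
  · obtain ⟨P, hP, -, -, hle⟩ := chain (R := R) _ m hm Ideal.le_comap_map n Q h hn.le
    exact hle.trans (td_le_d P)
  · rw [add_comm]
    refine E_ge (R := R) Q n f hf fun z hzp hzQ hfz hc => hz z hzp ?_ hzQ hfz
    rw [Ideal.map_le_iff_le_comap, hc]
    exact Ideal.map_le_iff_le_comap.mp h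

lemma generic_formula [IsDomain R] [Algebra.FiniteType R A] (q : Ideal A) [hq : q.IsPrime] 
    (h : q.comap (algebraMap R A) = ⊥) (j : ℕ) (hj : q.height = j) :
    d ≤ td R (A ⧸ q) + j := by
  obtain ⟨n, f, hn, hf, hz⟩ := params_gen q h
  have : n = j := by rw [hj] at hn; exact_mod_cast hn
  subst this
  exact E_ge (R := R) q n f hf fun z hzp hzQ hfz _ => hz z hzp hzQ hfz

lemma special_ineq [Algebra.FiniteType R A] (m : Ideal R) (hm : m.IsMaximal) (q q' P : Ideal A)
    [hq : q.IsPrime] [hq' : q'.IsPrime] [hP : P.IsPrime] (hmq : m.map (algebraMap R A) ≤ q)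
    (hmq' : m.map (algebraMap R A) ≤ q') (hqP : q ≤ P) (hqP' : q' ≤ P)
    (hmin : ∀ z : Ideal A, z.IsPrime → q ≤ z → q' ≤ z → z ≤ P → P ≤ z) :
    td R (A ⧸ q) + td R (A ⧸ q') ≤ td R (A ⧸ P) + d := by
  let _ : Field (R ⧸ m) := Ideal.Quotient.field m
  let _ : Algebra (R ⧸ m) (A ⧸ q) := Ideal.Quotient.algebraQuotientOfLEComap (comap_eq_max m hm q hmq).ge
  let _ : Algebra (R ⧸ m) (A ⧸ q') := Ideal.Quotient.algebraQuotientOfLEComap (comap_eq_max m hm q' hmq').ge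
  let _ : Algebra (R ⧸ m) (A ⧸ P) :=
    Ideal.Quotient.algebraQuotientOfLEComap (comap_eq_max m hm P (hmq.trans hqP)).ge
  have : IsScalarTower R (R ⧸ m) (A ⧸ q) := .of_algebraMap_eq' rfl
  have : IsScalarTower R (R ⧸ m) (A ⧸ q') := .of_algebraMap_eq' rfl
  have : IsScalarTower R (R ⧸ m) (A ⧸ P) := .of_algebraMap_eq' rfl
  have : Algebra.FiniteType (R ⧸ m) (A ⧸ q) := .of_restrictScalars_finiteType R _ _
  have : Algebra.FiniteType (R ⧸ m) (A ⧸ q') := .of_restrictScalars_finiteType R _ _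
  have hs : Function.Surjective (algebraMap R (R ⧸ m)) := Ideal.Quotient.mk_surjective
  rw [td_base (D := A ⧸ q) hs, td_base (D := A ⧸ q') hs, td_base (D := A ⧸ P) hs]
  let π : (A ⧸ q) →ₐ[R ⧸ m] A ⧸ P :=
    { Ideal.Quotient.factor hqP with
      commutes' := fun r => by
        obtain ⟨r, rfl⟩ := Ideal.Quotient.mk_surjective r
        rfl }
  let π' : (A ⧸ q') →ₐ[R ⧸ m] A ⧸ P :=
    { Ideal.Quotient.factor hqP' with
      commutes' := fun r => by
        obtain ⟨r, rfl⟩ := Ideal.Quotient.mk_surjective r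
        rfl }
  have := (lemN (R := R ⧸ m) (d := d) (Ideal.Quotient.mk m) Ideal.Quotient.mk_surjective
    (algebraMap (R ⧸ m) (A ⧸ q)).injective (algebraMap (R ⧸ m) (A ⧸ q')).injective π π'
    (Ideal.Quotient.mk q) (Ideal.Quotient.mk q') (fun _ => rfl) (fun _ => rfl)
    Ideal.Quotient.mk_surjective Ideal.Quotient.mk_surjective (fun _ => rfl)
    (Ideal.Quotient.factor_surjective hqP) 0 Fin.elim0 (fun i => i.elim0) (by
      intro z hz h1 h2 _ h4 _ a ha
      rw [Ideal.mk_ker] at h1 h2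
      exact hmin z hz h1 h2 (fun b hb => Ideal.Quotient.eq_zero_iff_mem.mp (h4 b hb))
        (Ideal.Quotient.eq_zero_iff_mem.mp ha))).1
  simpa using this

end
end LPI

namespace LPI
open MvPolynomial

lemma flat_of_inj {R D : Type u} [CommRing R] [IsDomain R] [ValuationRing R] [CommRing D] [IsDomain D]
    [Algebra R D] (h : Function.Injective (algebraMap R D)) : Module.Flat R D := by
  have : Module.IsTorsionFree R D := by
    have : FaithfulSMul R D := (faithfulSMul_iff_algebraMap_injective R D).mpr h
    infer_instance
  rw [Module.Flat.flat_iff_torsion_eq_bot_of_isBezout, ← Submodule.isTorsionFree_iff_torsion_eq_bot]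
  infer_instance

section
variable {R A : Type u} [CommRing R] [IsDomain R] [CommRing A] [Algebra R A]

lemma inj_quot {q : Ideal A} (h : q.comap (algebraMap R A) = ⊥) :
    Function.Injective (algebraMap R (A ⧸ q)) := by
  rw [injective_iff_map_eq_zero]
  intro a ha
  have : a ∈ q.comap (algebraMap R A) := (Ideal.Quotient.eq_zero_iff_mem (I := q)).mp ha
  rwa [h] at this

lemma comap_eq_bot (m : Ideal R) (hprimes : ∀ p : Ideal R, p.IsPrime → p = ⊥ ∨ p = m)
    (q : Ideal A) [hq : q.IsPrime] (h : ¬ m.map (algebraMap R A) ≤ q) :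
    q.comap (algebraMap R A) = ⊥ :=
  (hprimes _ (Ideal.IsPrime.comap _)).resolve_right fun h' =>
    h (Ideal.map_le_iff_le_comap.mpr h'.ge)

lemma exists_special (d : ℕ) [Algebra (MvPolynomial (Fin d) R) A]
    [IsScalarTower R (MvPolynomial (Fin d) R) A]
    [Algebra.Etale (MvPolynomial (Fin d) R) A] [Algebra.FiniteType R A] [Module.Flat R A]
    (m : Ideal R) (hm : m.IsMaximal) (hm0 : m ≠ ⊥)
    (hprimes : ∀ p : Ideal R, p.IsPrime → p = ⊥ ∨ p = m) (q x : Ideal A)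
    [hq : q.IsPrime] [hx : x.IsPrime] (hqx : q ≤ x) (hmx : m.map (algebraMap R A) ≤ x)
    (j : ℕ) (hj : q.height = j) :
    ∃ s : Ideal A, s.IsPrime ∧ q ≤ s ∧ s ≤ x ∧ m.map (algebraMap R A) ≤ s ∧ d ≤ td R (A ⧸ s) + j := by
  by_cases h : m.map (algebraMap R A) ≤ q
  · obtain ⟨n, hn, hd⟩ := special_formula (d := d) m hm q h
    have h1 := ht_special m hm hm0 q h n hn.le
    rw [hj] at h1
    have h2 : n + 1 ≤ j := by exact_mod_cast h1
    exact ⟨q, hq, le_rfl, hqx, h, by omega⟩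
  · have h0 := comap_eq_bot m hprimes q h
    obtain ⟨s, hs, hsx⟩ := Ideal.exists_minimalPrimes_le (I := q ⊔ m.map (algebraMap R A)) (J := x)
      (sup_le hqx hmx)
    have hsp : s.IsPrime := hs.1.1
    have hqs : q ≤ s := le_sup_left.trans hs.1.2
    have hms : m.map (algebraMap R A) ≤ s := le_sup_right.trans hs.1.2
    refine ⟨s, hsp, hqs, hsx, hms, ?_⟩
    have h1 := generic_formula (d := d) q h0 j hj
    have h2 := T3' (R := R) q s hqs 0 Fin.elim0 (fun i => i.elim0) (by
      intro z hz hqz hzs _ hc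
      refine le_antisymm hzs (hs.2 ⟨hz, sup_le hqz ?_⟩ hzs)
      rw [Ideal.map_le_iff_le_comap, hc]
      exact Ideal.map_le_iff_le_comap.mp hms)
    omega

lemma case0 (d : ℕ) [Algebra (MvPolynomial (Fin d) R) A]
    [IsScalarTower R (MvPolynomial (Fin d) R) A]
    [Algebra.Etale (MvPolynomial (Fin d) R) A] [Algebra.FiniteType R A] [Module.Flat R A]
    (m : Ideal R) (hm : m.IsMaximal) (hm0 : m ≠ ⊥)
    (hprimes : ∀ p : Ideal R, p.IsPrime → p = ⊥ ∨ p = m) (q q' x : Ideal A)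
    [hq : q.IsPrime] [hq' : q'.IsPrime] [hx : x.IsPrime] (hqx : q ≤ x) (hqx' : q' ≤ x)
    (hmx : m.map (algebraMap R A) ≤ x)
    (j j' : ℕ) (hj : q.height = j) (hj' : q'.height = j')
    (hP : ∀ P : Ideal A, P.IsPrime → q ≤ P → q' ≤ P → m.map (algebraMap R A) ≤ P → P ≤ x →
      ((j + j' : ℕ) : ℕ∞) ≤ (P.map (Ideal.Quotient.mk (m.map (algebraMap R A)))).height) :
    ¬ m.map (algebraMap R A) ≤ q := by
  intro h
  obtain ⟨n, hn, hd⟩ := special_formula (d := d) m hm q h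
  have h1 := ht_special m hm hm0 q h n hn.le
  rw [hj] at h1
  have h2 : n + 1 ≤ j := by exact_mod_cast h1
  obtain ⟨s, hs, hqs, hsx, hms, hds⟩ := exists_special d m hm hm0 hprimes q' x hqx' hmx j' hj'
  obtain ⟨P, hPm, hPx⟩ := Ideal.exists_minimalPrimes_le (I := q ⊔ s) (J := x) (sup_le hqx hsx)
  have hPp : P.IsPrime := hPm.1.1
  have hqP : q ≤ P := le_sup_left.trans hPm.1.2
  have hsP : s ≤ P := le_sup_right.trans hPm.1.2
  have h3 := special_ineq (d := d) m hm q s P h hms hqP hsP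
    (fun z hz h1 h2 h3 => hPm.2 ⟨hz, sup_le h1 h2⟩ h3)
  obtain ⟨nP, hnP, hdP⟩ := special_formula (d := d) m hm P (h.trans hqP)
  have h4 := hP P hPp hqP (hqs.trans hsP) (h.trans hqP) hPx
  rw [← hnP] at h4
  have h5 : j + j' ≤ nP := by exact_mod_cast h4
  omega

lemma mainEtale (d : ℕ) [Algebra (MvPolynomial (Fin d) R) A]
    [IsScalarTower R (MvPolynomial (Fin d) R) A]
    [Algebra.Etale (MvPolynomial (Fin d) R) A] [Algebra.FiniteType R A] [Module.Flat R A]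
    [ValuationRing R] (m : Ideal R) (hm : m.IsMaximal) (hm0 : m ≠ ⊥)
    (hprimes : ∀ p : Ideal R, p.IsPrime → p = ⊥ ∨ p = m) (q q' x : Ideal A)
    [hq : q.IsPrime] [hq' : q'.IsPrime] [hx : x.IsPrime] (hqx : q ≤ x) (hqx' : q' ≤ x)
    (hmx : m.map (algebraMap R A) ≤ x)
    (j j' : ℕ) (hj : q.height = j) (hj' : q'.height = j')
    (hP : ∀ P : Ideal A, P.IsPrime → q ≤ P → q' ≤ P → m.map (algebraMap R A) ≤ P → P ≤ x →
      ((j + j' : ℕ) : ℕ∞) ≤ (P.map (Ideal.Quotient.mk (m.map (algebraMap R A)))).height) :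
    ∃ p : Ideal A, p.IsPrime ∧ q ≤ p ∧ q' ≤ p ∧ p ≤ x ∧ p.comap (algebraMap R A) = ⊥ ∧
      (td R (A ⧸ x) = 0 → ∀ a, ∃ f : Polynomial R, f ≠ 0 ∧ Polynomial.aeval a f ∈ p) := by
  have h1 := comap_eq_bot m hprimes q
    (case0 d m hm hm0 hprimes q q' x hqx hqx' hmx j j' hj hj' hP)
  have h2 := comap_eq_bot m hprimes q'
    (case0 d m hm hm0 hprimes q' q x hqx' hqx hmx j' j hj' hj (fun P a b c e f => by
      rw [add_comm]; exact hP P a c b e f))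
  have i1 := inj_quot h1
  have i2 := inj_quot h2
  have f1 := flat_of_inj i1
  have d1 := generic_formula (d := d) q h1 j hj
  have d2 := generic_formula (d := d) q' h2 j' hj'
  let J := q ⊔ q' ⊔ m.map (algebraMap R A)
  have hmJ : m ≤ J.comap (algebraMap R A) := Ideal.map_le_iff_le_comap.mp le_sup_right
  have hJx : J ≤ x := sup_le (sup_le hqx hqx') hmx
  have := noeth_special (A := A) m hm J hmJ
  obtain ⟨r, h, hr, hh, hz⟩ := params_quot J x hJx
  obtain ⟨P, hPp, hJP, hPx, hle⟩ := chain (R := R) J m hm hmJ r x hJx hr.le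
  have hqP : q ≤ P := (le_sup_left.trans le_sup_left).trans hJP
  have hqP' : q' ≤ P := (le_sup_right.trans le_sup_left).trans hJP
  have hmP : m.map (algebraMap R A) ≤ P := le_sup_right.trans hJP
  obtain ⟨nP, hnP, hdP⟩ := special_formula (d := d) m hm P hmP
  have h4 := hP P hPp hqP hqP' hmP hPx
  rw [← hnP] at h4
  have h5 : j + j' ≤ nP := by exact_mod_cast h4
  have hxc := comap_eq_max m hm x hmx
  obtain ⟨p, hp, a1, a2, a3, a4, a5⟩ := (lemN (R := R) (d := d) (RingHom.id R) Function.surjective_id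
    i1 i2 (Ideal.Quotient.factorₐ R hqx) (Ideal.Quotient.factorₐ R hqx')
    (Ideal.Quotient.mk q) (Ideal.Quotient.mk q') (fun _ => rfl) (fun _ => rfl)
    Ideal.Quotient.mk_surjective Ideal.Quotient.mk_surjective (fun _ => rfl)
    (Ideal.Quotient.factor_surjective hqx) r h
    (fun i => Ideal.Quotient.eq_zero_iff_mem.mpr (hh i)) (by
      intro z hzp b1 b2 b3 b4 b5 a ha
      rw [Ideal.mk_ker] at b1 b2
      have hzx : z ≤ x := fun b hb => Ideal.Quotient.eq_zero_iff_mem.mp (b4 b hb)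
      have hmz : m.map (algebraMap R A) ≤ z := by
        rw [Ideal.map_le_iff_le_comap]
        intro a ha
        exact b5 a (Ideal.Quotient.eq_zero_iff_mem.mpr (hmx (Ideal.mem_map_of_mem _ ha)))
      rw [hz z hzp (sup_le (sup_le b1 b2) hmz) hzx b3]
      exact Ideal.Quotient.eq_zero_iff_mem.mp ha)).2 (by omega)
  rw [Ideal.mk_ker] at a1 a2
  refine ⟨p, hp, a1, a2, fun b hb => Ideal.Quotient.eq_zero_iff_mem.mp (a3 b hb), ?_, by
    simpa only [Polynomial.map_id] using a5⟩
  rw [eq_bot_iff]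
  exact fun a ha => a4 a ha

end
end LPI

namespace LPI
open TensorProduct

lemma alg_aux {k L : Type u} [CommRing k] [CommRing L] [Algebra k L] [Algebra.FiniteType k L]
    (hk : IsField k) (hL : IsField L) : Algebra.IsAlgebraic k L := by
  let _ := hk.toField
  let _ := hL.toField
  have hfin : Module.Finite k L := finite_of_finite_type_of_isJacobsonRing _ _
  exact Algebra.IsAlgebraic.of_finite k L

lemma inj_aux {k L : Type u} [CommRing k] [CommRing L] [Nontrivial L] [Algebra k L]
    (hk : IsField k) : Function.Injective (algebraMap k L) := by
  let _ := hk.toField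
  exact FaithfulSMul.algebraMap_injective k L

lemma td_zero {R A : Type u} [CommRing R] [CommRing A] [Algebra R A] [Algebra.FiniteType R A]
    (m : Ideal R) (hm : m.IsMaximal) (x : Ideal A) [hx : x.IsMaximal]
    (h : m.map (algebraMap R A) ≤ x) : td R (A ⧸ x) = 0 := by
  let _ : Algebra (R ⧸ m) (A ⧸ x) := Ideal.Quotient.algebraQuotientOfLEComap (comap_eq_max m hm x h).ge
  have : IsScalarTower R (R ⧸ m) (A ⧸ x) := .of_algebraMap_eq fun _ => rfl
  have hs : Function.Surjective (algebraMap R (R ⧸ m)) := Ideal.Quotient.mk_surjective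
  rw [td_base (D := A ⧸ x) hs]
  have ft : Algebra.FiniteType (R ⧸ m) (A ⧸ x) := .of_restrictScalars_finiteType R _ _
  have halg : Algebra.IsAlgebraic (R ⧸ m) (A ⧸ x) := alg_aux ((Ideal.Quotient.maximal_ideal_iff_isField_quotient m).mp hm)
    ((Ideal.Quotient.maximal_ideal_iff_isField_quotient x).mp hx)
  have hinj : Function.Injective (algebraMap (R ⧸ m)
      (Algebra.adjoin (R ⧸ m) (Set.range (Fin.elim0 : Fin 0 → A ⧸ x)))) := by
    have hi : Function.Injective (algebraMap (R ⧸ m) (A ⧸ x)) := by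
      exact inj_aux ((Ideal.Quotient.maximal_ideal_iff_isField_quotient m).mp hm)
    intro a b hab
    exact hi (congrArg Subtype.val hab)
  have := td_le (R := R ⧸ m) (D := A ⧸ x) (ι := Fin 0) Fin.elim0
    (Algebra.IsAlgebraic.extendScalars (R := R ⧸ m) hinj)
  simpa using this

lemma tensor_rep {R A : Type u} [CommRing R] [IsDomain R] [CommRing A] [Algebra R A]
    (t : TensorProduct R (FractionRing R) A) :
    ∃ c : R, c ≠ 0 ∧ ∃ a : A, c • t = (1 : FractionRing R) ⊗ₜ[R] a := by
  induction t with
  | zero => exact ⟨1, one_ne_zero, 0, by simp⟩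
  | add s t hs ht =>
    obtain ⟨c, hc, a, ha⟩ := hs
    obtain ⟨c', hc', a', ha'⟩ := ht
    refine ⟨c * c', mul_ne_zero hc hc', c' • a + c • a', ?_⟩
    rw [smul_add, mul_smul, mul_smul, ha', smul_comm, ha, TensorProduct.tmul_add,
      TensorProduct.tmul_smul, TensorProduct.tmul_smul]
  | tmul k a =>
    obtain ⟨r, s, hs, rfl⟩ := IsFractionRing.div_surjective (A := R) k
    refine ⟨s, nonZeroDivisors.ne_zero hs, r • a, ?_⟩
    rw [TensorProduct.smul_tmul', TensorProduct.tmul_smul, TensorProduct.smul_tmul']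
    congr 1
    have : algebraMap R (FractionRing R) s ≠ 0 :=
      IsFractionRing.to_map_ne_zero_of_mem_nonZeroDivisors hs
    rw [Algebra.smul_def, Algebra.smul_def, mul_one]
    field_simp

lemma tensor_max {R A : Type u} [CommRing R] [IsDomain R] [CommRing A] [Algebra R A]
    (p : Ideal A) [hp : p.IsPrime] (hb : p.comap (algebraMap R A) = ⊥)
    (halg : ∀ a, ∃ f : Polynomial R, f ≠ 0 ∧ Polynomial.aeval a f ∈ p) :
    (p.map (Algebra.TensorProduct.includeRight :
            A →ₐ[R] TensorProduct R (FractionRing R) A)).IsMaximal := by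
  have hinj : Function.Injective (algebraMap R (A ⧸ p)) := inj_quot hb
  have hdvd : ∀ a ∉ p, ∃ c : R, c ≠ 0 ∧ ∃ b, algebraMap R A c - a * b ∈ p := by
    intro a ha
    obtain ⟨f, hf, hfa⟩ := halg a
    have : IsAlgebraic R (Ideal.Quotient.mk p a) := ⟨f, hf, by
      have := Polynomial.aeval_algHom_apply (Ideal.Quotient.mkₐ R p) a f
      exact this.trans (Ideal.Quotient.eq_zero_iff_mem.mpr hfa)⟩
    obtain ⟨c, hc, y, hy⟩ := this.exists_nonzero_dvd
      (mem_nonZeroDivisors_of_ne_zero fun h => ha ((Ideal.Quotient.eq_zero_iff_mem (I := p)).mp h))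
    obtain ⟨y, rfl⟩ := Ideal.Quotient.mk_surjective y
    exact ⟨c, hc, y, (Ideal.Quotient.eq (I := p)).mp (by rw [map_mul]; exact hy)⟩
  have hunit : ∀ (J : Ideal (TensorProduct R (FractionRing R) A)) (c : R), c ≠ 0 → ∀ t, c • t ∈ J → t ∈ J := by
    intro J c hc t ht
    have h0 : algebraMap R (FractionRing R) c ≠ 0 := by simpa using hc
    have : t = ((algebraMap R (FractionRing R) c)⁻¹ ⊗ₜ[R] (1 : A)) * (c • t) := by
      rw [Algebra.smul_def c t, ← mul_assoc, Algebra.TensorProduct.algebraMap_apply,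
        Algebra.TensorProduct.tmul_mul_tmul, inv_mul_cancel₀ h0, mul_one,
        ← Algebra.TensorProduct.one_def, one_mul]
    rw [this]
    exact J.mul_mem_left _ ht
  rw [Ideal.isMaximal_iff]
  constructor
  · let L := FractionRing (A ⧸ p)
    have hRL : Function.Injective (algebraMap R L) := by
      rw [IsScalarTower.algebraMap_eq R (A ⧸ p) L]
      exact (IsFractionRing.injective (A ⧸ p) L).comp hinj
    let φK : FractionRing R →ₐ[R] L := IsFractionRing.liftAlgHom (g := Algebra.ofId R L) hRL
    let φA : A →ₐ[R] L := (IsScalarTower.toAlgHom R (A ⧸ p) L).comp (Ideal.Quotient.mkₐ R p)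
    let φ : TensorProduct R (FractionRing R) A →ₐ[R] L := Algebra.TensorProduct.lift φK φA fun _ _ => .all _ _
    intro h1
    have hle : p.map (Algebra.TensorProduct.includeRight :
            A →ₐ[R] TensorProduct R (FractionRing R) A) ≤ RingHom.ker φ := by
      rw [Ideal.map_le_iff_le_comap]
      intro a ha
      change φ (1 ⊗ₜ a) = 0
      rw [Algebra.TensorProduct.lift_tmul, map_one, one_mul]
      change algebraMap (A ⧸ p) L (Ideal.Quotient.mk p a) = 0
      rw [Ideal.Quotient.eq_zero_iff_mem.mpr ha, map_zero]
    have := hle h1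
    rw [RingHom.mem_ker, map_one] at this
    exact one_ne_zero this
  · intro J t hJ ht htJ
    obtain ⟨c, hc, a, ha⟩ := tensor_rep t
    have haJ : (1 : FractionRing R) ⊗ₜ[R] a ∈ J := by
      rw [← ha]; exact Submodule.smul_of_tower_mem J c htJ
    have hap : a ∉ p := fun h => ht (hunit _ c hc t (by
      rw [ha]; exact Ideal.mem_map_of_mem (Algebra.TensorProduct.includeRight :
            A →ₐ[R] TensorProduct R (FractionRing R) A) h))
    obtain ⟨c', hc', b, hb'⟩ := hdvd a hap
    apply hunit J c' hc'
    have h1 : (1 : FractionRing R) ⊗ₜ[R] (algebraMap R A c' - a * b) ∈ J :=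
      hJ (Ideal.mem_map_of_mem (Algebra.TensorProduct.includeRight :
            A →ₐ[R] TensorProduct R (FractionRing R) A) hb')
    have h2 := J.add_mem h1 (J.mul_mem_right ((1 : FractionRing R) ⊗ₜ[R] b) haJ)
    rw [Algebra.TensorProduct.tmul_mul_tmul, mul_one, ← TensorProduct.tmul_add, sub_add_cancel,
      Algebra.algebraMap_eq_smul_one, TensorProduct.tmul_smul, ← Algebra.TensorProduct.one_def] at h2
    exact h2

end LPI

namespace LPI

lemma ht_loc {A S : Type u} [CommRing A] [CommRing S] [Algebra A S] (M : Submonoid A)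
    [IsLocalization M S] (N : Ideal A) (N' : Ideal S) (hN : N' = N.map (algebraMap A S))
    (P : Ideal S) (hP : N' ≤ P) :
    (P.map (Ideal.Quotient.mk N')).height =
      ((P.comap (algebraMap A S)).map (Ideal.Quotient.mk N)).height := by
  have hNc : N ≤ N'.comap (algebraMap A S) := by rw [hN]; exact Ideal.le_comap_map
  let _ : Algebra (A ⧸ N) (S ⧸ N') := (Ideal.quotientMap N' (algebraMap A S) hNc).toAlgebra
  have hcomp : (Ideal.Quotient.mk N').comp (algebraMap A S) =
      (algebraMap (A ⧸ N) (S ⧸ N')).comp (Ideal.Quotient.mk N) := rfl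
  have : IsLocalization (M.map (Ideal.Quotient.mk N)) (S ⧸ N') :=
    IsLocalization.of_surjective (S := S) M (Ideal.Quotient.mk N) Ideal.Quotient.mk_surjective
      (Ideal.Quotient.mk N') Ideal.Quotient.mk_surjective hcomp (by
        rw [Ideal.mk_ker, Ideal.mk_ker, hN])
  rw [← IsLocalization.height_under (M.map (Ideal.Quotient.mk N)) (P.map (Ideal.Quotient.mk N'))]
  congr 1
  apply Ideal.comap_injective_of_surjective _ (Ideal.Quotient.mk_surjective (I := N))
  rw [Ideal.comap_map_mk (hNc.trans (Ideal.comap_mono hP)), Ideal.under_def, Ideal.comap_comap, ← hcomp,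
    ← Ideal.comap_comap, Ideal.comap_map_mk hP]

lemma main {R A : Type u} [CommRing R] [IsDomain R] [ValuationRing R]
    [CommRing A] [Algebra R A] [Algebra.FormallySmooth R A] [Algebra.FinitePresentation R A]
    (m : Ideal R) (hm : m.IsMaximal) (hm0 : m ≠ ⊥)
    (hprimes : ∀ p : Ideal R, p.IsPrime → p = ⊥ ∨ p = m) (q q' x : Ideal A)
    [hq : q.IsPrime] [hq' : q'.IsPrime] [hx : x.IsPrime] (hqx : q ≤ x) (hqx' : q' ≤ x)
    (hmx : m.map (algebraMap R A) ≤ x)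
    (j j' : ℕ) (hj : q.height = j) (hj' : q'.height = j')
    (hP : ∀ P : Ideal A, P.IsPrime → q ≤ P → q' ≤ P → m.map (algebraMap R A) ≤ P → P ≤ x →
      ((j + j' : ℕ) : ℕ∞) ≤ (P.map (Ideal.Quotient.mk (m.map (algebraMap R A)))).height) :
    ∃ p : Ideal A, p.IsPrime ∧ q ≤ p ∧ q' ≤ p ∧ p ≤ x ∧ p.comap (algebraMap R A) = ⊥ ∧
      (x.IsMaximal → ∀ a, ∃ f : Polynomial R, f ≠ 0 ∧ Polynomial.aeval a f ∈ p) := by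
  have : Algebra.Smooth R A := {}
  obtain ⟨g, hg, d, _, _, hst⟩ :=
    Algebra.IsSmoothAt.exists_isStandardEtale_mvPolynomial (R := R) (p := x)
  let A' := Localization.Away g
  have : Algebra.FiniteType A A' := inferInstance
  have : Algebra.FiniteType R A' := .trans (S := A) inferInstance inferInstance
  have : Algebra.Smooth A A' := inferInstance
  have : Module.Flat R A' := .trans R A A'
  have hdis : ∀ z : Ideal A, z.IsPrime → z ≤ x → Disjoint (Submonoid.powers g : Set A) z :=
    fun z hz hzx => (Ideal.disjoint_powers_iff_notMem_of_isPrime _).mpr fun h => hg (hzx h)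
  have hpr : ∀ z : Ideal A, z.IsPrime → z ≤ x → (z.map (algebraMap A A')).IsPrime :=
    fun z hz hzx => IsLocalization.isPrime_of_isPrime_disjoint (.powers g) _ _ hz (hdis z hz hzx)
  have hcm : ∀ z : Ideal A, z.IsPrime → z ≤ x → (z.map (algebraMap A A')).comap (algebraMap A A') = z :=
    fun z hz hzx => IsLocalization.under_map_of_isPrime_disjoint (.powers g) A' hz (hdis z hz hzx)
  have i1 := hpr q hq hqx
  have i2 := hpr q' hq' hqx'
  have i3 := hpr x hx le_rfl
  have hmm : m.map (algebraMap R A') = (m.map (algebraMap R A)).map (algebraMap A A') := by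
    rw [Ideal.map_map, ← IsScalarTower.algebraMap_eq]
  have hmx' : m.map (algebraMap R A') ≤ x.map (algebraMap A A') := by
    rw [hmm]; exact Ideal.map_mono hmx
  obtain ⟨p, hp, a1, a2, a3, a4, a5⟩ := mainEtale (A := A') d m hm hm0 hprimes (q.map (algebraMap A A'))
    (q'.map (algebraMap A A')) (x.map (algebraMap A A')) (Ideal.map_mono hqx) (Ideal.map_mono hqx')
    hmx' j j'
    (by rw [IsLocalization.height_map_of_disjoint (.powers g) q (hdis q hq hqx), hj])
    (by rw [IsLocalization.height_map_of_disjoint (.powers g) q' (hdis q' hq' hqx'), hj'])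
    (by
      intro P hPp b1 b2 b3 b4
      rw [ht_loc (.powers g) (m.map (algebraMap R A)) _ hmm P b3]
      refine hP _ (Ideal.IsPrime.comap _) (Ideal.map_le_iff_le_comap.mp b1)
        (Ideal.map_le_iff_le_comap.mp b2) (Ideal.map_le_iff_le_comap.mp (hmm ▸ b3)) ?_
      rw [← hcm x hx le_rfl]
      exact Ideal.comap_mono b4)
  refine ⟨p.comap (algebraMap A A'), Ideal.IsPrime.comap _, Ideal.map_le_iff_le_comap.mp a1,
    Ideal.map_le_iff_le_comap.mp a2, ?_, ?_, ?_⟩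
  · rw [← hcm x hx le_rfl]
    exact Ideal.comap_mono a3
  · rw [Ideal.comap_comap, ← IsScalarTower.algebraMap_eq, a4]
  · intro hxm a
    have hmax : (x.map (algebraMap A A')).IsMaximal := by
      obtain ⟨M, hM, hxM⟩ := Ideal.exists_le_maximal _ i3.ne_top
      have h1 : (M.comap (algebraMap A A')).IsPrime := Ideal.IsPrime.comap _
      have h2 := hxm.eq_of_le h1.ne_top (Ideal.map_le_iff_le_comap.mp hxM)
      have h3 : (M.comap (algebraMap A A')).map (algebraMap A A') = M :=
        IsLocalization.map_under (.powers g) A' M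
      rw [h2, h3]
      exact hM
    obtain ⟨f, hf, hfa⟩ := a5 (td_zero m hm _ hmx') (algebraMap A A' a)
    refine ⟨f, hf, ?_⟩
    rwa [Ideal.mem_comap, ← Polynomial.aeval_algebraMap_apply]

end LPI

end

lemma LPI.primeHt_eq {A : Type*} [CommRing A] (p : Ideal A) (hp : p.IsPrime) :
    primeHt p = p.height := by
  rw [primeHt, iSup_pos hp, ← PrimeSpectrum.height_eq_orderHeight]

/-- **Lifting proper intersections over rank-1 valuation rings.**
Let `R` be a valuation ring of rank 1 with maximal ideal `m` and fraction field `K`, and let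
`A` be a smooth `R`-algebra.  Let `I`, `I'` be ideals of pure heights `j`, `j'`, and let `x`
be a prime containing `I + I' + mA` such that every prime `P` minimal over `I + I' + mA` with
`P ⊆ x` has image of height `j + j'` in `A ⧸ mA`.  Then (1) there is a prime `p` with
`I + I' ⊆ p ⊆ x` not containing `mA` (a point of the generic fiber specializing to `x`); and
(2) if `x` is maximal, `p` may be chosen so that its extension to `A ⊗_R K` is maximal. -/
theorem lift_proper_intersection_over_rank_one_valuation_ring
    {R A : Type u} [CommRing R] [IsDomain R] [ValuationRing R]
    (hrank : ringKrullDim R = 1)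
    [CommRing A] [Algebra R A]
    [Algebra.FormallySmooth R A] [Algebra.FinitePresentation R A]
    (I I' : Ideal A) (j j' : ℕ)
    (hIpure : ∀ p ∈ I.minimalPrimes, primeHt p = (j : ℕ∞))
    (hI'pure : ∀ p ∈ I'.minimalPrimes, primeHt p = (j' : ℕ∞))
    (x : Ideal A) (hx : x.IsPrime)
    (hxI : I + I' + (IsLocalRing.maximalIdeal R).map (algebraMap R A) ≤ x)
    (hmin : ∀ P ∈ (I + I' + (IsLocalRing.maximalIdeal R).map (algebraMap R A)).minimalPrimes,
      P ≤ x →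
        primeHt (P.map (Ideal.Quotient.mk
          ((IsLocalRing.maximalIdeal R).map (algebraMap R A)))) = ((j + j' : ℕ) : ℕ∞)) :
    (∃ p : Ideal A, p.IsPrime ∧ I + I' ≤ p ∧ p ≤ x ∧
        ¬ (IsLocalRing.maximalIdeal R).map (algebraMap R A) ≤ p) ∧
      (x.IsMaximal →
        ∃ p : Ideal A, p.IsPrime ∧ I + I' ≤ p ∧ p ≤ x ∧
          ¬ (IsLocalRing.maximalIdeal R).map (algebraMap R A) ≤ p ∧
          (p.map (Algebra.TensorProduct.includeRight :
            A →ₐ[R] TensorProduct R (FractionRing R) A)).IsMaximal) := by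
  have hK : Ring.KrullDimLE 1 R := Ring.krullDimLE_iff.mpr hrank.le
  have hm : (IsLocalRing.maximalIdeal R).IsMaximal := inferInstance
  have hm0 : IsLocalRing.maximalIdeal R ≠ ⊥ := by
    intro h
    have hF : IsField R := IsLocalRing.isField_iff_maximalIdeal_eq.mpr h
    rw [ringKrullDim_eq_zero_of_isField hF] at hrank
    exact zero_ne_one hrank
  have hprimes : ∀ p : Ideal R, p.IsPrime → p = ⊥ ∨ p = IsLocalRing.maximalIdeal R := by
    intro p hp
    by_cases h : p = ⊥
    · exact Or.inl h
    · exact Or.inr (IsLocalRing.eq_maximalIdeal (hp.isMaximal_of_ne_bot h))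
  have hI : I ≤ x := (le_sup_left.trans le_sup_left).trans hxI
  have hI' : I' ≤ x := (le_sup_right.trans le_sup_left).trans hxI
  have hmx : (IsLocalRing.maximalIdeal R).map (algebraMap R A) ≤ x := le_sup_right.trans hxI
  obtain ⟨q, hq, hqx⟩ := Ideal.exists_minimalPrimes_le hI
  obtain ⟨q', hq', hqx'⟩ := Ideal.exists_minimalPrimes_le hI'
  have hqp : q.IsPrime := hq.1.1
  have hqp' : q'.IsPrime := hq'.1.1
  obtain ⟨p, hp, a1, a2, a3, a4, a5⟩ := LPI.main (IsLocalRing.maximalIdeal R) hm hm0 hprimes q q' x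
    hqx hqx' hmx j j' (by rw [← LPI.primeHt_eq q hqp, hIpure q hq])
    (by rw [← LPI.primeHt_eq q' hqp', hI'pure q' hq']) (by
      intro P hP b1 b2 b3 b4
      obtain ⟨P0, hP0, hle⟩ := Ideal.exists_minimalPrimes_le
        (I := I + I' + (IsLocalRing.maximalIdeal R).map (algebraMap R A)) (J := P)
        (sup_le (sup_le (hq.1.2.trans b1) (hq'.1.2.trans b2)) b3)
      have hP0p : P0.IsPrime := hP0.1.1
      have hmP0 : (IsLocalRing.maximalIdeal R).map (algebraMap R A) ≤ P0 := le_sup_right.trans hP0.1.2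
      rw [← hmin P0 hP0 (hle.trans b4), LPI.primeHt_eq _ (LPI.map_mk_prime hmP0)]
      exact Ideal.height_mono (Ideal.map_mono hle))
  have hIp : I + I' ≤ p := sup_le (hq.1.2.trans a1) (hq'.1.2.trans a2)
  have hnm : ¬ (IsLocalRing.maximalIdeal R).map (algebraMap R A) ≤ p := by
    intro h
    rw [Ideal.map_le_iff_le_comap, a4, le_bot_iff] at h
    exact hm0 h
  exact ⟨⟨p, hp, hIp, a3, hnm⟩, fun hxm => ⟨p, hp, hIp, a3, hnm, LPI.tensor_max p a4 (a5 hxm)⟩⟩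
end
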